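/- arXiv:2410.17121 — 3 statements merged into one kernel-verified Lean document; each statement's English description precedes it below -/
import Mathlib

section
/- Let X be a poset and f : X → X a monotone poset map, i.e. an order-preserving map such that f(x) ≤ x for all x ∈ X (or f(x) ≥ x for all x ∈ X). Then the geometric realization of the order complex of X is homotopy equivalent to the geometric realization of the order complex of the image f(X). -/
open scoped Classical

noncomputable section

universe u v

/-- An abstract simplicial complex on a vertex type `V`, given by its set of
faces (finite subsets of `V`), closed under taking subsets. -/
structure AbsSC (V : Type u) where
  faces : Set (Finset V)
  down_closed : ∀ s ∈ faces, ∀ t ⊆ s, t ∈ faces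

namespace AbsSC

/-- The geometric realization of an abstract simplicial complex: the space of
convex-combination functions supported on a face of the complex. -/
def realization {V : Type u} (K : AbsSC V) : Type u :=
  {f : V → ℝ // ∃ s ∈ K.faces, (∀ v ∉ s, f v = 0) ∧ (∀ v, 0 ≤ f v) ∧ ∑ v ∈ s, f v = 1}

instance {V : Type u} (K : AbsSC V) : TopologicalSpace (realization K) :=
  inferInstanceAs (TopologicalSpace {_f : V → ℝ // _})

end AbsSC

/-- The order complex of a poset: its simplices are the finite chains. -/
def orderComplex (X : Type u) [Preorder X] : AbsSC X where
  faces := {s | IsChain (· ≤ ·) (↑s : Set X)}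
  down_closed := fun _s hs _t hts => hs.mono (Finset.coe_subset.mpr hts)

namespace AbsSC

variable {ι : Type*} {Z : Type*} [TopologicalSpace Z]

/-- Finitely supported probability weights on `ι`. -/
structure IsWeight (w : ι → ℝ) : Prop where
  nonneg : ∀ i, 0 ≤ w i
  finite_support : w.support.Finite
  tsum_eq_one : ∑' i, w i = 1

namespace IsWeight

variable {w u : ι → ℝ}

lemma summable (hw : IsWeight w) : Summable w :=
  summable_of_hasFiniteSupport hw.finite_support

lemma of_finset (S : Finset ι) (h0 : ∀ i ∉ S, w i = 0) (hw : ∀ i, 0 ≤ w i)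
    (h1 : ∑ i ∈ S, w i = 1) : IsWeight w where
  nonneg := hw
  finite_support := S.finite_toSet.subset fun i hi => by
    by_contra h
    exact hi (h0 i h)
  tsum_eq_one := by rw [tsum_eq_sum h0, h1]

lemma summable_of_le (hw : IsWeight w) (hu : ∀ i, 0 ≤ u i) (huw : ∀ i, u i ≤ w i) :
    Summable u :=
  hw.summable.of_nonneg_of_le hu huw

lemma summable_ite (hw : IsWeight w) (p : ι → Prop) :
    Summable fun i => if p i then w i else 0 :=
  hw.summable_of_le (fun i => by split_ifs <;> simp [hw.nonneg])
    (fun i => by split_ifs <;> simp [hw.nonneg])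

end IsWeight

/-- Sums dominated by a continuous family of weights are continuous, although the family is only
assumed to be continuous coordinatewise. -/
lemma continuous_tsum_of_le_weight {w u : Z → ι → ℝ} (hw : ∀ z, IsWeight (w z))
    (hwc : ∀ i, Continuous fun z => w z i) (huc : ∀ i, Continuous fun z => u z i)
    (hu : ∀ z i, 0 ≤ u z i) (huw : ∀ z i, u z i ≤ w z i) :
    Continuous fun z => ∑' i, u z i := by
  rw [continuous_iff_continuousAt]
  intro z₀
  set S := (hw z₀).finite_support.toFinset with hS
  have hw0 : ∀ i ∉ S, w z₀ i = 0 := fun i hi => by simpa [hS] using hi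
  have hu0 : ∀ i ∉ S, u z₀ i = 0 := fun i hi =>
    le_antisymm ((huw z₀ i).trans (hw0 i hi).le) (hu z₀ i)
  have hu_sum : ∀ z, Summable (u z) := fun z => (hw z).summable_of_le (hu z) (huw z)
  have hlow : Filter.Tendsto (fun z => ∑ i ∈ S, u z i) (nhds z₀) (nhds (∑' i, u z₀ i)) := by
    rw [tsum_eq_sum hu0]
    exact (continuous_finsetSum S fun i _ => huc i).tendsto z₀
  have hup : Filter.Tendsto (fun z => 1 - ∑ i ∈ S, (w z i - u z i)) (nhds z₀)
      (nhds (∑' i, u z₀ i)) := by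
    have h : ∑' i, u z₀ i = 1 - ∑ i ∈ S, (w z₀ i - u z₀ i) := by
      rw [tsum_eq_sum hu0, ← (hw z₀).tsum_eq_one, tsum_eq_sum hw0, Finset.sum_sub_distrib]
      ring
    rw [h]
    exact (continuous_const.sub
      (continuous_finsetSum S fun i _ => (hwc i).sub (huc i))).tendsto z₀
  refine tendsto_of_tendsto_of_tendsto_of_le_of_le hlow hup (fun z => ?_) (fun z => ?_)
  · exact (hu_sum z).sum_le_tsum S fun i _ => hu z i
  · have h := ((hw z).summable.sub (hu_sum z)).sum_le_tsum S
      fun i _ => sub_nonneg.2 (huw z i)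
    rw [(hw z).summable.tsum_sub (hu_sum z), (hw z).tsum_eq_one] at h
    change ∑' i, u z i ≤ 1 - ∑ i ∈ S, (w z i - u z i)
    linarith

variable {V : Type*} {K : AbsSC V}

lemma realization.isWeight (t : K.realization) : IsWeight t.1 := by
  obtain ⟨S, -, h0, hn, h1⟩ := t.2
  exact .of_finset S h0 hn h1

lemma realization.support_mem_faces (t : K.realization) :
    t.isWeight.finite_support.toFinset ∈ K.faces := by
  obtain ⟨S, hS, h0, -, -⟩ := t.2
  refine K.down_closed S hS _ fun i hi => ?_
  by_contra h
  simp [h0 i h] at hi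

lemma realization.continuous_apply (v : V) : Continuous fun t : K.realization => t.1 v :=
  (_root_.continuous_apply v).comp continuous_subtype_val

/-- The pushforward along `φ : ι → V` of finitely supported weights on `ι`, as a point of the
realization. -/
def ofWeight (φ : ι → V) (w : ι → ℝ) (hw : IsWeight w)
    (hφ : hw.finite_support.toFinset.image φ ∈ K.faces) : K.realization :=
  ⟨fun v => ∑' i, if φ i = v then w i else 0, hw.finite_support.toFinset.image φ, hφ,
    fun v hv => by
      refine (tsum_congr fun i => ?_).trans tsum_zero
      split_ifs with h
      · by_contra hi
        exact hv (Finset.mem_image.2 ⟨i, by simpa using hi, h⟩)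
      · rfl,
    fun v => tsum_nonneg fun i => by split_ifs <;> simp [hw.nonneg],
    by
      have hw0 : ∀ i ∉ hw.finite_support.toFinset, w i = 0 := fun i hi => by simpa using hi
      have h : ∀ v, ∑' i, (if φ i = v then w i else 0) =
          ∑ i ∈ hw.finite_support.toFinset, if φ i = v then w i else 0 := fun v =>
        tsum_eq_sum fun i hi => by simp [hw0 i hi]
      simp_rw [h]
      rw [Finset.sum_comm, ← hw.tsum_eq_one, tsum_eq_sum hw0]
      refine Finset.sum_congr rfl fun i hi => ?_
      rw [Finset.sum_ite_eq, if_pos (Finset.mem_image_of_mem φ hi)]⟩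

lemma continuous_ofWeight (φ : ι → V) (w : Z → ι → ℝ) (hw : ∀ z, IsWeight (w z))
    (hφ : ∀ z, (hw z).finite_support.toFinset.image φ ∈ K.faces)
    (hwc : ∀ i, Continuous fun z => w z i) :
    Continuous fun z => ofWeight φ (w z) (hw z) (hφ z) := by
  refine Continuous.subtype_mk (continuous_pi fun v => ?_) _
  refine continuous_tsum_of_le_weight hw hwc (fun i => ?_) (fun z i => ?_) (fun z i => ?_)
  · split_ifs
    exacts [hwc i, continuous_const]
  all_goals split_ifs <;> simp [(hw z).nonneg]

end AbsSC

namespace orderComplex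

open AbsSC unitInterval

variable {P Q R : Type*} [PartialOrder P] [PartialOrder Q] [PartialOrder R]

lemma isChain_support (t : (orderComplex P).realization) : IsChain (· ≤ ·) t.1.support := by
  have h : IsChain (· ≤ ·) (t.isWeight.finite_support.toFinset : Set P) := t.support_mem_faces
  rwa [Set.Finite.coe_toFinset] at h

lemma image_support_mem_faces (g : P →o Q) (t : (orderComplex P).realization) :
    t.isWeight.finite_support.toFinset.image g ∈ (orderComplex Q).faces := by
  change IsChain _ _
  rw [Finset.coe_image, Set.Finite.coe_toFinset]
  exact g.monotone.isChain_image (isChain_support t)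

/-- The continuous map of realizations induced by an order-preserving map. -/
def map (g : P →o Q) : C((orderComplex P).realization, (orderComplex Q).realization) where
  toFun t := ofWeight g t.1 t.isWeight (image_support_mem_faces g t)
  continuous_toFun := continuous_ofWeight _ _ _ _ realization.continuous_apply

lemma map_apply (g : P →o Q) (t : (orderComplex P).realization) (q : Q) :
    (map g t).1 q = ∑' x, if g x = q then t.1 x else 0 := rfl

lemma map_id : map (OrderHom.id : P →o P) = ContinuousMap.id _ := by
  ext t
  refine Subtype.ext (funext fun q => ?_)
  simp [map_apply]

lemma map_comp (h : Q →o R) (g : P →o Q) : (map h).comp (map g) = map (h.comp g) := by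
  ext t
  refine Subtype.ext (funext fun r => ?_)
  set S := t.isWeight.finite_support.toFinset with hS
  have ht : ∀ x ∉ S, t.1 x = 0 := fun x hx => by simpa [hS] using hx
  have hg : ∀ y, (map g t).1 y = ∑ x ∈ S, if g x = y then t.1 x else 0 := fun y =>
    (map_apply g t y).trans (tsum_eq_sum fun x hx => by simp [ht x hx])
  have hg0 : ∀ y ∉ S.image g, (map g t).1 y = 0 := fun y hy => by
    rw [hg]
    refine Finset.sum_eq_zero fun x hx => if_neg ?_
    rintro rfl
    exact hy (Finset.mem_image_of_mem g hx)
  rw [ContinuousMap.comp_apply, map_apply, map_apply,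
    tsum_eq_sum (s := S.image g) fun y hy => by rw [hg0 y hy, ite_self],
    tsum_eq_sum (s := S) fun x hx => by rw [ht x hx, ite_self]]
  calc ∑ y ∈ S.image g, (if h y = r then (map g t).1 y else 0)
      = ∑ y ∈ S.image g, ∑ x ∈ S,
          if g x = y then (if h (g x) = r then t.1 x else 0) else 0 := by
        refine Finset.sum_congr rfl fun y _ => ?_
        split_ifs with hy
        · rw [hg]
          refine Finset.sum_congr rfl fun x _ => ?_
          by_cases hx : g x = y <;> simp [hx, hy]
        · refine (Finset.sum_eq_zero fun x _ => ?_).symm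
          by_cases hx : g x = y <;> simp [hx, hy]
    _ = ∑ x ∈ S, if h (g x) = r then t.1 x else 0 := by
        rw [Finset.sum_comm]
        refine Finset.sum_congr rfl fun x hx => ?_
        rw [Finset.sum_ite_eq, if_pos (Finset.mem_image_of_mem g hx)]

/-- The mass that `t` puts strictly below `x`. -/
def massBelow (t : (orderComplex P).realization) (x : P) : ℝ :=
  ∑' y, if y < x then t.1 y else 0

lemma massBelow_nonneg (t : (orderComplex P).realization) (x : P) : 0 ≤ massBelow t x :=
  tsum_nonneg fun y => by split_ifs <;> simp [t.isWeight.nonneg]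

lemma massBelow_add (t : (orderComplex P).realization) (x : P) :
    massBelow t x + t.1 x = ∑' y, if y ≤ x then t.1 y else 0 := by
  have hx : ∑' y, (if y = x then t.1 y else 0) = t.1 x := by
    simp
  rw [massBelow, ← hx, ← (t.isWeight.summable_ite _).tsum_add (t.isWeight.summable_ite _)]
  refine tsum_congr fun y => ?_
  rcases eq_or_ne y x with rfl | hne
  · simp
  · simp [hne, lt_iff_le_and_ne]

lemma massBelow_add_le_one (t : (orderComplex P).realization) (x : P) :
    massBelow t x + t.1 x ≤ 1 := by
  rw [massBelow_add]
  refine ((t.isWeight.summable_ite _).tsum_le_tsum (fun y => ?_)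
    t.isWeight.summable).trans_eq t.isWeight.tsum_eq_one
  split_ifs <;> simp [t.isWeight.nonneg]

lemma massBelow_add_le_of_lt (t : (orderComplex P).realization) {x y : P} (h : y < x) :
    massBelow t y + t.1 y ≤ massBelow t x := by
  rw [massBelow_add, massBelow]
  refine (t.isWeight.summable_ite _).tsum_le_tsum (fun z => ?_) (t.isWeight.summable_ite _)
  by_cases hz : z ≤ y
  · simp [hz, hz.trans_lt h]
  · rw [if_neg hz]
    split_ifs <;> simp [t.isWeight.nonneg]

lemma continuous_massBelow (x : P) :
    Continuous fun t : (orderComplex P).realization => massBelow t x := by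
  refine continuous_tsum_of_le_weight (fun t => t.isWeight) realization.continuous_apply
    (fun y => ?_) (fun t y => ?_) (fun t y => ?_)
  · split_ifs
    exacts [realization.continuous_apply y, continuous_const]
  all_goals split_ifs <;> simp [t.isWeight.nonneg]

/-- The part at `x` of the lowest `s` units of mass of `t`. -/
def lowerMass (s : ℝ) (t : (orderComplex P).realization) (x : P) : ℝ :=
  min (t.1 x) (max 0 (s - massBelow t x))

lemma lowerMass_nonneg (s : ℝ) (t : (orderComplex P).realization) (x : P) :
    0 ≤ lowerMass s t x :=
  le_min (t.isWeight.nonneg x) (le_max_left _ _)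

lemma lowerMass_le (s : ℝ) (t : (orderComplex P).realization) (x : P) :
    lowerMass s t x ≤ t.1 x :=
  min_le_left _ _

lemma lowerMass_zero (t : (orderComplex P).realization) (x : P) : lowerMass 0 t x = 0 := by
  rw [lowerMass, max_eq_left (by linarith [massBelow_nonneg t x]),
    min_eq_right (t.isWeight.nonneg x)]

lemma lowerMass_one (t : (orderComplex P).realization) (x : P) : lowerMass 1 t x = t.1 x :=
  min_eq_left (le_max_of_le_right (by linarith [massBelow_add_le_one t x]))

lemma continuous_lowerMass (x : P) :
    Continuous fun z : I × (orderComplex P).realization => lowerMass z.1 z.2 x :=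
  ((realization.continuous_apply x).comp continuous_snd).min
    (continuous_const.max ((continuous_subtype_val.comp continuous_fst).sub
      ((continuous_massBelow x).comp continuous_snd)))

/-- If part of the lower mass lies at `x` and part of the upper mass lies at `y`, then `x ≤ y`. -/
lemma le_of_lowerMass {s : ℝ} {t : (orderComplex P).realization} {x y : P}
    (hx : lowerMass s t x ≠ 0) (hy : t.1 y - lowerMass s t y ≠ 0) : x ≤ y := by
  have hx' : 0 < lowerMass s t x := (lowerMass_nonneg s t x).lt_of_ne' hx
  have hy' : lowerMass s t y < t.1 y := by
    linarith [(sub_nonneg.2 (lowerMass_le s t y)).lt_of_ne' hy]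
  have htx : t.1 x ≠ 0 := (hx'.trans_le (lowerMass_le s t x)).ne'
  have hty : t.1 y ≠ 0 := ((lowerMass_nonneg s t y).trans_lt hy').ne'
  by_contra hxy
  have hlt : y < x := lt_of_le_not_ge
    (((isChain_support t).total htx hty).resolve_left hxy) hxy
  have h₁ : massBelow t x < s := by
    simpa using (lt_min_iff.1 hx').2
  have h₂ : s - massBelow t y < t.1 y := by
    exact (max_lt_iff.1 ((min_lt_iff.1 hy').resolve_left (lt_irrefl _))).2
  linarith [massBelow_add_le_of_lt t hlt]

/-- The decomposition of `t` into its lower and upper mass, as a weight on two copies of `P`. -/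
def prismWeight (s : ℝ) (t : (orderComplex P).realization) : P ⊕ P → ℝ :=
  Sum.elim (lowerMass s t) fun x => t.1 x - lowerMass s t x

lemma isWeight_prismWeight (s : ℝ) (t : (orderComplex P).realization) :
    IsWeight (prismWeight s t) := by
  set S := t.isWeight.finite_support.toFinset with hS
  have ht : ∀ x ∉ S, t.1 x = 0 := fun x hx => by simpa [hS] using hx
  have hl : ∀ x ∉ S, lowerMass s t x = 0 := fun x hx =>
    le_antisymm ((lowerMass_le s t x).trans (ht x hx).le) (lowerMass_nonneg s t x)
  refine .of_finset (S.disjSum S) ?_ ?_ ?_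
  · rintro (x | x) hx
    · exact hl x (by simpa using hx)
    · have hx : x ∉ S := by simpa using hx
      simp [prismWeight, ht x hx, hl x hx]
  · rintro (x | x)
    exacts [lowerMass_nonneg s t x, sub_nonneg.2 (lowerMass_le s t x)]
  · rw [Finset.sum_disjSum, ← t.isWeight.tsum_eq_one, tsum_eq_sum ht]
    simp [prismWeight]

lemma isChain_image_prismWeight {g h : P →o Q} (hgh : g ≤ h) (s : ℝ)
    (t : (orderComplex P).realization) :
    IsChain (· ≤ ·) (Sum.elim g h '' (prismWeight s t).support) := by
  have hl : ∀ x, lowerMass s t x ≠ 0 → x ∈ t.1.support := fun x hx =>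
    (((lowerMass_nonneg s t x).lt_of_ne' hx).trans_le (lowerMass_le s t x)).ne'
  have hr : ∀ x, t.1 x - lowerMass s t x ≠ 0 → x ∈ t.1.support := fun x hx h0 => by
    have := lowerMass_le s t x
    have := lowerMass_nonneg s t x
    exact hx (by linarith)
  have hle : ∀ {x y}, lowerMass s t x ≠ 0 → t.1 y - lowerMass s t y ≠ 0 → g x ≤ h y :=
    fun hx hy => (g.monotone (le_of_lowerMass hx hy)).trans (hgh _)
  rintro _ ⟨x | x, hx, rfl⟩ _ ⟨y | y, hy, rfl⟩ -
  · exact ((isChain_support t).total (hl x hx) (hl y hy)).imp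
      (fun h => g.monotone h) (fun h => g.monotone h)
  · exact .inl (hle hx hy)
  · exact .inr (hle hy hx)
  · exact ((isChain_support t).total (hr x hx) (hr y hy)).imp
      (fun h' => h.monotone h') (fun h' => h.monotone h')

lemma homotopic_map_of_le {g h : P →o Q} (hgh : g ≤ h) : (map h).Homotopic (map g) := by
  refine ⟨⟨⟨fun z => ofWeight (Sum.elim g h) (prismWeight z.1 z.2)
    (isWeight_prismWeight z.1 z.2) ?_, ?_⟩, fun t => ?_, fun t => ?_⟩⟩
  · change IsChain _ _
    rw [Finset.coe_image, Set.Finite.coe_toFinset]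
    exact isChain_image_prismWeight hgh _ _
  · refine continuous_ofWeight _ _ _ _ ?_
    rintro (x | x)
    exacts [continuous_lowerMass x,
      ((realization.continuous_apply x).comp continuous_snd).sub (continuous_lowerMass x)]
  · refine Subtype.ext (funext fun q => ?_)
    change (∑' i, if Sum.elim g h i = q then prismWeight (0 : I) t i else 0) = _
    rw [← Sum.inr_injective.tsum_eq, map_apply]
    · simp [prismWeight, lowerMass_zero]
    · rintro (x | x) hx
      · exact absurd (by simp [prismWeight, lowerMass_zero]) hx
      · exact ⟨x, rfl⟩
  · refine Subtype.ext (funext fun q => ?_)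
    change (∑' i, if Sum.elim g h i = q then prismWeight (1 : I) t i else 0) = _
    rw [← Sum.inl_injective.tsum_eq, map_apply]
    · simp [prismWeight, lowerMass_one]
    · rintro (x | x) hx
      · exact ⟨x, rfl⟩
      · exact absurd (by simp [prismWeight, lowerMass_one]) hx

lemma homotopic_map_id {g : P →o P} (hg : (∀ x, g x ≤ x) ∨ ∀ x, x ≤ g x) :
    (map g).Homotopic (ContinuousMap.id _) := by
  rw [← map_id]
  rcases hg with hg | hg
  · exact (homotopic_map_of_le (h := OrderHom.id) hg).symm
  · exact homotopic_map_of_le (g := OrderHom.id) hg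

end orderComplex

/-- If `f` is a monotone poset map (order-preserving with
`f x ≤ x` for all `x`, or `x ≤ f x` for all `x`), then the geometric
realization of the order complex of `X` is homotopy equivalent to that of the
order complex of the image `f(X)`. -/
theorem monotone_poset_map_realization_homotopyEquiv_image
    {X : Type u} [PartialOrder X] (f : X →o X)
    (hf : (∀ x, f x ≤ x) ∨ (∀ x, x ≤ f x)) :
    Nonempty (ContinuousMap.HomotopyEquiv
      (AbsSC.realization (orderComplex X))
      (AbsSC.realization (orderComplex ↥(Set.range ⇑f)))) := by
  let r : X →o Set.range f := ⟨Set.rangeFactorization f, fun _ _ h => f.monotone h⟩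
  let i : Set.range f →o X := OrderHom.Subtype.val _
  refine ⟨⟨orderComplex.map r, orderComplex.map i, ?_, ?_⟩⟩
  · rw [orderComplex.map_comp]
    exact orderComplex.homotopic_map_id hf
  · rw [orderComplex.map_comp]
    exact orderComplex.homotopic_map_id (hf.imp (fun h x => h x) (fun h x => h x))
end
end

section
/- Let (G, l) be a connected finite labelled graph. If G contains an l-separating edge e, then the order complex of the poset X(G,l) of proper subgraphs with a component of non-trivial fundamental group or with at least two labelled vertices is contractible. -/
open scoped Classical

noncomputable section

universe u v

/-- A finite multigraph (loops and multiple edges allowed): a finite vertex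
type, a finite edge type and an endpoint map assigning to each edge an
unordered pair of vertices. -/
structure MGraph where
  V : Type
  E : Type
  [fV : Fintype V]
  [fE : Fintype E]
  ends : E → Sym2 V

attribute [instance] MGraph.fV MGraph.fE

namespace MGraph

variable (G : MGraph)

/-- The valence of a vertex `v` in the (edge-induced) subgraph `H` of `G`:
the number of half-edges of `H` adjacent to `v` (a loop counts twice). -/
def valence (H : Finset G.E) (v : G.V) : ℕ :=
  ∑ e ∈ H, (if G.ends e = Sym2.diag v then 2 else if v ∈ G.ends e then 1 else 0)

/-- `v` is a vertex of the edge-induced subgraph `H`. -/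
def vertexIn (H : Finset G.E) (v : G.V) : Prop := ∃ e ∈ H, v ∈ G.ends e

/-- Two vertices of `G` are connected by an edge path within the subgraph `H`. -/
def vconn (H : Finset G.E) : G.V → G.V → Prop :=
  Relation.ReflTransGen (fun a b => ∃ e ∈ H, G.ends e = s(a, b))

/-- The graph `G` is connected. -/
def Conn : Prop := ∀ u v : G.V, G.vconn Finset.univ u v

/-- `G` has no isolated vertices. -/
def NoIsolated : Prop := ∀ v : G.V, ∃ e : G.E, v ∈ G.ends e

/-- The subgraph `H` has a connected component with non-trivial fundamental
group, i.e. `H` contains a cycle: equivalently, `H` contains a non-empty edge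
subset in which no vertex has valence one. -/
def hasCycle (H : Finset G.E) : Prop :=
  ∃ S : Finset G.E, S ⊆ H ∧ S.Nonempty ∧ ∀ v, G.valence S v ≠ 1

/-- Defining condition of the poset `X(G,l)`: the subgraph `H` has a connected
component with non-trivial fundamental group, or a connected component
containing at least two labelled vertices. -/
def inX (l : Finset G.V) (H : Finset G.E) : Prop :=
  G.hasCycle H ∨ ∃ u v, u ∈ l ∧ v ∈ l ∧ u ≠ v ∧ G.vconn H u v

/-- The poset `X(G,l)` of proper subgraphs of `G` having a connected component
with non-trivial fundamental group or with at least two labelled vertices,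
ordered by inclusion. -/
def XP (l : Finset G.V) : Type :=
  {H : Finset G.E // H ⊂ Finset.univ ∧ G.inX l H}

instance (l : Finset G.V) : PartialOrder (G.XP l) :=
  inferInstanceAs (PartialOrder {_H : Finset G.E // _})

/-- A core subgraph of the labelled graph `(G,l)`: a non-empty subgraph in
which every vertex of valence one is labelled. -/
def IsCore (l : Finset G.V) (H : Finset G.E) : Prop :=
  H.Nonempty ∧ ∀ v, G.valence H v = 1 → v ∈ l

/-- The edge `e` is separating: removing an interior point of `e` disconnects
`G`; combinatorially, `e` is not a loop and its two endpoints are not connected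
in the graph with `e` deleted (in particular, leaves are separating). -/
def Separating (e : G.E) : Prop :=
  ∀ a b, G.ends e = s(a, b) → ¬ G.vconn (Finset.univ.erase e) a b

/-- The edge `e` of `(G,l)` is `l`-separating: it is separating, one of the
components of `G` minus the interior of `e` contains all labelled vertices, and
`G` with `e` deleted satisfies the defining condition of `X(G,l)`. -/
def LSep (l : Finset G.V) (e : G.E) : Prop :=
  G.Separating e ∧
  (∃ a, a ∈ G.ends e ∧ ∀ u ∈ l, G.vconn (Finset.univ.erase e) a u) ∧
  G.inX l (Finset.univ.erase e)

end MGraph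

namespace AbsSC

section Push

variable {X : Type u} [Fintype X]

/-- Pushforward of a weight function along a map. -/
def push (f : X → X) (w : X → ℝ) (v : X) : ℝ := ∑ x, if f x = v then w x else 0

theorem push_nonneg (f : X → X) {w : X → ℝ} (hw : ∀ x, 0 ≤ w x) (v : X) : 0 ≤ push f w v :=
  Finset.sum_nonneg fun x _ => by split_ifs <;> simp [hw]

theorem sum_push (f : X → X) (w : X → ℝ) : ∑ v, push f w v = ∑ x, w x := by
  unfold push
  rw [Finset.sum_comm]
  simp

theorem exists_of_push_ne_zero {f : X → X} {w : X → ℝ} {v : X} (h : push f w v ≠ 0) :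
    ∃ x, f x = v ∧ w x ≠ 0 := by
  obtain ⟨x, _, hx⟩ := Finset.exists_ne_zero_of_sum_ne_zero h
  split_ifs at hx with hv
  · exact ⟨x, hv, hx⟩
  · exact absurd rfl hx

theorem continuous_push {Y : Type*} [TopologicalSpace Y] (f : X → X) {w : Y → X → ℝ}
    (hw : ∀ x, Continuous fun y => w y x) (v : X) : Continuous fun y => push f (w y) v := by
  unfold push
  refine continuous_finsetSum _ fun x _ => ?_
  split_ifs
  · exact hw x
  · exact continuous_const

end Push

section OrderComplex

variable {X : Type u} [PartialOrder X]

theorem realization.nonneg (p : realization (orderComplex X)) (x : X) : 0 ≤ p.1 x := by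
  obtain ⟨_, _, _, h, _⟩ := p.2
  exact h x

theorem realization.isChain (p : realization (orderComplex X)) :
    IsChain (· ≤ ·) {x | p.1 x ≠ 0} := by
  obtain ⟨s, hs, h0, _, _⟩ := p.2
  refine IsChain.mono ?_ hs
  intro x hx
  by_contra h
  exact hx (h0 x h)

variable [Fintype X]

/-- A probability vector on a finite poset whose support is a chain, as a point of the realization
of the order complex. -/
def ofWeights (w : X → ℝ) (h0 : ∀ x, 0 ≤ w x) (h1 : ∑ x, w x = 1)
    (hc : IsChain (· ≤ ·) {x | w x ≠ 0}) : realization (orderComplex X) :=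
  ⟨w, Finset.univ.filter fun x => w x ≠ 0, by simpa [orderComplex] using hc, by simp, h0, by
    rw [Finset.sum_filter_ne_zero, h1]⟩

theorem realization.sum_eq_one (p : realization (orderComplex X)) : ∑ x, p.1 x = 1 := by
  obtain ⟨s, _, h0, _, h1⟩ := p.2
  exact (Finset.sum_subset (Finset.subset_univ s) fun x _ hx => h0 x hx).symm.trans h1

/-- The part of the weight at `x` lying in the first `t` units of mass, counted from below. -/
def lowerPart (t : ℝ) (w : X → ℝ) (x : X) : ℝ :=
  min (w x) (max 0 (t - ∑ y with y < x, w y))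

theorem lowerPart_nonneg (t : ℝ) {w : X → ℝ} (hw : ∀ x, 0 ≤ w x) (x : X) :
    0 ≤ lowerPart t w x := le_min (hw x) (le_max_left _ _)

theorem lowerPart_le (t : ℝ) (w : X → ℝ) (x : X) : lowerPart t w x ≤ w x := min_le_left _ _

theorem add_sum_lt_le {w : X → ℝ} (hw : ∀ x, 0 ≤ w x) {s : Finset X} {x : X} (hx : x ∈ s)
    (hs : ∀ y < x, y ∈ s) : w x + ∑ y with y < x, w y ≤ ∑ y ∈ s, w y := by
  rw [← Finset.sum_insert (s := Finset.univ.filter (· < x)) (by simp)]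
  refine Finset.sum_le_sum_of_subset_of_nonneg ?_ fun y _ _ => hw y
  intro y hy
  rcases Finset.mem_insert.1 hy with rfl | hy
  · exact hx
  · exact hs y (by simpa using hy)

theorem lowerPart_zero {w : X → ℝ} (hw : ∀ x, 0 ≤ w x) (x : X) : lowerPart 0 w x = 0 := by
  have : 0 ≤ ∑ y with y < x, w y := Finset.sum_nonneg fun y _ => hw y
  rw [lowerPart, max_eq_left (by linarith), min_eq_right (hw x)]

theorem lowerPart_one {w : X → ℝ} (hw : ∀ x, 0 ≤ w x) (h1 : ∑ x, w x = 1) (x : X) :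
    lowerPart 1 w x = w x := by
  have := add_sum_lt_le hw (Finset.mem_univ x) fun y _ => Finset.mem_univ y
  exact min_eq_left (le_max_of_le_right (by linarith))

theorem lowerPart_eq_of_lt {t : ℝ} {w : X → ℝ} (hw : ∀ x, 0 ≤ w x) {x y : X} (hxy : x < y)
    (hy : lowerPart t w y ≠ 0) : lowerPart t w x = w x := by
  have := add_sum_lt_le (s := Finset.univ.filter (· < y)) hw (by simpa using hxy)
    fun z hz => by simpa using hz.trans hxy
  refine min_eq_left (le_max_of_le_right ?_)
  by_contra! h
  refine hy ?_
  rw [lowerPart, max_eq_left (by linarith), min_eq_right (hw y)]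

/-- The map induced on the realization by a monotone map of posets. -/
def realizationMap (f : X →o X) : C(realization (orderComplex X), realization (orderComplex X)) where
  toFun p := ofWeights (push f p.1) (push_nonneg f p.nonneg)
    ((sum_push f p.1).trans p.sum_eq_one) (by
      intro u hu v hv _
      obtain ⟨x, rfl, hx⟩ := exists_of_push_ne_zero hu
      obtain ⟨y, rfl, hy⟩ := exists_of_push_ne_zero hv
      exact (p.isChain.total hx hy).imp (fun h => f.monotone h) fun h => f.monotone h)
  continuous_toFun := by
    refine Continuous.subtype_mk (continuous_pi fun v => ?_) _
    exact continuous_push f (fun x => (continuous_apply x).comp continuous_subtype_val) v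

/-- A monotone map lying below the identity induces a map homotopic to the identity. -/
theorem id_homotopic_realizationMap (f : X →o X) (hf : ∀ x, f x ≤ x) :
    (ContinuousMap.id (realization (orderComplex X))).Homotopic (realizationMap f) := by
  have hcont : ∀ x, Continuous fun q : unitInterval × realization (orderComplex X) =>
      q.2.1 x := fun x =>
    (continuous_apply x).comp (continuous_subtype_val.comp continuous_snd)
  have hlow : ∀ x, Continuous fun q : unitInterval × realization (orderComplex X) =>
      lowerPart q.1 q.2.1 x := fun x => by
    refine (hcont x).min (continuous_const.max ?_)
    exact (continuous_subtype_val.comp continuous_fst).sub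
      (continuous_finsetSum _ fun y _ => hcont y)
  refine ⟨⟨⟨fun q => ofWeights
    (fun v => q.2.1 v - lowerPart q.1 q.2.1 v + push f (lowerPart q.1 q.2.1) v)
    (fun v => ?_) ?_ ?_, ?_⟩, ?_, ?_⟩⟩
  · exact add_nonneg (sub_nonneg.2 (lowerPart_le _ _ _))
      (push_nonneg f (lowerPart_nonneg _ q.2.nonneg) v)
  · rw [Finset.sum_add_distrib, Finset.sum_sub_distrib, sum_push, sub_add_cancel,
      q.2.sum_eq_one]
  · obtain ⟨t, p⟩ := q
    have hsupp : ∀ v, p.1 v - lowerPart t p.1 v + push f (lowerPart t p.1) v ≠ 0 →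
        (lowerPart t p.1 v ≠ p.1 v ∧ p.1 v ≠ 0) ∨
          ∃ x, f x = v ∧ lowerPart t p.1 x ≠ 0 ∧ p.1 x ≠ 0 := by
      intro v hv
      have hle : ∀ x, lowerPart t p.1 x ≠ 0 → p.1 x ≠ 0 := fun x hx h =>
        hx (le_antisymm ((lowerPart_le t p.1 x).trans h.le) (lowerPart_nonneg _ p.nonneg x))
      by_cases h : push f (lowerPart t p.1) v = 0
      · left
        have hne : lowerPart t p.1 v ≠ p.1 v := fun h' => hv (by rw [h, h']; ring)
        refine ⟨hne, fun h0 => hne ?_⟩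
        by_contra h'
        exact hle v (by rwa [h0] at h') h0
      · right
        obtain ⟨x, hx, hx'⟩ := exists_of_push_ne_zero h
        exact ⟨x, hx, hx', hle x hx'⟩
    have hmix : ∀ u y, lowerPart t p.1 u ≠ p.1 u → p.1 u ≠ 0 → lowerPart t p.1 y ≠ 0 →
        p.1 y ≠ 0 → f y ≤ u := by
      intro u y hu hu' hy hy'
      refine (hf y).trans ?_
      rcases p.isChain.total hu' hy' with h | h
      · rcases h.eq_or_lt with rfl | h
        · exact le_rfl
        · exact absurd (lowerPart_eq_of_lt p.nonneg h hy) hu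
      · exact h
    intro u hu v hv _
    rcases hsupp u hu with ⟨hu, hu'⟩ | ⟨x, rfl, hx, hx'⟩ <;>
      rcases hsupp v hv with ⟨hv, hv'⟩ | ⟨y, rfl, hy, hy'⟩
    · exact p.isChain.total hu' hv'
    · exact Or.inr (hmix _ _ hu hu' hy hy')
    · exact Or.inl (hmix _ _ hv hv' hx hx')
    · exact (p.isChain.total hx' hy').imp (fun h => f.monotone h) fun h => f.monotone h
  · refine Continuous.subtype_mk (continuous_pi fun v => ?_) _
    exact ((hcont v).sub (hlow v)).add (continuous_push f hlow v)
  · intro p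
    refine Subtype.ext (funext fun v => ?_)
    have : lowerPart 0 p.1 = fun _ => 0 := funext (lowerPart_zero p.nonneg)
    simp [ofWeights, this, push]
  · intro p
    refine Subtype.ext (funext fun v => ?_)
    have : lowerPart 1 p.1 = p.1 := funext (lowerPart_one p.nonneg p.sum_eq_one)
    change p.1 v - lowerPart 1 p.1 v + push f (lowerPart 1 p.1) v = push f p.1 v
    simp [this]

/-- The vertex of the order complex given by an element of the poset. -/
def vertex (c : X) : realization (orderComplex X) :=
  ofWeights (Pi.single c 1) (fun x => by by_cases h : x = c <;> simp [h])
    (by simp) (by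
      intro x hx y hy hxy
      have key : ∀ z, (Pi.single c 1 : X → ℝ) z ≠ 0 → z = c := fun z hz => by
        by_contra h
        exact hz (by simp [h])
      exact absurd ((key x hx).trans (key y hy).symm) hxy)

/-- A monotone map bounded above induces a null-homotopic map. -/
theorem realizationMap_homotopic_const (f : X →o X) (c : X) (hf : ∀ x, f x ≤ c) :
    (realizationMap f).Homotopic (ContinuousMap.const _ (vertex c)) := by
  have hcont : ∀ v, Continuous fun q : unitInterval × realization (orderComplex X) =>
      (realizationMap f q.2).1 v := fun v =>
    (continuous_apply v).comp
      (continuous_subtype_val.comp ((realizationMap f).continuous.comp continuous_snd))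
  have ht : Continuous fun q : unitInterval × realization (orderComplex X) => (q.1 : ℝ) :=
    continuous_subtype_val.comp continuous_fst
  refine ⟨⟨⟨fun q => ofWeights
    (fun v => (1 - (q.1 : ℝ)) * (realizationMap f q.2).1 v + q.1 * (vertex c).1 v)
    (fun v => ?_) ?_ ?_, ?_⟩, ?_, ?_⟩⟩
  · exact add_nonneg (mul_nonneg (sub_nonneg.2 q.1.2.2) (realization.nonneg _ v))
      (mul_nonneg q.1.2.1 (realization.nonneg _ v))
  · rw [Finset.sum_add_distrib, ← Finset.mul_sum, ← Finset.mul_sum, realization.sum_eq_one,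
      realization.sum_eq_one]
    ring
  · obtain ⟨t, p⟩ := q
    have hsupp : ∀ v, (1 - (t : ℝ)) * (realizationMap f p).1 v + t * (vertex c).1 v ≠ 0 →
        v = c ∨ (realizationMap f p).1 v ≠ 0 := by
      intro v hv
      by_contra! h
      refine hv ?_
      rw [h.2]
      simp [vertex, ofWeights, h.1]
    have hle : ∀ v, (realizationMap f p).1 v ≠ 0 → v ≤ c := by
      intro v hv
      obtain ⟨x, rfl, _⟩ := exists_of_push_ne_zero hv
      exact hf x
    intro u hu v hv _
    rcases hsupp u hu with rfl | hu' <;> rcases hsupp v hv with rfl | hv'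
    · exact Or.inl le_rfl
    · exact Or.inr (hle v hv')
    · exact Or.inl (hle u hu')
    · exact (realizationMap f p).isChain.total hu' hv'
  · refine Continuous.subtype_mk (continuous_pi fun v => ?_) _
    exact ((continuous_const.sub ht).mul (hcont v)).add (ht.mul continuous_const)
  · intro p
    refine Subtype.ext (funext fun v => ?_)
    simp [ofWeights]
  · intro p
    refine Subtype.ext (funext fun v => ?_)
    simp [ofWeights]

/-- A finite poset that is conically contractible via `x ≥ f x ≤ c` has a contractible order
complex. -/
theorem contractibleSpace_orderComplex (f : X →o X) (c : X) (hid : ∀ x, f x ≤ x)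
    (hc : ∀ x, f x ≤ c) : ContractibleSpace (realization (orderComplex X)) :=
  (contractible_iff_id_nullhomotopic _).2
    ⟨vertex c, (id_homotopic_realizationMap f hid).trans (realizationMap_homotopic_const f c hc)⟩

end OrderComplex

end AbsSC

namespace MGraph

variable {G : MGraph}

theorem valence_erase {H : Finset G.E} {e : G.E} (he : e ∈ H) (v : G.V) :
    G.valence (H.erase e) v +
      (if G.ends e = Sym2.diag v then 2 else if v ∈ G.ends e then 1 else 0) = G.valence H v :=
  Finset.sum_erase_add _ _ he

theorem exists_of_valence_ne_zero {H : Finset G.E} {v : G.V} (h : G.valence H v ≠ 0) :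
    ∃ e ∈ H, v ∈ G.ends e := by
  obtain ⟨e, he, hne⟩ := Finset.exists_ne_zero_of_sum_ne_zero h
  refine ⟨e, he, ?_⟩
  by_contra hv
  refine hne ?_
  rw [if_neg, if_neg hv]
  intro h'
  exact hv (by rw [h']; simp [Sym2.diag])

theorem valence_eq_of_incident {S H : Finset G.E} (hSH : S ⊆ H) {v : G.V}
    (h : ∀ f ∈ H, v ∈ G.ends f → f ∈ S) : G.valence S v = G.valence H v := by
  refine Finset.sum_subset hSH fun f hf hfS => ?_
  have hv : v ∉ G.ends f := fun hv => hfS (h f hf hv)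
  rw [if_neg, if_neg hv]
  intro h'
  exact hv (by rw [h']; simp [Sym2.diag])

/-- A non-empty subgraph with at most one vertex of valence one contains a cycle. -/
theorem hasCycle_of_valence_ne_one {S : Finset G.E} (hS : S.Nonempty) (p : G.V)
    (h : ∀ v, v ≠ p → G.valence S v ≠ 1) : G.hasCycle S := by
  induction S using Finset.strongInduction generalizing p with
  | H S ih =>
    by_cases hp : G.valence S p = 1
    · obtain ⟨f, hfS, hpf⟩ := exists_of_valence_ne_zero (by omega : G.valence S p ≠ 0)
      obtain ⟨q, hq⟩ := hpf
      have hqp : q ≠ p := by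
        rintro rfl
        have := valence_erase hfS q
        rw [if_pos (by rw [hq]; rfl)] at this
        omega
      have hval : ∀ v, (if G.ends f = Sym2.diag v then 2 else if v ∈ G.ends f then 1 else 0)
          = if v = p ∨ v = q then 1 else 0 := by
        intro v
        rw [if_neg]
        · simp only [hq, Sym2.mem_iff]
        rw [hq]
        intro h'
        have hpv : p ∈ Sym2.diag v := h' ▸ Sym2.mem_mk_left p q
        have hqv : q ∈ Sym2.diag v := h' ▸ Sym2.mem_mk_right p q
        simp only [Sym2.diag, Sym2.mem_iff, or_self] at hpv hqv
        exact hqp (hqv.trans hpv.symm)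
      have herase : ∀ v, G.valence (S.erase f) v + (if v = p ∨ v = q then 1 else 0)
          = G.valence S v := fun v => by rw [← hval, valence_erase hfS]
      have hne : (S.erase f).Nonempty := by
        by_contra hemp
        rw [Finset.not_nonempty_iff_eq_empty] at hemp
        have := herase q
        rw [hemp, if_pos (Or.inr rfl)] at this
        exact h q hqp (by simpa [valence] using this.symm)
      obtain ⟨T, hT, hT'⟩ := ih _ (Finset.erase_ssubset hfS) hne q (by
        intro v hv hv1
        have := herase v
        by_cases hvp : v = p
        · rw [if_pos (Or.inl hvp), hv1, hvp, hp] at this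
          omega
        · rw [if_neg (by tauto), hv1] at this
          exact h v hvp this.symm)
      exact ⟨T, hT.trans (Finset.erase_subset _ _), hT'⟩
    · refine ⟨S, subset_rfl, hS, fun v => ?_⟩
      by_cases hv : v = p
      · rwa [hv]
      · exact h v hv

theorem hasCycle.mono {H K : Finset G.E} (hHK : H ⊆ K) (h : G.hasCycle H) : G.hasCycle K := by
  obtain ⟨S, hS, hS'⟩ := h
  exact ⟨S, hS.trans hHK, hS'⟩

/-- Deleting a separating edge from a subgraph with a cycle leaves a cycle. -/
theorem hasCycle.erase_of_separating {e : G.E} (he : G.Separating e) {H : Finset G.E}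
    (h : G.hasCycle H) : G.hasCycle (H.erase e) := by
  obtain ⟨S, hSH, hne, hS⟩ := h
  by_cases heS : e ∈ S
  swap
  · exact ⟨S, Finset.subset_erase.2 ⟨hSH, heS⟩, hne, hS⟩
  obtain ⟨a, b, hab⟩ : ∃ a b, G.ends e = s(a, b) := by
    induction h : G.ends e using Sym2.ind with | _ a b => exact ⟨a, b, rfl⟩
  have hsep := he a b hab
  let A : G.V → Prop := G.vconn (Finset.univ.erase e) a
  let T := (S.erase e).filter fun f => ∃ v ∈ G.ends f, A v
  have hA : ∀ f, f ≠ e → ∀ v ∈ G.ends f, ∀ w ∈ G.ends f, A v → A w := by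
    rintro f hf v ⟨x, hx⟩ w hw hv
    rw [hx, Sym2.mem_iff] at hw
    rcases hw with rfl | rfl
    · exact hv
    · exact hv.tail ⟨f, by simp [hf], hx⟩
  have hT : T ⊆ H.erase e := (Finset.filter_subset _ _).trans (Finset.erase_subset_erase _ hSH)
  refine (hasCycle_of_valence_ne_one (S := T) ?_ a fun v hva hv => ?_).mono hT
  · have haval := valence_erase heS a
    have hab' : a ≠ b := by
      rintro rfl
      exact hsep .refl
    rw [if_neg, if_pos (by rw [hab]; simp)] at haval
    · obtain ⟨f, hf, haf⟩ := exists_of_valence_ne_zero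
        (H := S.erase e) (v := a) (fun h0 => hS a (by omega))
      exact ⟨f, Finset.mem_filter.2 ⟨hf, a, haf, .refl⟩⟩
    · intro h'
      have hb : b ∈ Sym2.diag a := by rw [← h', hab]; simp
      exact hab' (by simpa [Sym2.diag, eq_comm] using hb)
  · obtain ⟨f, hf, hvf⟩ := exists_of_valence_ne_zero (by omega : G.valence T v ≠ 0)
    obtain ⟨hf, w, hw, hAw⟩ := Finset.mem_filter.1 hf
    have hAv : A v := hA f (Finset.ne_of_mem_erase hf) w hw v hvf hAw
    refine hS v ?_
    rw [← hv]
    refine (valence_eq_of_incident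
      ((Finset.filter_subset _ _).trans (Finset.erase_subset _ _)) fun g hg hvg => ?_).symm
    refine Finset.mem_filter.2 ⟨Finset.mem_erase.2 ⟨?_, hg⟩, v, hvg, hAv⟩
    rintro rfl
    rw [hab, Sym2.mem_iff] at hvg
    rcases hvg with rfl | rfl
    · exact hva rfl
    · exact hsep hAv

/-- Vertices on the same side of a separating edge that are connected in a subgraph remain
connected after deleting that edge. -/
theorem vconn_erase_of_separating {e : G.E} (he : G.Separating e) {a : G.V} (ha : a ∈ G.ends e)
    {H : Finset G.E} {u v : G.V} (hu : G.vconn (Finset.univ.erase e) a u)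
    (hv : G.vconn (Finset.univ.erase e) a v) (h : G.vconn H u v) :
    G.vconn (H.erase e) u v := by
  obtain ⟨b, hab⟩ := ha
  have hsep := he a b hab
  have key : ∀ w, G.vconn H u w →
      (G.vconn (Finset.univ.erase e) a w → G.vconn (H.erase e) u w) ∧
      (¬ G.vconn (Finset.univ.erase e) a w → G.vconn (H.erase e) u a) := by
    intro w hw
    induction hw with
    | refl => exact ⟨fun _ => .refl, fun h => absurd hu h⟩
    | @tail x y _ hxy ih =>
      obtain ⟨f, hf, hfxy⟩ := hxy
      by_cases hfe : f = e
      · subst hfe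
        rw [hab, Sym2.eq_iff] at hfxy
        rcases hfxy with ⟨rfl, rfl⟩ | ⟨rfl, rfl⟩
        · exact ⟨fun h => absurd h hsep, fun _ => ih.1 .refl⟩
        · exact ⟨fun _ => ih.2 hsep, fun h => absurd .refl h⟩
      · have hiff : G.vconn (Finset.univ.erase e) a x ↔ G.vconn (Finset.univ.erase e) a y :=
          ⟨fun h => h.tail ⟨f, by simp [hfe], hfxy⟩,
            fun h => h.tail ⟨f, by simp [hfe], by rw [hfxy, Sym2.eq_swap]⟩⟩
        refine ⟨fun h => ?_, fun h => ih.2 fun h' => h (hiff.1 h')⟩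
        exact (ih.1 (hiff.2 h)).tail ⟨f, Finset.mem_erase.2 ⟨hfe, hf⟩, hfxy⟩
  exact (key v h).1 hv

theorem inX.erase_of_lSep {l : Finset G.V} {e : G.E} (he : G.LSep l e) {H : Finset G.E}
    (h : G.inX l H) : G.inX l (H.erase e) := by
  obtain ⟨hsep, ⟨a, ha, hl⟩, _⟩ := he
  rcases h with h | ⟨u, v, hu, hv, huv, h⟩
  · exact Or.inl (h.erase_of_separating hsep)
  · exact Or.inr ⟨u, v, hu, hv, huv, vconn_erase_of_separating hsep ha (hl u hu) (hl v hv) h⟩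

instance (l : Finset G.V) : Fintype (G.XP l) :=
  inferInstanceAs (Fintype {_H : Finset G.E // _})

end MGraph

/-- If a connected finite labelled graph `(G,l)` contains an
`l`-separating edge, then the order complex of the poset `X(G,l)` is
contractible. -/
theorem XP_contractible_of_lSeparating
    (G : MGraph) (l : Finset G.V) (hconn : G.Conn)
    (e : G.E) (he : G.LSep l e) :
    ContractibleSpace (AbsSC.realization (orderComplex (G.XP l))) := by
  let f : G.XP l →o G.XP l :=
    ⟨fun H => ⟨H.1.erase e, (Finset.erase_subset _ _).trans_ssubset H.2.1,
      H.2.2.erase_of_lSep he⟩, fun _ _ h => Finset.erase_subset_erase e h⟩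
  let c : G.XP l := ⟨Finset.univ.erase e, Finset.erase_ssubset (Finset.mem_univ e), he.2.2⟩
  exact AbsSC.contractibleSpace_orderComplex f c (fun H => Finset.erase_subset e H.1)
    fun H => Finset.erase_subset_erase e (Finset.subset_univ H.1)
end
end

section
/- Let (G, l) be a connected finite labelled graph with k labelled vertices and fundamental group of rank n, and set d = n + k − 3 if k ≥ 1 and d = n − 2 if k = 0. Then the order complex of the poset X(G,l) of proper subgraphs with a component of non-trivial fundamental group or with at least two labelled vertices is homotopy equivalent to a wedge of d-spheres, and it is contractible if and only if G contains an l-separating edge. -/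
open scoped Classical

noncomputable section

universe u v

/-- A basepoint on the `n`-sphere. -/
def spherePt (n : ℕ) : Metric.sphere (0 : EuclideanSpace ℝ (Fin (n+1))) 1 :=
  ⟨(NormedSpace.sphere_nonempty.mpr zero_le_one).choose,
    (NormedSpace.sphere_nonempty.mpr zero_le_one).choose_spec⟩

/-- The wedge of `ι`-many `n`-spheres: the disjoint union of the spheres with
their basepoints identified. -/
def SphereWedge (ι : Type) (n : ℕ) : Type :=
  Quot (fun a b : ι × (Metric.sphere (0 : EuclideanSpace ℝ (Fin (n+1))) 1) =>
    a.2 = spherePt n ∧ b.2 = spherePt n)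

instance (ι : Type) (n : ℕ) : TopologicalSpace (SphereWedge ι n) :=
  letI : TopologicalSpace ι := ⊥
  inferInstanceAs (TopologicalSpace (Quot _))

/-- `X` has the homotopy type of a wedge of `d`-spheres, with the conventions
that a point is a (trivial) wedge of `d`-spheres for every `d`, and that for
`d < 0` a non-trivial wedge of `d`-spheres is the empty space. -/
def IsWedgeOfSpheres (d : ℤ) (X : Type u) [TopologicalSpace X] : Prop :=
  ContractibleSpace X ∨ (d < 0 ∧ IsEmpty X) ∨
    (0 ≤ d ∧ ∃ ι : Type, Nonempty ι ∧
      Nonempty (ContinuousMap.HomotopyEquiv X (SphereWedge ι d.toNat)))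

namespace AbsSC

variable {V : Type u} {W : Type v}

theorem continuous_val (K : AbsSC V) : Continuous (fun p : K.realization => p.1) :=
  continuous_subtype_val

theorem continuous_of_val {X : Type*} [TopologicalSpace X] {K : AbsSC V}
    {f : X → K.realization} (h : Continuous fun x => (f x).1) : Continuous f :=
  continuous_induced_rng.2 h

instance (K : AbsSC V) : T2Space K.realization :=
  inferInstanceAs (T2Space {_f : V → ℝ // _})

variable [Fintype V] [Fintype W]

/-- The set of vertices at which a function does not vanish. -/
def supp (f : V → ℝ) : Finset V := Finset.univ.filter (fun v => f v ≠ 0)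

@[simp] theorem mem_supp {f : V → ℝ} {v : V} : v ∈ supp f ↔ f v ≠ 0 := by simp [supp]

theorem realization_iff (K : AbsSC V) (f : V → ℝ) :
    (∃ s ∈ K.faces, (∀ v ∉ s, f v = 0) ∧ (∀ v, 0 ≤ f v) ∧ ∑ v ∈ s, f v = 1) ↔
      (∀ v, 0 ≤ f v) ∧ ∑ v, f v = 1 ∧ supp f ∈ K.faces := by
  constructor
  · rintro ⟨s, hs, h0, hp, h1⟩
    refine ⟨hp, ?_, K.down_closed s hs _ fun v hv => ?_⟩
    · rw [← h1]
      exact (Finset.sum_subset (Finset.subset_univ s) fun v _ hv => h0 v hv).symm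
    · by_contra hvs
      exact (mem_supp.1 hv) (h0 v hvs)
  · rintro ⟨hp, h1, hs⟩
    refine ⟨_, hs, fun v hv => by simpa using hv, hp, ?_⟩
    rw [← h1]
    exact Finset.sum_subset (Finset.subset_univ _) fun v _ hv => by simpa using hv

/-- The point of the realization with given barycentric coordinates. -/
def pt (K : AbsSC V) (f : V → ℝ) (hp : ∀ v, 0 ≤ f v) (h1 : ∑ v, f v = 1)
    (hs : supp f ∈ K.faces) : K.realization :=
  ⟨f, (K.realization_iff f).2 ⟨hp, h1, hs⟩⟩

theorem nonneg {K : AbsSC V} (p : K.realization) (v : V) : 0 ≤ p.1 v :=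
  ((K.realization_iff p.1).1 p.2).1 v

theorem sum_eq_one {K : AbsSC V} (p : K.realization) : ∑ v, p.1 v = 1 :=
  ((K.realization_iff p.1).1 p.2).2.1

theorem supp_mem {K : AbsSC V} (p : K.realization) : supp p.1 ∈ K.faces :=
  ((K.realization_iff p.1).1 p.2).2.2

theorem exists_pos {K : AbsSC V} (p : K.realization) : ∃ v, 0 < p.1 v := by
  by_contra! h
  have := sum_eq_one p
  rw [Finset.sum_eq_zero fun v _ => le_antisymm (h v) (nonneg p v)] at this
  exact zero_ne_one this

theorem le_one {K : AbsSC V} (p : K.realization) (v : V) : p.1 v ≤ 1 :=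
  (Finset.single_le_sum (fun w _ => nonneg p w) (Finset.mem_univ v)).trans_eq (sum_eq_one p)

instance (K : AbsSC V) : CompactSpace K.realization := by
  have hset : {f : V → ℝ | ∃ s ∈ K.faces, (∀ v ∉ s, f v = 0) ∧ (∀ v, 0 ≤ f v) ∧
      ∑ v ∈ s, f v = 1} = ⋃ s ∈ K.faces, (stdSimplex ℝ V ∩ ⋂ v ∈ {v | v ∉ s}, {f | f v = 0}) := by
    ext f
    simp only [Set.mem_ofPred_eq, Set.mem_iUnion, Set.mem_inter_iff, Set.mem_iInter, stdSimplex]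
    refine exists_congr fun s => ?_
    rw [exists_prop]
    refine and_congr_right fun _ => ?_
    constructor
    · rintro ⟨h0, hp, h1⟩
      refine ⟨⟨hp, ?_⟩, h0⟩
      rw [← h1]
      exact (Finset.sum_subset (Finset.subset_univ s) fun v _ hv => h0 v hv).symm
    · rintro ⟨⟨hp, h1⟩, h0⟩
      refine ⟨h0, hp, ?_⟩
      rw [← h1]
      exact Finset.sum_subset (Finset.subset_univ _) fun v _ hv => h0 v hv
  have hc : IsCompact {f : V → ℝ | ∃ s ∈ K.faces, (∀ v ∉ s, f v = 0) ∧ (∀ v, 0 ≤ f v) ∧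
      ∑ v ∈ s, f v = 1} := by
    rw [hset]
    refine (Set.toFinite _).isCompact_biUnion fun s _ => ?_
    refine (isCompact_stdSimplex ℝ V).inter_right ?_
    exact isClosed_biInter fun v _ => isClosed_eq (continuous_apply v) continuous_const
  exact isCompact_iff_compactSpace.1 hc

section prism

/-- The mass lying strictly above a vertex. -/
def upMass [PartialOrder V] (f : V → ℝ) (v : V) : ℝ :=
  ∑ w ∈ Finset.univ.filter (fun w => v < w), f w

/-- The part of the mass at a vertex which has been moved at time `t`, when mass is moved from
the top of a chain downwards. -/
def moved [PartialOrder V] (f : V → ℝ) (t : ℝ) (v : V) : ℝ :=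
  min (f v) (max 0 (t - upMass f v))

/-- Pushforward of the unmoved mass along `f` and of the moved mass along `g`. -/
def prismFun [PartialOrder V] (f g : V → W) (p : V → ℝ) (t : ℝ) (w : W) : ℝ :=
  ∑ v, ((if f v = w then p v - moved p t v else 0) + (if g v = w then moved p t v else 0))

variable [PartialOrder V]

theorem moved_nonneg {p : V → ℝ} (hp : ∀ v, 0 ≤ p v) (t : ℝ) (v : V) : 0 ≤ moved p t v :=
  le_min (hp v) (le_max_left _ _)

theorem moved_le (p : V → ℝ) (t : ℝ) (v : V) : moved p t v ≤ p v := min_le_left _ _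

theorem moved_zero {p : V → ℝ} (hp : ∀ v, 0 ≤ p v) (v : V) : moved p 0 v = 0 := by
  have : 0 ≤ upMass p v := Finset.sum_nonneg fun w _ => hp w
  rw [moved, max_eq_left (sub_nonpos.2 this), min_eq_right (hp v)]

theorem moved_one {p : V → ℝ} (hp : ∀ v, 0 ≤ p v) (h1 : ∑ v, p v = 1) (v : V) :
    moved p 1 v = p v := by
  refine min_eq_left (le_max_of_le_right ?_)
  have : p v + upMass p v ≤ ∑ v, p v := by
    rw [upMass, ← Finset.sum_insert (by simp)]
    exact Finset.sum_le_sum_of_subset_of_nonneg (Finset.subset_univ _) fun w _ _ => hp w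
  linarith

theorem continuous_moved (v : V) : Continuous fun x : (V → ℝ) × ℝ => moved x.1 x.2 v := by
  unfold moved upMass
  fun_prop

omit [Fintype W] in
theorem continuous_prismFun (f g : V → W) :
    Continuous fun x : (V → ℝ) × ℝ => prismFun f g x.1 x.2 := by
  refine continuous_pi fun w => ?_
  unfold prismFun
  refine continuous_finsetSum _ fun v _ => ?_
  have := continuous_moved v
  refine Continuous.add ?_ ?_
  · split_ifs
    · fun_prop
    · exact continuous_const
  · split_ifs
    · exact this
    · exact continuous_const

omit [Fintype W] in
theorem prismFun_nonneg (f g : V → W) {p : V → ℝ} (hp : ∀ v, 0 ≤ p v) (t : ℝ) (w : W) :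
    0 ≤ prismFun f g p t w := by
  refine Finset.sum_nonneg fun v _ => add_nonneg ?_ ?_
  · split_ifs
    · exact sub_nonneg.2 (moved_le p t v)
    · rfl
  · split_ifs
    · exact moved_nonneg hp t v
    · rfl

theorem sum_prismFun (f g : V → W) (p : V → ℝ) (t : ℝ) :
    ∑ w, prismFun f g p t w = ∑ v, p v := by
  unfold prismFun
  rw [Finset.sum_comm]
  refine Finset.sum_congr rfl fun v _ => ?_
  simp [Finset.sum_add_distrib]

theorem upMass_of_lt {p : V → ℝ} (hp : ∀ v, 0 ≤ p v) {x y : V} (h : y < x) :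
    p x + upMass p x ≤ upMass p y := by
  rw [upMass, ← Finset.sum_insert (by simp)]
  refine Finset.sum_le_sum_of_subset_of_nonneg (fun z hz => ?_) fun w _ _ => hp w
  rcases Finset.mem_insert.1 hz with rfl | hz
  · simpa using h
  · simpa using h.trans (by simpa using hz)

theorem moved_of_lt {p : V → ℝ} (hp : ∀ v, 0 ≤ p v) {t : ℝ} {x y : V} (h : y < x)
    (hy : 0 < moved p t y) : moved p t x = p x := by
  have h1 := upMass_of_lt hp h
  have h2 : 0 < t - upMass p y := by
    by_contra! h3
    have : moved p t y ≤ max 0 (t - upMass p y) := min_le_right _ _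
    rw [max_eq_left h3] at this
    exact absurd hy (not_lt.2 this)
  exact min_eq_left (le_max_of_le_right (by linarith))

/-- In a chain the unmoved mass lies below the moved mass. -/
theorem exists_split {p : V → ℝ} (hp : ∀ v, 0 ≤ p v) (t : ℝ) (hne : (supp p).Nonempty)
    (hc : IsChain (· ≤ ·) (↑(supp p) : Set V)) :
    ∃ x ∈ supp p, (∀ y, p y - moved p t y ≠ 0 → y ≤ x) ∧ (∀ y, moved p t y ≠ 0 → x ≤ y) := by
  have hsup : ∀ y, moved p t y ≠ 0 → y ∈ supp p := fun y hy => by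
    have h1 := lt_of_le_of_ne (moved_nonneg hp t y) (Ne.symm hy)
    exact mem_supp.2 (h1.trans_le (moved_le p t y)).ne'
  have hsup' : ∀ y, p y - moved p t y ≠ 0 → y ∈ supp p := fun y hy => by
    rw [mem_supp]
    intro h0
    have h1 := moved_nonneg hp t y
    have h2 := moved_le p t y
    exact hy (by linarith)
  by_cases hM : ∃ y, moved p t y ≠ 0
  · obtain ⟨x, hx⟩ := (Set.toFinite {y | moved p t y ≠ 0}).exists_minimal hM
    have hx0 : moved p t x ≠ 0 := hx.1
    refine ⟨x, hsup x hx0, fun y hy => ?_, fun y hy => ?_⟩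
    · rcases hc.total (hsup' y hy) (hsup x hx0) with h | h
      · exact h
      · rcases h.lt_or_eq with h | h
        · exact absurd (sub_eq_zero.2 (moved_of_lt hp h
            (lt_of_le_of_ne (moved_nonneg hp t x) (Ne.symm hx0))).symm) hy
        · exact h.ge
    · rcases hc.total (hsup y hy) (hsup x hx0) with h | h
      · exact hx.2 hy h
      · exact h
  · push Not at hM
    obtain ⟨x, hx⟩ := (supp p).exists_maximal hne
    refine ⟨x, hx.1, fun y hy => ?_, fun y hy => absurd (hM y) hy⟩
    rcases hc.total (hsup' y hy) hx.1 with h | h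
    · exact h
    · exact hx.2 (hsup' y hy) h

variable {K : AbsSC V} {K' : AbsSC W}

/-- The condition on a pair of vertex maps which makes the prism homotopy well defined. -/
def PrismCompat (K : AbsSC V) (K' : AbsSC W) (f g : V → W) : Prop :=
  ∀ σ ∈ K.faces, ∀ x ∈ σ,
    (σ.filter (· ≤ x)).image f ∪ (σ.filter (x ≤ ·)).image g ∈ K'.faces

theorem supp_prismFun (hK : ∀ σ ∈ K.faces, IsChain (· ≤ ·) (↑σ : Set V)) {f g : V → W}
    (h : PrismCompat K K' f g) (p : K.realization) (t : ℝ) :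
    supp (prismFun f g p.1 t) ∈ K'.faces := by
  obtain ⟨v0, hv0⟩ := exists_pos p
  obtain ⟨x, hx, h1, h2⟩ := exists_split (nonneg p) t ⟨v0, mem_supp.2 hv0.ne'⟩ (hK _ (supp_mem p))
  refine K'.down_closed _ (h _ (supp_mem p) x hx) _ fun w hw => ?_
  rw [mem_supp] at hw
  obtain ⟨v, -, hv⟩ := Finset.exists_ne_zero_of_sum_ne_zero hw
  rw [Finset.mem_union, Finset.mem_image, Finset.mem_image]
  have hv0 : p.1 v ≠ 0 := by
    intro h0
    have h3 : moved p.1 t v = 0 :=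
      le_antisymm ((moved_le p.1 t v).trans h0.le) (moved_nonneg (nonneg p) t v)
    simp [h0, h3] at hv
  by_cases ha : f v = w ∧ p.1 v - moved p.1 t v ≠ 0
  · exact Or.inl ⟨v, by simp [hv0, h1 v ha.2], ha.1⟩
  · have hb : g v = w ∧ moved p.1 t v ≠ 0 := by
      by_contra hb
      apply hv
      rw [not_and_not_right] at ha hb
      have e1 : (if f v = w then p.1 v - moved p.1 t v else 0) = 0 := by
        split_ifs with hh
        · exact ha hh
        · rfl
      have e2 : (if g v = w then moved p.1 t v else 0) = 0 := by
        split_ifs with hh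
        · exact hb hh
        · rfl
      rw [e1, e2, add_zero]
    exact Or.inr ⟨v, by simp [hv0, h2 v hb.2], hb.1⟩

/-- The prism homotopy. -/
def prism (hK : ∀ σ ∈ K.faces, IsChain (· ≤ ·) (↑σ : Set V)) {f g : V → W}
    (h : PrismCompat K K' f g) (p : K.realization) (t : ℝ) : K'.realization :=
  K'.pt (prismFun f g p.1 t) (prismFun_nonneg f g (nonneg p) t)
    ((sum_prismFun f g p.1 t).trans (sum_eq_one p)) (supp_prismFun hK h p t)

theorem continuous_prism (hK : ∀ σ ∈ K.faces, IsChain (· ≤ ·) (↑σ : Set V)) {f g : V → W}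
    (h : PrismCompat K K' f g) :
    Continuous fun x : K.realization × ℝ => prism hK h x.1 x.2 :=
  continuous_of_val <| (continuous_prismFun f g).comp
    (((continuous_val K).comp continuous_fst).prodMk continuous_snd)

end prism

/-- A vertex map is simplicial if it maps faces to faces. -/
def Simplicial (K : AbsSC V) (K' : AbsSC W) (f : V → W) : Prop :=
  ∀ σ ∈ K.faces, σ.image f ∈ K'.faces

variable {K : AbsSC V} {K' : AbsSC W}

theorem supp_push {f : V → W} (h : Simplicial K K' f) (p : K.realization) :
    supp (fun w => ∑ v, if f v = w then p.1 v else 0) ∈ K'.faces := by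
  refine K'.down_closed _ (h _ (supp_mem p)) _ fun w hw => ?_
  rw [mem_supp] at hw
  obtain ⟨v, -, hv⟩ := Finset.exists_ne_zero_of_sum_ne_zero hw
  rw [ite_ne_right_iff] at hv
  exact Finset.mem_image.2 ⟨v, by simpa using hv.2, hv.1⟩

/-- The map of realizations induced by a simplicial map. -/
def map {f : V → W} (h : Simplicial K K' f) : C(K.realization, K'.realization) where
  toFun p := K'.pt (fun w => ∑ v, if f v = w then p.1 v else 0)
    (fun w => Finset.sum_nonneg fun v _ => by split_ifs; exacts [nonneg p v, le_rfl])
    (by rw [Finset.sum_comm]; simpa using sum_eq_one p) (supp_push h p)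
  continuous_toFun := continuous_of_val <| continuous_pi fun w =>
    continuous_finsetSum _ fun v _ => by
      split_ifs
      · exact (continuous_apply v).comp (continuous_val K)
      · exact continuous_const

theorem map_val {f : V → W} (h : Simplicial K K' f) (p : K.realization) (w : W) :
    (map h p).1 w = ∑ v, if f v = w then p.1 v else 0 := rfl

theorem map_id (h : Simplicial K K id) : map h = ContinuousMap.id _ := by
  ext p
  refine Subtype.ext (funext fun w => ?_)
  rw [map_val]
  simp

theorem map_comp {U : Type*} [Fintype U] {K'' : AbsSC U} {f : V → W} {g : W → U}
    (hf : Simplicial K K' f) (hg : Simplicial K' K'' g) (hgf : Simplicial K K'' (g ∘ f)) :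
    (map hg).comp (map hf) = map hgf := by
  ext p
  refine Subtype.ext (funext fun u => ?_)
  simp only [ContinuousMap.comp_apply, map_val, Function.comp]
  calc _ = ∑ w, ∑ v, (if g w = u then if f v = w then p.1 v else 0 else 0) := by
        refine Finset.sum_congr rfl fun w _ => ?_
        split_ifs <;> simp
    _ = _ := by
        rw [Finset.sum_comm]
        refine Finset.sum_congr rfl fun v _ => ?_
        rw [Finset.sum_eq_single (f v)]
        · simp
        · intro w _ hw
          simp [hw.symm]
        · simp

theorem map_homotopic [PartialOrder V] (hK : ∀ σ ∈ K.faces, IsChain (· ≤ ·) (↑σ : Set V))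
    {f g : V → W} (h : PrismCompat K K' f g) (hf : Simplicial K K' f) (hg : Simplicial K K' g) :
    (map hf).Homotopic (map hg) := by
  refine ⟨⟨⟨fun x => prism hK h x.2 x.1, ?_⟩, fun p => ?_, fun p => ?_⟩⟩
  · exact (continuous_prism hK h).comp
      (continuous_snd.prodMk (continuous_subtype_val.comp continuous_fst))
  · refine Subtype.ext (funext fun w => ?_)
    change prismFun f g p.1 0 w = _
    rw [map_val]
    simp [prismFun, moved_zero (nonneg p)]
  · refine Subtype.ext (funext fun w => ?_)
    change prismFun f g p.1 1 w = _
    rw [map_val]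
    simp [prismFun, moved_one (nonneg p) (sum_eq_one p)]

/-- Comparable monotone maps between posets of simplices induce homotopic maps. -/
theorem map_homotopic_of_le {V W : Type*} [Fintype V] [Fintype W] [PartialOrder V] [Preorder W]
    {K : AbsSC V} {K' : AbsSC W} (S : Set W)
    (hK : ∀ σ ∈ K.faces, IsChain (· ≤ ·) (↑σ : Set V))
    (hK' : ∀ σ : Finset W, σ ∈ K'.faces ↔ ↑σ ⊆ S ∧ IsChain (· ≤ ·) (↑σ : Set W))
    {f g : V → W} (hf : Simplicial K K' f) (hg : Simplicial K K' g)
    (hfm : ∀ σ ∈ K.faces, MonotoneOn f ↑σ) (hgm : ∀ σ ∈ K.faces, MonotoneOn g ↑σ)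
    (hle : ∀ σ ∈ K.faces, ∀ x ∈ σ, f x ≤ g x) :
    (map hf).Homotopic (map hg) := by
  refine map_homotopic hK (fun σ hσ x hx => ?_) hf hg
  rw [hK']
  have h1 := (hK' _).1 (hf σ hσ)
  have h2 := (hK' _).1 (hg σ hσ)
  have key : ∀ a ∈ σ, a ≤ x → ∀ b ∈ σ, x ≤ b → f a ≤ g b := fun a ha hax b hb hxb =>
    ((hfm σ hσ ha hx hax).trans (hle σ hσ x hx)).trans (hgm σ hσ hx hb hxb)
  constructor
  · intro w hw
    simp only [Finset.coe_union, Finset.coe_image, Set.mem_union, Set.mem_image, Finset.mem_coe,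
      Finset.mem_filter] at hw
    rcases hw with ⟨a, ha, rfl⟩ | ⟨a, ha, rfl⟩
    · exact h1.1 (by simpa using ⟨a, ha.1, rfl⟩)
    · exact h2.1 (by simpa using ⟨a, ha.1, rfl⟩)
  · intro w hw w' hw' hne
    simp only [Finset.coe_union, Finset.coe_image, Set.mem_union, Set.mem_image, Finset.mem_coe,
      Finset.mem_filter] at hw hw'
    rcases hw with ⟨a, ha, rfl⟩ | ⟨a, ha, rfl⟩ <;> rcases hw' with ⟨b, hb, rfl⟩ | ⟨b, hb, rfl⟩
    · exact h1.2 (by simpa using ⟨a, ha.1, rfl⟩) (by simpa using ⟨b, hb.1, rfl⟩) hne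
    · exact Or.inl (key a ha.1 ha.2 b hb.1 hb.2)
    · exact Or.inr (key b hb.1 hb.2 a ha.1 ha.2)
    · exact h2.2 (by simpa using ⟨a, ha.1, rfl⟩) (by simpa using ⟨b, hb.1, rfl⟩) hne

/-- The simplicial complex of finite chains in a subset of a preorder. -/
def chainsIn {M : Type*} [Preorder M] (S : Set M) : AbsSC M where
  faces := {σ | ↑σ ⊆ S ∧ IsChain (· ≤ ·) (↑σ : Set M)}
  down_closed := fun _s hs _t hts =>
    ⟨(Finset.coe_subset.2 hts).trans hs.1, hs.2.mono (Finset.coe_subset.2 hts)⟩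

theorem simplicial_chainsIn {V M : Type*} [Preorder V] [Preorder M] {S : Set V} {S' : Set M}
    {f : V → M} (hfS : Set.MapsTo f S S') (hf : MonotoneOn f S) :
    Simplicial (chainsIn S) (chainsIn S') f := by
  intro σ hσ
  constructor
  · rw [Finset.coe_image]
    exact Set.image_subset_iff.2 fun x hx => hfS (hσ.1 hx)
  · rw [Finset.coe_image]
    rintro _ ⟨a, ha, rfl⟩ _ ⟨b, hb, rfl⟩ _
    rcases hσ.2.total ha hb with h | h
    · exact Or.inl (hf (hσ.1 ha) (hσ.1 hb) h)
    · exact Or.inr (hf (hσ.1 hb) (hσ.1 ha) h)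

theorem chainsIn_homotopic {M N : Type*} [Fintype M] [Fintype N] [PartialOrder M] [Preorder N]
    {S : Set M} {S' : Set N} {f g : M → N} (hfS : Set.MapsTo f S S') (hf : MonotoneOn f S)
    (hgS : Set.MapsTo g S S') (hg : MonotoneOn g S) (hle : ∀ x ∈ S, f x ≤ g x) :
    (map (simplicial_chainsIn hfS hf)).Homotopic (map (simplicial_chainsIn hgS hg)) :=
  map_homotopic_of_le (K := chainsIn S) (K' := chainsIn S') S' (fun _ hσ => hσ.2)
    (fun _ => Iff.rfl) _ _
    (fun _ hσ => hf.mono hσ.1) (fun _ hσ => hg.mono hσ.1) (fun _ hσ x hx => hle x (hσ.1 hx))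

/-- Quillen's criterion: a conically contractible poset is contractible. -/
theorem contractible_chainsIn {M : Type*} [Fintype M] [PartialOrder M] {S : Set M} {f : M → M}
    (hfS : Set.MapsTo f S S) (hf : MonotoneOn f S) (hle : ∀ x ∈ S, f x ≤ x) {a : M} (ha : a ∈ S)
    (hfa : ∀ x ∈ S, f x ≤ a) : ContractibleSpace (chainsIn S).realization := by
  rw [contractible_iff_id_nullhomotopic]
  have hid : Set.MapsTo (id : M → M) S S := fun x hx => hx
  have hc : Set.MapsTo (fun _ : M => a) S S := fun x _ => ha
  have hcm : MonotoneOn (fun _ : M => a) S := fun _ _ _ _ _ => le_rfl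
  have h1 := chainsIn_homotopic hfS hf hid monotoneOn_id hle
  have h2 := chainsIn_homotopic hfS hf hc hcm hfa
  rw [map_id] at h1
  have hp : ∀ v, (0 : ℝ) ≤ (Pi.single a 1 : M → ℝ) v := fun v => by
    by_cases h : v = a
    · subst h; simp
    · simp [h]
  have h1' : ∑ v, (Pi.single a 1 : M → ℝ) v = 1 := by simp
  have hs : supp (Pi.single a 1 : M → ℝ) ∈ (chainsIn S).faces := by
    constructor
    · intro v hv
      have : v = a := by
        by_contra h
        simp [h] at hv
      exact this ▸ ha
    · intro v hv w hw hne
      exfalso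
      apply hne
      have h1 : v = a := by
        by_contra h
        simp [h] at hv
      have h2 : w = a := by
        by_contra h
        simp [h] at hw
      rw [h1, h2]
  refine ⟨(chainsIn S).pt (Pi.single a 1) hp h1' hs, (h1.symm.trans h2).trans ?_⟩
  · have : map (simplicial_chainsIn hc hcm) = 
        ContinuousMap.const _ ((chainsIn S).pt (Pi.single a 1) hp h1' hs) := by
      ext p
      refine Subtype.ext (funext fun w => ?_)
      rw [map_val]
      change _ = (Pi.single a 1 : M → ℝ) w
      by_cases h : w = a
      · subst h; simpa using sum_eq_one p
      · simp [h, Ne.symm h]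
    rw [this]

end AbsSC

section topology

open scoped unitInterval

theorem exists_lift_homotopic {X Y Z : Type*} [TopologicalSpace X] [TopologicalSpace Y]
    [TopologicalSpace Z] {P : Y → X} (hP : Topology.IsQuotientMap P) (f : C(Y, C(I, Z)))
    (hf : ∀ y y', P y = P y' → f y = f y') :
    ∃ F : C(I × X, Z), ∀ s y, F (s, P y) = f y s := by
  have hfac : Function.FactorsThrough f (⟨P, hP.continuous⟩ : C(Y, X)) :=
    fun y y' h => hf y y' h
  let F : C(X, C(I, Z)) := Topology.IsQuotientMap.lift (f := ⟨P, hP.continuous⟩) hP f hfac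
  have hF : ∀ y, F (P y) = f y := fun y =>
    DFunLike.congr_fun (Topology.IsQuotientMap.lift_comp (f := ⟨P, hP.continuous⟩) hP f hfac) y
  exact ⟨F.uncurry.comp ⟨Prod.swap, continuous_swap⟩, fun s y => by
    change F (P y) s = _
    rw [hF]⟩

section cones

variable {X A J : Type*} [TopologicalSpace X] [T2Space X] [TopologicalSpace A] [CompactSpace A]
  [Finite J] {K : J → Type*} [∀ j, TopologicalSpace (K j)] [∀ j, CompactSpace (K j)]

theorem isQuotientMap_of_cover {P : A ⊕ (Σ j, K j) → X} (hc : Continuous P)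
    (hs : Function.Surjective P) : Topology.IsQuotientMap P :=
  hc.isClosedMap.isQuotientMap hc hs

/-- A space obtained from a contractible space by attaching cones over contractible subspaces
is contractible. -/
theorem contractible_of_cones [ContractibleSpace A] [∀ j, ContractibleSpace (K j)]
    (i : C(A, X)) (hi : Function.Injective i) (π : ∀ j, C(K j × I, X))
    (hsurj : ∀ x, (∃ a, i a = x) ∨ ∃ j y, π j y = x)
    (h0 : ∀ j q q', π j (q, 0) = π j (q', 0))
    (hbase : ∀ j q, ∃ a, i a = π j (q, 1))
    (hA : ∀ j q u a, π j (q, u) = i a → u = 1)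
    (hJ : ∀ (a b : Σ j, K j × I), π a.1 a.2 = π b.1 b.2 →
      (a.2.2 = 1 ∧ b.2.2 = 1) ∨ (a.2.2 = 0 ∧ b.2.2 = 0 ∧ a.1 = b.1) ∨ a = b) :
    ContractibleSpace X := by
  have hnull : ∀ j, (ContinuousMap.id (K j)).Nullhomotopic := fun j => id_nullhomotopic _
  choose a hcj using hnull
  let c : ∀ j, (ContinuousMap.id (K j)).Homotopy (ContinuousMap.const _ (a j)) :=
    fun j => (hcj j).some
  let P : A ⊕ (Σ j, K j × I) → X := Sum.elim i (fun y => π y.1 y.2)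
  have hPc : Continuous P := i.continuous.sumElim (continuous_sigma fun j => (π j).continuous)
  have hP : Topology.IsQuotientMap P := by
    refine isQuotientMap_of_cover hPc fun x => ?_
    rcases hsurj x with ⟨a, rfl⟩ | ⟨j, y, rfl⟩
    · exact ⟨Sum.inl a, rfl⟩
    · exact ⟨Sum.inr ⟨j, y⟩, rfl⟩
  let g1 : ∀ j, C((K j × I) × I, X) := fun j =>
    (π j).comp ⟨fun x => (c j (x.2 * σ x.1.2, x.1.1), x.1.2), by fun_prop⟩
  let g2 : ∀ j, C((K j × I) × I, X) := fun j =>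
    (π j).comp ⟨fun x => (c j (σ x.1.2, x.1.1), σ (σ x.2 * σ x.1.2)), by fun_prop⟩
  let i' : C(A, C(I, X)) := (i.comp ContinuousMap.fst).curry
  let f : (∀ j, C((K j × I) × I, X)) → C(A ⊕ (Σ j, K j × I), C(I, X)) := fun g =>
    ⟨Sum.elim i' (fun y => (g y.1).curry y.2),
      i'.continuous.sumElim (continuous_sigma fun j => ((g j).curry).continuous)⟩
  have hf : ∀ g : (∀ j, C((K j × I) × I, X)), (∀ j q s, g j ((q, 1), s) = π j (q, 1)) →
      (∀ j q q' s, g j ((q, 0), s) = g j ((q', 0), s)) →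
      ∀ y y', P y = P y' → f g y = f g y' := by
    intro g hg1 hg0 y y' h
    ext s
    rcases y with b | ⟨j, q, u⟩ <;> rcases y' with b' | ⟨j', q', u'⟩
    · exact h
    · obtain rfl : u' = 1 := hA j' q' u' b h.symm
      exact h.trans (hg1 j' q' s).symm
    · obtain rfl : u = 1 := hA j q u b' h
      exact (hg1 j q s).trans h
    · rcases hJ ⟨j, q, u⟩ ⟨j', q', u'⟩ h with ⟨h1, h2⟩ | ⟨h1, h2, h3⟩ | h1
      · dsimp only at h1 h2
        subst h1 h2
        exact (hg1 j q s).trans (Eq.trans h (hg1 j' q' s).symm)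
      · dsimp only at h1 h2 h3
        subst h1 h2 h3
        exact hg0 j q q' s
      · rw [h1]
  obtain ⟨F1, hF1⟩ := exists_lift_homotopic hP (f g1) (hf g1
    (fun j q s => by simp [g1]) (fun j q q' s => h0 j _ _))
  obtain ⟨F2, hF2⟩ := exists_lift_homotopic hP (f g2) (hf g2
    (fun j q s => by simp [g2]) (fun j q q' s => by simp [g2]))
  have hPs := hP.surjective
  let e1 : C(X, X) := F1.comp ((ContinuousMap.const X (1 : I)).prodMk (ContinuousMap.id X))
  let e2 : C(X, X) := F2.comp ((ContinuousMap.const X (1 : I)).prodMk (ContinuousMap.id X))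
  have H1 : (ContinuousMap.id X).Homotopic e1 := by
    refine ⟨⟨F1, fun x => ?_, fun x => rfl⟩⟩
    obtain ⟨y, rfl⟩ := hPs x
    change F1 (0, P y) = P y
    rw [hF1]
    rcases y with b | ⟨j, q, u⟩
    · rfl
    · change π j (c j (0 * σ u, q), u) = π j (q, u)
      simp
  have H2 : e1.Homotopic e2 := by
    refine ⟨⟨F2, fun x => ?_, fun x => rfl⟩⟩
    obtain ⟨y, rfl⟩ := hPs x
    change F2 (0, P y) = F1 (1, P y)
    rw [hF2, hF1]
    rcases y with b | ⟨j, q, u⟩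
    · rfl
    · change π j (c j (σ u, q), σ (σ 0 * σ u)) = π j (c j (1 * σ u, q), u)
      simp
  have he2 : ∀ x, ∃ b, i b = e2 x := by
    intro x
    obtain ⟨y, rfl⟩ := hPs x
    change ∃ b, i b = F2 (1, P y)
    rw [hF2]
    rcases y with b | ⟨j, q, u⟩
    · exact ⟨b, rfl⟩
    · change ∃ b, i b = π j (c j (σ u, q), σ (σ 1 * σ u))
      obtain ⟨b, hb⟩ := hbase j (c j (σ u, q))
      exact ⟨b, by simpa using hb⟩
  choose r hr using he2
  have hie : Topology.IsClosedEmbedding i := i.continuous.isClosedEmbedding hi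
  have hrc : Continuous r := by
    rw [hie.isInducing.continuous_iff]
    exact e2.continuous.congr fun x => (hr x).symm
  rw [contractible_iff_id_nullhomotopic]
  have hn := ((id_nullhomotopic A).comp_right i).comp_left ⟨r, hrc⟩
  obtain ⟨x, hx⟩ := hn
  refine ⟨x, (H1.trans H2).trans ?_⟩
  convert hx
  ext x
  exact (hr x).symm

end cones

section wedge

variable {E : Type*} [NormedAddCommGroup E] [NormedSpace ℝ E]

/-- Radial retraction onto the closed unit ball. -/
def ballClip (x : E) : Metric.closedBall (0 : E) 1 :=
  ⟨(max 1 ‖x‖)⁻¹ • x, by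
    have h1 : 0 < max 1 ‖x‖ := lt_max_of_lt_left one_pos
    rw [mem_closedBall_zero_iff, norm_smul, norm_inv, Real.norm_of_nonneg h1.le,
      inv_mul_le_iff₀ h1, mul_one]
    exact le_max_right _ _⟩

theorem continuous_ballClip : Continuous (ballClip : E → _) := by
  refine Continuous.subtype_mk (Continuous.smul (Continuous.inv₀ (by fun_prop) fun x => ?_)
    continuous_id) _
  exact (lt_max_of_lt_left one_pos).ne'

theorem ballClip_of_le {x : E} (h : ‖x‖ ≤ 1) : (ballClip x : E) = x := by
  simp [ballClip, max_eq_left h]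

theorem norm_ballClip_of_le {x : E} (h : 1 ≤ ‖x‖) : ‖(ballClip x : E)‖ = 1 := by
  have : ‖x‖ ≠ 0 := (one_pos.trans_le h).ne'
  simp [ballClip, max_eq_right h, norm_smul, this]

/-- The wedge of spheres injects into a product of spheres. -/
def SphereWedge.toPi (ι : Type) (n : ℕ) (w : SphereWedge ι n) :
    ι → Metric.sphere (0 : EuclideanSpace ℝ (Fin (n+1))) 1 :=
  Quot.lift (fun a j => if a.1 = j then a.2 else spherePt n)
    (by rintro a b ⟨h1, h2⟩; ext1 j; simp [h1, h2]) w

theorem SphereWedge.continuous_mk {ι : Type} {n : ℕ} (j : ι) :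
    @Continuous _ (SphereWedge ι n) _ _ fun x => Quot.mk _ (j, x) := by
  let _ : TopologicalSpace ι := ⊥
  exact continuous_coinduced_rng.comp (Continuous.prodMk_right j)

theorem SphereWedge.continuous_of {ι : Type} {n : ℕ} {Z : Type*} [TopologicalSpace Z]
    {f : SphereWedge ι n → Z} (h : ∀ j, Continuous fun x => f (Quot.mk _ (j, x))) :
    Continuous f := by
  let _ : TopologicalSpace ι := ⊥
  have : DiscreteTopology ι := ⟨rfl⟩
  refine continuous_coinduced_dom.2 ?_
  exact continuous_prod_of_discrete_left.2 h

theorem SphereWedge.continuous_toPi (ι : Type) (n : ℕ) :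
    Continuous (SphereWedge.toPi ι n) := by
  refine SphereWedge.continuous_of fun i => continuous_pi fun j => ?_
  change Continuous fun x => if i = j then x else spherePt n
  split_ifs
  · exact continuous_id
  · exact continuous_const

theorem SphereWedge.toPi_injective (ι : Type) (n : ℕ) :
    Function.Injective (SphereWedge.toPi ι n) := by
  rintro ⟨i, x⟩ ⟨j, y⟩ h
  have h1 := congrFun h i
  have h2 := congrFun h j
  change (if i = i then x else spherePt n) = (if j = i then y else spherePt n) at h1
  change (if i = j then x else spherePt n) = (if j = j then y else spherePt n) at h2
  by_cases hij : i = j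
  · subst hij
    simp only [if_true] at h1
    rw [h1]
  · simp only [if_true, if_neg hij, if_neg (Ne.symm hij)] at h1 h2
    exact Quot.sound ⟨h1, h2.symm⟩

instance (ι : Type) (n : ℕ) : T2Space (SphereWedge ι n) :=
  T2Space.of_injective_continuous (SphereWedge.toPi_injective ι n)
    (SphereWedge.continuous_toPi ι n)

variable {X A : Type*} {J : Type} [TopologicalSpace X] [T2Space X] [TopologicalSpace A]
  [CompactSpace A] [Finite J] [FiniteDimensional ℝ E]

/-- A space obtained from a contractible space by attaching discs of a fixed dimension is
homotopy equivalent to a wedge of spheres. -/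
theorem homotopyEquiv_sphereWedge [ContractibleSpace A] [Nonempty J] {d : ℕ}
    (i : C(A, X)) (hi : Function.Injective i) (π : J → C(Metric.closedBall (0 : E) 1, X))
    (hsurj : ∀ x, (∃ a, i a = x) ∨ ∃ j y, π j y = x)
    (hbase : ∀ j (x : Metric.closedBall (0 : E) 1), ‖(x : E)‖ = 1 → ∃ a, i a = π j x)
    (hA : ∀ j (x : Metric.closedBall (0 : E) 1) a, π j x = i a → ‖(x : E)‖ = 1)
    (hJ : ∀ j (x : Metric.closedBall (0 : E) 1) j' (x' : Metric.closedBall (0 : E) 1),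
      π j x = π j' x' →
      (‖(x : E)‖ = 1 ∧ ‖(x' : E)‖ = 1) ∨ (j = j' ∧ x = x'))
    (θ : C(Metric.closedBall (0 : E) 1, Metric.sphere (0 : EuclideanSpace ℝ (Fin (d+1))) 1))
    (hθs : ∀ z, z ≠ spherePt d → ∃ x, θ x = z)
    (hθ1 : ∀ x : Metric.closedBall (0 : E) 1, θ x = spherePt d ↔ ‖(x : E)‖ = 1)
    (hθ : ∀ x x' : Metric.closedBall (0 : E) 1, ‖(x : E)‖ ≠ 1 → θ x = θ x' → x = x') :
    Nonempty (ContinuousMap.HomotopyEquiv X (SphereWedge J d)) := by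
  have : ProperSpace E := FiniteDimensional.proper ℝ E
  have : CompactSpace (Metric.closedBall (0 : E) 1) :=
    isCompact_iff_compactSpace.1 (isCompact_closedBall _ _)
  let B := Metric.closedBall (0 : E) 1
  have hle : ∀ x : B, ‖(x : E)‖ ≤ 1 := fun x => mem_closedBall_zero_iff.1 x.2
  obtain ⟨a0, ⟨c⟩⟩ := id_nullhomotopic A
  let P : A ⊕ (Σ _ : J, B) → X := Sum.elim i (fun y => π y.1 y.2)
  have hPc : Continuous P := i.continuous.sumElim (continuous_sigma fun j => (π j).continuous)
  have hP : Topology.IsQuotientMap P := by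
    refine isQuotientMap_of_cover hPc fun x => ?_
    rcases hsurj x with ⟨a, rfl⟩ | ⟨j, y, rfl⟩
    · exact ⟨Sum.inl a, rfl⟩
    · exact ⟨Sum.inr ⟨j, y⟩, rfl⟩
  have hie : Topology.IsClosedEmbedding i :=
    i.continuous.isClosedEmbedding hi
  have hb : ∀ j (x : B), ∃ a, ‖(x : E)‖ = 1 → i a = π j x := fun j x => by
    by_cases h : ‖(x : E)‖ = 1
    · obtain ⟨a, ha⟩ := hbase j x h
      exact ⟨a, fun _ => ha⟩
    · exact ⟨a0, fun h' => absurd h' h⟩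
  choose b hb using hb
  have hbc : ∀ j, ContinuousOn (b j) {x : B | ‖(x : E)‖ = 1} := fun j => by
    rw [hie.isInducing.continuousOn_iff]
    exact (π j).continuous.continuousOn.congr fun x hx => hb j x hx
  let ρ : B × I → E := fun x => (1 + (x.2 : ℝ)) • (x.1 : E)
  have hρ : Continuous ρ := by fun_prop
  let G : J → B × I → X := fun j x =>
    if ‖ρ x‖ ≤ 1 then π j (ballClip (ρ x))
    else i (c (Set.projIcc 0 1 zero_le_one (‖ρ x‖ - 1), b j (ballClip (ρ x))))
  have hG : ∀ j, Continuous (G j) := fun j => by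
    refine continuous_if_le hρ.norm continuous_const ?_ ?_ ?_
    · exact ((π j).continuous.comp (continuous_ballClip.comp hρ)).continuousOn
    · refine i.continuous.comp_continuousOn (c.continuous.comp_continuousOn
        (ContinuousOn.prodMk ?_ ?_))
      · exact (continuous_projIcc.comp (hρ.norm.sub continuous_const)).continuousOn
      · exact (hbc j).comp (continuous_ballClip.comp hρ).continuousOn
          fun x hx => norm_ballClip_of_le hx
    · intro x hx
      rw [hx, sub_self]
      have : (Set.projIcc (0 : ℝ) 1 zero_le_one 0) = 0 := Set.projIcc_left _
      rw [this]
      change _ = i (c (0, _))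
      rw [c.apply_zero]
      exact (hb j _ (norm_ballClip_of_le hx.ge)).symm
  have hG0 : ∀ j x, G j (x, 0) = π j x := fun j x => by
    have h1 : ρ (x, 0) = x := by simp [ρ]
    change (if ‖ρ (x, 0)‖ ≤ 1 then _ else _) = _
    rw [if_pos (by rw [h1]; exact hle x)]
    congr 1
    refine Subtype.ext ?_
    rw [h1, ballClip_of_le (hle x)]
  have hG1 : ∀ j (x : B) s, ‖(x : E)‖ = 1 → G j (x, s) = i (c (s, b j x)) := fun j x s hx => by
    have hs : 0 ≤ (s : ℝ) := s.2.1
    have h1 : ‖ρ (x, s)‖ = 1 + s := by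
      simp only [ρ]
      rw [norm_smul, hx, mul_one, Real.norm_of_nonneg (by linarith)]
    have h2 : ballClip (ρ (x, s)) = x := by
      refine Subtype.ext ?_
      simp only [ballClip, h1]
      rw [max_eq_right (by linarith)]
      simp only [ρ]
      rw [smul_smul, inv_mul_cancel₀ (by linarith), one_smul]
    change (if ‖ρ (x, s)‖ ≤ 1 then _ else _) = _
    rw [h2, h1]
    split_ifs with h
    · have h0 : s = 0 := Subtype.ext (le_antisymm (by simpa using h) hs)
      subst h0
      change _ = i (c (0, _))
      rw [c.apply_zero]
      exact (hb j x hx).symm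
    · simp
  let i' : C(A, C(I, X)) := (i.comp (c.toContinuousMap.comp
    (ContinuousMap.snd.prodMk ContinuousMap.fst))).curry
  let f : C(A ⊕ (Σ _ : J, B), C(I, X)) :=
    ⟨Sum.elim i' (fun y => (⟨G y.1, hG y.1⟩ : C(B × I, X)).curry y.2),
      i'.continuous.sumElim (continuous_sigma fun j =>
        (ContinuousMap.curry (⟨G j, hG j⟩ : C(B × I, X))).continuous)⟩
  have hfl : ∀ a s, f (Sum.inl a) s = i (c (s, a)) := fun a s => rfl
  have hfr : ∀ j x s, f (Sum.inr ⟨j, x⟩) s = G j (x, s) := fun j x s => rfl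
  have hfc : ∀ y y', P y = P y' → f y = f y' := by
    intro y y' h
    ext s
    have key : ∀ j x a, π j x = i a → f (Sum.inr ⟨j, x⟩) s = f (Sum.inl a) s := by
      intro j x a h
      have hx := hA j x a h
      rw [hfr, hfl, hG1 j x s hx]
      have : b j x = a := hi ((hb j x hx).trans h)
      rw [this]
    rcases y with a | ⟨j, x⟩ <;> rcases y' with a' | ⟨j', x'⟩
    · have : a = a' := hi h
      rw [this]
    · exact (key j' x' a h.symm).symm
    · exact key j x a' h
    · rcases hJ j x j' x' h with ⟨h1, h2⟩ | ⟨h1, h2⟩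
      · obtain ⟨a, ha⟩ := hbase j x h1
        rw [key j x a ha.symm, key j' x' a (h.symm.trans ha.symm)]
      · rw [h1, h2]
  obtain ⟨F, hF⟩ := exists_lift_homotopic hP f hfc
  have hFA : ∀ s a, F (s, i a) = i (c (s, a)) := fun s a => hF s (Sum.inl a)
  let pt : SphereWedge J d := Quot.mk _ (Classical.arbitrary J, spherePt d)
  have hpt : ∀ j, (Quot.mk _ (j, spherePt d) : SphereWedge J d) = pt := fun j =>
    Quot.sound ⟨rfl, rfl⟩
  let γ : C(A ⊕ (Σ _ : J, B), SphereWedge J d) :=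
    ⟨Sum.elim (fun _ => pt) (fun y => Quot.mk _ (y.1, θ y.2)),
      continuous_const.sumElim (continuous_sigma fun j =>
        (SphereWedge.continuous_mk j).comp θ.continuous)⟩
  have hγr : ∀ j x, γ (Sum.inr ⟨j, x⟩) = Quot.mk _ (j, θ x) := fun j x => rfl
  have hγ1 : ∀ j (x : B), ‖(x : E)‖ = 1 → γ (Sum.inr ⟨j, x⟩) = pt := fun j x hx => by
    rw [hγr, (hθ1 x).2 hx, hpt]
  have hγP : ∀ y y', P y = P y' → γ y = γ y' := by
    intro y y' h
    rcases y with a | ⟨j, x⟩ <;> rcases y' with a' | ⟨j', x'⟩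
    · rfl
    · exact (hγ1 j' x' (hA j' x' a h.symm)).symm
    · exact hγ1 j x (hA j x a' h)
    · rcases hJ j x j' x' h with ⟨h1, h2⟩ | ⟨h1, h2⟩
      · rw [hγ1 j x h1, hγ1 j' x' h2]
      · rw [h1, h2]
  have hγA : ∀ y, γ y = pt → ∃ a, P y = i a := by
    intro y hy
    rcases y with a | ⟨j, x⟩
    · exact ⟨a, rfl⟩
    · have h1 := congrArg (SphereWedge.toPi J d) hy
      have h2 := congrFun h1 j
      change (if j = j then θ x else spherePt d) =
        (if Classical.arbitrary J = j then spherePt d else spherePt d) at h2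
      simp only [if_true, ite_self] at h2
      obtain ⟨a, ha⟩ := hbase j x ((hθ1 x).1 h2)
      exact ⟨a, ha.symm⟩
  have hγinj : ∀ y y', γ y = γ y' → P y = P y' ∨ ((∃ a, P y = i a) ∧ ∃ a, P y' = i a) := by
    intro y y' h
    by_cases hy : γ y = pt
    · exact Or.inr ⟨hγA y hy, hγA y' (h ▸ hy)⟩
    · left
      rcases y with a | ⟨j, x⟩
      · exact absurd rfl hy
      rcases y' with a' | ⟨j', x'⟩
      · exact absurd h hy
      have hx : ‖(x : E)‖ ≠ 1 := fun hx => hy (hγ1 j x hx)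
      have h1 := congrFun (congrArg (SphereWedge.toPi J d) h) j
      change (if j = j then θ x else spherePt d) = (if j' = j then θ x' else spherePt d) at h1
      rw [if_pos rfl] at h1
      by_cases hj : j' = j
      · subst hj
        rw [if_pos rfl] at h1
        rw [hθ x x' hx h1]
      · rw [if_neg hj] at h1
        exact absurd ((hθ1 x).1 h1) hx
  have hγfac : Function.FactorsThrough γ (⟨P, hPc⟩ : C(_, X)) := fun y y' h => hγP y y' h
  let g : C(X, SphereWedge J d) :=
    Topology.IsQuotientMap.lift (f := ⟨P, hPc⟩) hP γ hγfac
  have hg : ∀ y, g (P y) = γ y := fun y =>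
    DFunLike.congr_fun (Topology.IsQuotientMap.lift_comp (f := ⟨P, hPc⟩) hP γ hγfac) y
  have hgA : ∀ a, g (i a) = pt := fun a => hg (Sum.inl a)
  have hgs : Function.Surjective g := by
    rintro ⟨j, z⟩
    by_cases hz : z = spherePt d
    · exact ⟨i a0, by rw [hgA, hz]; exact (hpt j).symm⟩
    · obtain ⟨x, rfl⟩ := hθs z hz
      exact ⟨P (Sum.inr ⟨j, x⟩), hg _⟩
  have hginj : ∀ x x', g x = g x' → x = x' ∨ ((∃ a, x = i a) ∧ ∃ a, x' = i a) := by
    intro x x' h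
    obtain ⟨y, rfl⟩ := hP.surjective x
    obtain ⟨y', rfl⟩ := hP.surjective x'
    rw [hg, hg] at h
    exact hγinj y y' h
  have : CompactSpace X := by
    constructor
    rw [← Set.range_eq_univ.2 hP.surjective]
    exact isCompact_range hPc
  have hgq : Topology.IsQuotientMap g :=
    g.continuous.isClosedMap.isQuotientMap g.continuous hgs
  let F1 : C(X, X) := F.comp ((ContinuousMap.const X (1 : I)).prodMk (ContinuousMap.id X))
  have hF1 : ∀ x, F1 x = F (1, x) := fun x => rfl
  have hF1A : ∀ a, F1 (i a) = i a0 := fun a => by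
    rw [hF1, hFA]
    exact congrArg i (c.apply_one a)
  have hF1fac : Function.FactorsThrough F1 g := fun x x' h => by
    rcases hginj x x' h with rfl | ⟨⟨a, rfl⟩, ⟨a', rfl⟩⟩
    · rfl
    · rw [hF1A, hF1A]
  let φ : C(SphereWedge J d, X) := Topology.IsQuotientMap.lift hgq F1 hF1fac
  have hφ : ∀ x, φ (g x) = F1 x := fun x =>
    DFunLike.congr_fun (Topology.IsQuotientMap.lift_comp hgq F1 hF1fac) x
  have hF0 : ∀ x, F (0, x) = x := by
    intro x
    obtain ⟨y, rfl⟩ := hP.surjective x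
    rw [hF]
    rcases y with a | ⟨j, x⟩
    · exact congrArg i (c.apply_zero a)
    · exact hG0 j x
  have hh : (ContinuousMap.id X).Homotopic (φ.comp g) :=
    ⟨⟨F, fun x => hF0 x, fun x => (hφ x).symm⟩⟩
  let k : C(X, C(I, SphereWedge J d)) :=
    ((g.comp F).comp (ContinuousMap.snd.prodMk ContinuousMap.fst)).curry
  have hk : ∀ x s, k x s = g (F (s, x)) := fun x s => rfl
  obtain ⟨H, hH⟩ := exists_lift_homotopic hgq k (fun x x' h => by
    rcases hginj x x' h with rfl | ⟨⟨a, rfl⟩, ⟨a', rfl⟩⟩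
    · rfl
    · ext s
      rw [hk, hk, hFA, hFA, hgA, hgA])
  have hh' : (ContinuousMap.id (SphereWedge J d)).Homotopic (g.comp φ) := by
    refine ⟨⟨H, fun w => ?_, fun w => ?_⟩⟩
    · obtain ⟨x, rfl⟩ := hgs w
      change H (0, g x) = g x
      rw [hH, hk, hF0]
    · obtain ⟨x, rfl⟩ := hgs w
      change H (1, g x) = g (φ (g x))
      rw [hH, hk, hφ, hF1]
  exact ⟨⟨g, φ, hh.symm, hh'.symm⟩⟩

end wedge

end topology

namespace AbsSC

/-- Inclusion of the realization of a subcomplex. -/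
def incl {V : Type*} {K K' : AbsSC V} (h : K.faces ⊆ K'.faces) :
    C(K.realization, K'.realization) where
  toFun p := ⟨p.1, p.2.imp fun _ hs => ⟨h hs.1, hs.2⟩⟩
  continuous_toFun := continuous_of_val (continuous_val K)

theorem incl_val {V : Type*} {K K' : AbsSC V} (h : K.faces ⊆ K'.faces) (p : K.realization) :
    (incl h p).1 = p.1 := rfl

theorem incl_injective {V : Type*} {K K' : AbsSC V} (h : K.faces ⊆ K'.faces) :
    Function.Injective (incl h) :=
  fun _ _ hpq => Subtype.ext (congrArg (fun p => p.1) hpq)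

/-- The complex of chains in `S` which contain no member of `T`. -/
def chainsAvoid {M : Type*} [Preorder M] (S : Set M) (T : Finset (Finset M)) : AbsSC M where
  faces := {σ | ↑σ ⊆ S ∧ IsChain (· ≤ ·) (↑σ : Set M) ∧ ∀ τ ∈ T, ¬ τ ⊆ σ}
  down_closed := fun _s hs _t hts =>
    ⟨(Finset.coe_subset.2 hts).trans hs.1, hs.2.1.mono (Finset.coe_subset.2 hts),
      fun τ hτ h => hs.2.2 τ hτ (h.trans hts)⟩

theorem chainsAvoid_subset {M : Type*} [Preorder M] (S : Set M) (T : Finset (Finset M)) :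
    (chainsAvoid S T).faces ⊆ (chainsIn S).faces := fun _ hσ => ⟨hσ.1, hσ.2.1⟩

theorem isChain_insert_bot {M : Type*} [PartialOrder M] {a b : M} {σ : Finset M}
    (hσ : σ ∈ (chainsIn (Set.Ioo a b)).faces) :
    IsChain (· ≤ ·) (↑(insert a σ) : Set M) := by
  rw [Finset.coe_insert]
  exact hσ.2.insert fun x hx _ => Or.inl (hσ.1 hx).1.le

section step

variable {M : Type*} [Fintype M] [PartialOrder M] {w t : M} {Q : Set M} {Hs : Finset M}
  {T : M → Finset (Finset M)}

/-- The faces obtained by adding the minimal elements in `Hs` to the given faces above them. -/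
def joinFaces (Hs : Finset M) (T : M → Finset (Finset M)) : Finset (Finset M) :=
  Hs.biUnion fun h => (T h).image (insert h)

omit [Fintype M] [PartialOrder M] in
theorem mem_joinFaces {σ : Finset M} :
    σ ∈ joinFaces Hs T ↔ ∃ h ∈ Hs, ∃ τ ∈ T h, insert h τ = σ := by
  simp [joinFaces]

variable (hQS : Q ⊆ Set.Ioo w t) (hHs : ∀ x, x ∈ Hs ↔ x ∈ Set.Ioo w t ∧ x ∉ Q)
  (hmin : ∀ h ∈ Hs, ∀ x ∈ Set.Ioo w t, ¬ x < h) (hup : ∀ h ∈ Hs, Set.Ioo h t ⊆ Q)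
  (hT : ∀ h ∈ Hs, ∀ σ ∈ T h, σ ∈ (chainsIn (Set.Ioo h t)).faces)

omit [Fintype M] in
include hQS hHs hup hT in
theorem insert_mem_chainsAvoid {h : M} (hh : h ∈ Hs) {σ : Finset M}
    (hσ : σ ∈ (chainsAvoid (Set.Ioo h t) (T h)).faces) :
    insert h σ ∈ (chainsAvoid (Set.Ioo w t) (joinFaces Hs T)).faces := by
  refine ⟨?_, isChain_insert_bot (chainsAvoid_subset _ _ hσ), fun τ hτ hle => ?_⟩
  · rw [Finset.coe_insert]
    exact Set.insert_subset ((hHs h).1 hh).1 ((hσ.1.trans (hup h hh)).trans hQS)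
  · obtain ⟨h', hh', τ', hτ', rfl⟩ := mem_joinFaces.1 hτ
    have h1 := hle (Finset.mem_insert_self _ _)
    rcases Finset.mem_insert.1 h1 with rfl | h1
    · refine hσ.2.2 τ' hτ' fun x hx => ?_
      rcases Finset.mem_insert.1 (hle (Finset.mem_insert_of_mem hx)) with rfl | h2
      · exact absurd ((hT _ hh' _ hτ').1 hx).1 (lt_irrefl _)
      · exact h2
    · exact absurd (hup h hh (hσ.1 h1)) ((hHs h').1 hh').2

omit [Fintype M] in
include hQS hHs in
theorem chainsIn_subset_chainsAvoid :
    (chainsIn Q).faces ⊆ (chainsAvoid (Set.Ioo w t) (joinFaces Hs T)).faces := by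
  refine fun σ hσ => ⟨hσ.1.trans hQS, hσ.2, fun τ hτ hle => ?_⟩
  obtain ⟨h', hh', τ', hτ', rfl⟩ := mem_joinFaces.1 hτ
  exact ((hHs h').1 hh').2 (hσ.1 (hle (Finset.mem_insert_self _ _)))

/-- The cone coordinates with cone point `h`. -/
def coneFun (h : M) (q : M → ℝ) (u : ℝ) (x : M) : ℝ := u * q x + (1 - u) * if x = h then 1 else 0

omit [PartialOrder M] in
theorem supp_coneFun {h : M} {q : M → ℝ} {u : ℝ} : supp (coneFun h q u) ⊆ insert h (supp q) := by
  intro x hx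
  rw [mem_supp] at hx
  by_contra hx'
  rw [Finset.mem_insert, mem_supp, not_or, not_not] at hx'
  exact hx (by simp [coneFun, hx'.1, hx'.2])

/-- The characteristic map of a cone. -/
def coneMap {K K' : AbsSC M} (h : M) (hK : ∀ σ ∈ K.faces, insert h σ ∈ K'.faces) :
    C(K.realization × unitInterval, K'.realization) where
  toFun x := K'.pt (coneFun h x.1.1 x.2)
    (fun v => by
      have h1 := nonneg x.1 v
      have h2 := x.2.2.1
      have h3 := x.2.2.2
      unfold coneFun
      split_ifs <;> nlinarith [mul_nonneg h2 h1])
    (by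
      simp only [coneFun, Finset.sum_add_distrib, ← Finset.mul_sum, sum_eq_one]
      simp)
    (K'.down_closed _ (hK _ (supp_mem x.1)) _ supp_coneFun)
  continuous_toFun := continuous_of_val <| continuous_pi fun v => by
    have h1 : Continuous fun x : K.realization × unitInterval => x.1.1 v :=
      (continuous_apply v).comp ((continuous_val K).comp continuous_fst)
    change Continuous fun x : K.realization × unitInterval => coneFun h x.1.1 x.2 v
    unfold coneFun
    fun_prop

omit [PartialOrder M] in
theorem coneMap_val {K K' : AbsSC M} (h : M) (hK : ∀ σ ∈ K.faces, insert h σ ∈ K'.faces)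
    (x : K.realization × unitInterval) (v : M) :
    (coneMap h hK x).1 v = x.2 * x.1.1 v + (1 - x.2) * if v = h then 1 else 0 := rfl

include hQS hHs hmin hup hT in
theorem contractible_chainsAvoid_joinFaces [ContractibleSpace (chainsIn Q).realization]
    (hc : ∀ h ∈ Hs, ContractibleSpace (chainsAvoid (Set.Ioo h t) (T h)).realization) :
    ContractibleSpace (chainsAvoid (Set.Ioo w t) (joinFaces Hs T)).realization := by
  have hins := fun h (hh : h ∈ Hs) σ hσ =>
    insert_mem_chainsAvoid hQS hHs hup hT hh (σ := σ) hσ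
  have := fun h : Hs => hc h.1 h.2
  have hA0 : ∀ h ∈ Hs, ∀ a : (chainsIn Q).realization, a.1 h = 0 := fun h hh a => by
    by_contra hne
    exact ((hHs h).1 hh).2 ((supp_mem a).1 (mem_supp.2 hne))
  have hK0 : ∀ h ∈ Hs, ∀ h' ∈ Hs,
      ∀ q : (chainsAvoid (Set.Ioo h t) (T h)).realization, q.1 h' = 0 := fun h hh h' hh' q => by
    by_contra hne
    exact ((hHs h').1 hh').2 (hup h hh ((supp_mem q).1 (mem_supp.2 hne)))
  refine contractible_of_cones (A := (chainsIn Q).realization) (J := Hs)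
    (K := fun h => (chainsAvoid (Set.Ioo h.1 t) (T h.1)).realization)
    (incl (chainsIn_subset_chainsAvoid hQS hHs)) (incl_injective _)
    (fun h => coneMap h.1 (hins h.1 h.2)) ?_ ?_ ?_ ?_ ?_
  · intro x
    by_cases hx : ↑(supp x.1) ⊆ Q
    · left
      exact ⟨(chainsIn Q).pt x.1 (nonneg x) (sum_eq_one x) ⟨hx, (supp_mem x).2.1⟩, rfl⟩
    · right
      obtain ⟨h, hhx, hhQ⟩ := Set.not_subset.1 hx
      have hh : h ∈ Hs := (hHs h).2 ⟨(supp_mem x).1 hhx, hhQ⟩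
      by_cases h1 : x.1 h = 1
      · obtain ⟨q, -⟩ := @id_nullhomotopic (chainsAvoid (Set.Ioo h t) (T h)).realization _
          (this ⟨h, hh⟩)
        refine ⟨⟨h, hh⟩, (q, 0), Subtype.ext (funext fun v => ?_)⟩
        rw [coneMap_val]
        split_ifs with hv
        · simp [hv, h1]
        · have h2 := sum_eq_one x
          rw [← Finset.add_sum_erase _ _ (Finset.mem_univ h), h1] at h2
          have h3 : ∑ v ∈ Finset.univ.erase h, x.1 v = 0 := by linarith
          rw [Finset.sum_eq_zero_iff_of_nonneg fun v _ => nonneg x v] at h3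
          simp [h3 v (by simp [hv])]
      · have hlt : x.1 h < 1 := lt_of_le_of_ne (le_one x h) h1
        have hpos : 0 < 1 - x.1 h := sub_pos.2 hlt
        let q : M → ℝ := fun v => if v = h then 0 else x.1 v / (1 - x.1 h)
        have hqs : ∀ v ∈ supp q, v ≠ h ∧ v ∈ supp x.1 := fun v hv => by
          rw [mem_supp] at hv ⊢
          by_cases hvh : v = h
          · simp [q, hvh] at hv
          · refine ⟨hvh, fun h0 => hv ?_⟩
            simp [q, h0]
        have hq : supp q ∈ (chainsAvoid (Set.Ioo h t) (T h)).faces := by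
          refine ⟨fun v hv => ?_, (supp_mem x).2.1.mono fun v hv => (hqs v hv).2,
            fun τ hτ hle => ?_⟩
          · obtain ⟨hvh, hvx⟩ := hqs v hv
            have hvI := (supp_mem x).1 hvx
            refine ⟨?_, hvI.2⟩
            rcases (supp_mem x).2.1 hhx hvx (Ne.symm hvh) with h2 | h2
            · exact lt_of_le_of_ne h2 (Ne.symm hvh)
            · exact absurd (lt_of_le_of_ne h2 hvh) (hmin h hh v hvI)
          · refine (supp_mem x).2.2 (insert h τ) (mem_joinFaces.2 ⟨h, hh, τ, hτ, rfl⟩) ?_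
            exact Finset.insert_subset hhx fun v hv => (hqs v (hle hv)).2
        refine ⟨⟨h, hh⟩, (pt _ q (fun v => ?_) ?_ hq, ⟨1 - x.1 h, hpos.le, by
          linarith [nonneg x h]⟩), Subtype.ext (funext fun v => ?_)⟩
        · simp only [q]
          split_ifs
          · rfl
          · exact div_nonneg (nonneg x v) hpos.le
        · have h2 := sum_eq_one x
          rw [← Finset.add_sum_erase _ _ (Finset.mem_univ h)] at h2 ⊢
          have h3 : ∑ v ∈ Finset.univ.erase h, q v =
              ∑ v ∈ Finset.univ.erase h, x.1 v / (1 - x.1 h) :=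
            Finset.sum_congr rfl fun v hv => if_neg (Finset.ne_of_mem_erase hv)
          rw [h3, ← Finset.sum_div]
          simp only [q, if_true, zero_add]
          rw [div_eq_one_iff_eq hpos.ne']
          linarith
        · rw [coneMap_val]
          change (1 - x.1 h) * (if v = h then 0 else x.1 v / (1 - x.1 h)) +
            (1 - (1 - x.1 h)) * _ = _
          split_ifs with hv
          · simp [hv]
          · field_simp
            simp
  · intro h q q'
    refine Subtype.ext (funext fun v => ?_)
    simp [coneMap_val]
  · intro h q
    refine ⟨(chainsIn Q).pt q.1 (nonneg q) (sum_eq_one q)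
      ⟨(supp_mem q).1.trans (hup h.1 h.2), (supp_mem q).2.1⟩, Subtype.ext (funext fun v => ?_)⟩
    rw [coneMap_val, incl_val]
    simp [pt]
  · intro h q u a hqa
    have h1 := congrFun (congrArg (fun p => p.1) hqa) h.1
    rw [coneMap_val, incl_val, hA0 h.1 h.2, hK0 h.1 h.2 h.1 h.2] at h1
    simp only [mul_zero, if_true, mul_one, zero_add] at h1
    exact Subtype.ext (sub_eq_zero.1 h1).symm
  · rintro ⟨h, q, u⟩ ⟨h', q', u'⟩ hab
    have key : ∀ v, (u : ℝ) * q.1 v + (1 - u) * (if v = h.1 then 1 else 0) =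
        u' * q'.1 v + (1 - u') * (if v = h'.1 then 1 else 0) := fun v =>
      congrFun (congrArg (fun p => p.1) hab) v
    have k1 := key h.1
    have k2 := key h'.1
    rw [hK0 h.1 h.2 h.1 h.2, hK0 h'.1 h'.2 h.1 h.2] at k1
    rw [hK0 h.1 h.2 h'.1 h'.2, hK0 h'.1 h'.2 h'.1 h'.2] at k2
    by_cases hhh : h = h'
    · subst hhh
      right
      simp only [mul_zero, if_true, mul_one, zero_add] at k1
      have huu : u = u' := Subtype.ext (by linarith)
      subst huu
      by_cases hu : u = 0
      · exact Or.inl ⟨hu, hu, rfl⟩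
      · right
        have hu' : (u : ℝ) ≠ 0 := fun h0 => hu (Subtype.ext h0)
        have : q = q' := Subtype.ext (funext fun v =>
          mul_left_cancel₀ hu' (add_right_cancel (key v)))
        rw [this]
    · left
      have hne : h.1 ≠ h'.1 := fun h0 => hhh (Subtype.ext h0)
      rw [if_pos rfl, if_neg hne] at k1
      rw [if_pos rfl, if_neg hne.symm] at k2
      exact ⟨Subtype.ext (by simp only [Set.Icc.coe_one]; linarith),
        Subtype.ext (by simp only [Set.Icc.coe_one]; linarith)⟩

end step

section lattice

variable {M Ix : Type*} [Fintype M] [SemilatticeInf M] [OrderTop M] {cr : M → ℕ} {c : Ix → M}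
  (hcr : ∀ x y, x < y → cr y < cr x) (hc : ∀ x i, ¬ x ≤ c i → cr (x ⊓ c i) = cr x + 1)
  (hsep : ∀ x y, x < y → ∃ i, x ≤ c i ∧ ¬ y ≤ c i) (h0 : cr ⊤ = 0)

omit [Fintype M] in
include hcr h0 in
theorem card_add_one_le {w : M} {σ : Finset M} (hσ : σ ∈ (chainsIn (Set.Ioo w ⊤)).faces)
    (hw : w ≠ ⊤) : σ.card + 1 ≤ cr w := by
  have hinj : Set.InjOn cr (↑σ : Set M) := by
    intro x hx y hy hxy
    by_contra hne
    rcases hσ.2 hx hy hne with h | h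
    · exact (hcr x y (lt_of_le_of_ne h hne)).ne' hxy
    · exact (hcr y x (lt_of_le_of_ne h (Ne.symm hne))).ne hxy
  have h1 : σ.image cr ⊆ Finset.Ioo 0 (cr w) := by
    intro n hn
    obtain ⟨x, hx, rfl⟩ := Finset.mem_image.1 hn
    have h2 := hσ.1 hx
    exact Finset.mem_Ioo.2 ⟨h0 ▸ hcr x ⊤ h2.2, hcr w x h2.1⟩
  have h2 := Finset.card_le_card h1
  rw [Finset.card_image_of_injOn hinj, Nat.card_Ioo] at h2
  have h3 := hcr w ⊤ (lt_top_iff_ne_top.2 hw)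
  omega

include hcr hc hsep h0 in
/-- The open interval above `w` becomes contractible after the removal of a non-empty set of
maximal simplices. -/
theorem exists_faces (s : ℕ) : ∀ w : M, cr w = s + 1 →
    ∃ T : Finset (Finset M), T.Nonempty ∧
      (∀ σ ∈ T, σ ∈ (chainsIn (Set.Ioo w ⊤)).faces ∧ σ.card = s) ∧
      (1 ≤ s → ContractibleSpace (chainsAvoid (Set.Ioo w ⊤) T).realization) := by
  induction s with
  | zero =>
    intro w _
    refine ⟨{∅}, Finset.singleton_nonempty _, fun σ hσ => ?_, fun h => by omega⟩
    rw [Finset.mem_singleton.1 hσ]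
    exact ⟨⟨by simp, by simp⟩, rfl⟩
  | succ r ih =>
    intro w hw
    have hwt : w < ⊤ := lt_top_iff_ne_top.2 fun h => by rw [h, h0] at hw; omega
    have htop : ∀ i, ¬ (⊤ : M) ≤ c i → cr (c i) = 1 := fun i hi => by
      have := hc ⊤ i hi
      rwa [top_inf_eq, h0] at this
    have hmem : ∀ i, w ≤ c i → ¬ (⊤ : M) ≤ c i → c i ∈ Set.Ioo w ⊤ := fun i hi hi' => by
      refine ⟨lt_of_le_of_ne hi fun h => ?_, lt_top_iff_ne_top.2 fun h => hi' h.ge⟩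
      have := htop i hi'
      rw [← h] at this
      omega
    obtain ⟨h1, hh1⟩ : ∃ h1, Minimal (· ∈ Set.Ioo w ⊤) h1 := by
      obtain ⟨i, hi, hi'⟩ := hsep w ⊤ hwt
      exact (Set.toFinite (Set.Ioo w ⊤)).exists_minimal ⟨c i, hmem i hi hi'⟩
    obtain ⟨i, hi, hi'⟩ := hsep w h1 hh1.1.1
    have ha : c i ∈ Set.Ioo w ⊤ := hmem i hi fun h => hi' (le_top.trans h)
    let Q : Set M := {x | x ∈ Set.Ioo w ⊤ ∧ w < x ⊓ c i}
    let Hs : Finset M := Finset.univ.filter fun x => x ∈ Set.Ioo w ⊤ ∧ x ∉ Q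
    have hHs : ∀ x, x ∈ Hs ↔ x ∈ Set.Ioo w ⊤ ∧ x ∉ Q := fun x => by simp [Hs]
    have hinf : ∀ x ∈ Hs, x ⊓ c i = w := fun x hx => by
      obtain ⟨h2, h3⟩ := (hHs x).1 hx
      by_contra hne
      exact h3 ⟨h2, lt_of_le_of_ne (le_inf h2.1.le hi) (Ne.symm hne)⟩
    have hcrH : ∀ x ∈ Hs, cr x = r + 1 := fun x hx => by
      have h2 := hinf x hx
      have h3 : ¬ x ≤ c i := fun h => by
        rw [inf_eq_left.2 h] at h2
        exact ((hHs x).1 hx).1.1.ne' h2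
      have h4 := hc x i h3
      rw [h2, hw] at h4
      omega
    have hQS : Q ⊆ Set.Ioo w ⊤ := fun x hx => hx.1
    have hmin : ∀ h ∈ Hs, ∀ x ∈ Set.Ioo w ⊤, ¬ x < h := fun h hh x hx hlt => by
      have h2 := hcr x h hlt
      have h3 := hcr w x hx.1
      rw [hcrH h hh] at h2
      omega
    have hup : ∀ h ∈ Hs, Set.Ioo h ⊤ ⊆ Q := fun h hh x hx => by
      by_contra hxQ
      have hxH : x ∈ Hs := (hHs x).2 ⟨⟨((hHs h).1 hh).1.1.trans hx.1, hx.2⟩, hxQ⟩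
      have h2 := hcr h x hx.1
      rw [hcrH h hh, hcrH x hxH] at h2
      omega
    have hh1s : h1 ∈ Hs := by
      refine (hHs h1).2 ⟨hh1.1, fun hQ => hi' ?_⟩
      exact (hh1.2 (y := h1 ⊓ c i) ⟨hQ.2, inf_le_left.trans_lt hh1.1.2⟩ inf_le_left).trans
        inf_le_right
    have ih' : ∀ h : M, ∃ T : Finset (Finset M), h ∈ Hs → T.Nonempty ∧
        (∀ σ ∈ T, σ ∈ (chainsIn (Set.Ioo h ⊤)).faces ∧ σ.card = r) ∧
        (1 ≤ r → ContractibleSpace (chainsAvoid (Set.Ioo h ⊤) T).realization) := fun h => by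
      by_cases hh : h ∈ Hs
      · obtain ⟨T, hT⟩ := ih h (hcrH h hh)
        exact ⟨T, fun _ => hT⟩
      · exact ⟨∅, fun h' => absurd h' hh⟩
    choose T hT using ih'
    have hcQ : ContractibleSpace (chainsIn Q).realization := by
      refine contractible_chainsIn (f := fun x => x ⊓ c i) (a := c i) ?_ ?_ ?_ ?_ ?_
      · intro x hx
        exact ⟨⟨hx.2, inf_le_left.trans_lt hx.1.2⟩, by simpa using hx.2⟩
      · intro x _ y _ hxy
        exact inf_le_inf_right _ hxy
      · exact fun x _ => inf_le_left
      · exact ⟨ha, by simpa using ha.1⟩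
      · exact fun x _ => inf_le_right
    have hTc : ∀ h ∈ Hs, ∀ σ ∈ T h, σ ∈ (chainsIn (Set.Ioo h ⊤)).faces :=
      fun h hh σ hσ => ((hT h hh).2.1 σ hσ).1
    refine ⟨joinFaces Hs T, ?_, ?_, fun _ => ?_⟩
    · obtain ⟨σ, hσ⟩ := (hT h1 hh1s).1
      exact ⟨_, mem_joinFaces.2 ⟨h1, hh1s, σ, hσ, rfl⟩⟩
    · intro σ hσ
      obtain ⟨h, hh, τ, hτ, rfl⟩ := mem_joinFaces.1 hσ
      have hτ1 := hTc h hh τ hτ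
      refine ⟨⟨?_, isChain_insert_bot hτ1⟩, ?_⟩
      · rw [Finset.coe_insert]
        exact Set.insert_subset ((hHs h).1 hh).1 ((hτ1.1.trans (hup h hh)).trans hQS)
      · rw [Finset.card_insert_of_notMem fun hm => lt_irrefl _ (hτ1.1 hm).1,
          ((hT h hh).2.1 τ hτ).2]
    · rcases Nat.eq_zero_or_pos r with rfl | hr
      · have hfe : (chainsAvoid (Set.Ioo w ⊤) (joinFaces Hs T)).faces = (chainsIn Q).faces := by
          refine Set.Subset.antisymm (fun σ hσ => ⟨fun x hx => ?_, hσ.2.1⟩)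
            (chainsIn_subset_chainsAvoid hQS hHs)
          by_contra hxQ
          have hxH : x ∈ Hs := (hHs x).2 ⟨hσ.1 hx, hxQ⟩
          obtain ⟨τ, hτ⟩ := (hT x hxH).1
          have hτ0 : τ = ∅ := Finset.card_eq_zero.1 ((hT x hxH).2.1 τ hτ).2
          refine hσ.2.2 (insert x τ) (mem_joinFaces.2 ⟨x, hxH, τ, hτ, rfl⟩) ?_
          rw [hτ0]
          simpa using hx
        have hKe : chainsAvoid (Set.Ioo w ⊤) (joinFaces Hs T) = chainsIn Q := by
          revert hfe
          generalize chainsAvoid (Set.Ioo w ⊤) (joinFaces Hs T) = K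
          generalize chainsIn Q = K'
          rcases K with ⟨f, _⟩
          rcases K' with ⟨f', _⟩
          rintro rfl
          rfl
        rw [hKe]
        exact hcQ
      · exact contractible_chainsAvoid_joinFaces hQS hHs hmin hup hTc
          fun h hh => (hT h hh).2.2 hr

end lattice

end AbsSC

section discs

/-- The corner of the positive orthant cut off by the hyperplane of sum one. -/
def cornerSimplex (d : ℕ) : Set (EuclideanSpace ℝ (Fin d)) :=
  {y | (∀ i, 0 ≤ y i) ∧ ∑ i, y i ≤ 1}

theorem interior_cornerSimplex (d : ℕ) :
    interior (cornerSimplex d) = {y | (∀ i, 0 < y i) ∧ ∑ i, y i < 1} := by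
  refine Set.Subset.antisymm (fun y hy => ?_) (interior_maximal (fun y hy =>
    ⟨fun i => (hy.1 i).le, hy.2.le⟩) ?_)
  · have key : ∀ z : EuclideanSpace ℝ (Fin d), ∃ ε > (0 : ℝ), y + ε • z ∈ cornerSimplex d := by
      intro z
      have hcont : Continuous fun ε : ℝ => y + ε • z := by fun_prop
      have h1 : ∀ᶠ ε in nhds (0 : ℝ), y + ε • z ∈ cornerSimplex d := by
        refine hcont.continuousAt.eventually ?_
        simp only [zero_smul, add_zero]
        exact mem_interior_iff_mem_nhds.1 hy
      have h2 := (h1.filter_mono nhdsWithin_le_nhds).and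
        (self_mem_nhdsWithin : Set.Ioi (0 : ℝ) ∈ nhdsWithin 0 (Set.Ioi 0))
      obtain ⟨ε, h3, h4⟩ := h2.exists
      exact ⟨ε, h4, h3⟩
    constructor
    · intro i
      obtain ⟨ε, hε, h⟩ := key (-EuclideanSpace.single i 1)
      have := h.1 i
      simp at this
      linarith
    · rcases Nat.eq_zero_or_pos d with rfl | hd
      · simp
      · obtain ⟨ε, hε, h⟩ := key (EuclideanSpace.single ⟨0, hd⟩ 1)
        have := h.2
        simp [Finset.sum_add_distrib] at this
        linarith
  · have h1 : IsOpen {y : EuclideanSpace ℝ (Fin d) | ∑ i, y i < 1} :=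
      isOpen_lt (by fun_prop) continuous_const
    have h2 : IsOpen (⋂ i, {y : EuclideanSpace ℝ (Fin d) | 0 < y i}) :=
      isOpen_iInter_of_finite fun i => isOpen_lt continuous_const (by fun_prop)
    convert h2.inter h1 using 1
    ext y
    simp

theorem exists_ball_simplex (d : ℕ) :
    ∃ β : C(Metric.closedBall (0 : EuclideanSpace ℝ (Fin d)) 1, Fin (d + 1) → ℝ),
      (∀ x, β x ∈ stdSimplex ℝ (Fin (d + 1))) ∧ Function.Injective β ∧
      (∀ y ∈ stdSimplex ℝ (Fin (d + 1)), ∃ x, β x = y) ∧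
      ∀ x : Metric.closedBall (0 : EuclideanSpace ℝ (Fin d)) 1,
        ‖(x : EuclideanSpace ℝ (Fin d))‖ = 1 ↔ ∃ i, β x i = 0 := by
  have hconv : Convex ℝ (cornerSimplex d) := by
    intro x hx y hy a b ha hb hab
    refine ⟨fun i => ?_, ?_⟩
    · exact add_nonneg (mul_nonneg ha (hx.1 i)) (mul_nonneg hb (hy.1 i))
    · have : ∑ i, (a • x + b • y) i = a * ∑ i, x i + b * ∑ i, y i := by
        simp [Finset.sum_add_distrib, Finset.mul_sum]
      rw [this]
      nlinarith [hx.2, hy.2]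
  have hclosed : IsClosed (cornerSimplex d) := by
    have h1 : IsClosed {y : EuclideanSpace ℝ (Fin d) | ∑ i, y i ≤ 1} :=
      isClosed_le (by fun_prop) continuous_const
    have h2 : IsClosed (⋂ i, {y : EuclideanSpace ℝ (Fin d) | 0 ≤ y i}) :=
      isClosed_iInter fun i => isClosed_le continuous_const (by fun_prop)
    convert h2.inter h1 using 1
    ext y
    simp [cornerSimplex]
  have hbdd : Bornology.IsBounded (cornerSimplex d) := by
    refine (Metric.isBounded_iff_subset_closedBall 0).2 ⟨1, fun y hy => ?_⟩
    rw [mem_closedBall_zero_iff, EuclideanSpace.norm_eq, Real.sqrt_le_left zero_le_one, one_pow]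
    have h1 : ∀ i, y i ≤ 1 := fun i =>
      (Finset.single_le_sum (fun j _ => hy.1 j) (Finset.mem_univ i)).trans hy.2
    refine le_trans (Finset.sum_le_sum fun i _ => ?_) hy.2
    rw [Real.norm_of_nonneg (hy.1 i)]
    nlinarith [hy.1 i, h1 i]
  have hne : (interior (cornerSimplex d)).Nonempty := by
    rw [interior_cornerSimplex]
    refine ⟨WithLp.toLp 2 fun _ => ((d : ℝ) + 1)⁻¹, fun i => by simp; positivity, ?_⟩
    simp
    rw [← div_eq_mul_inv, div_lt_one (by positivity)]
    linarith
  obtain ⟨h, h1, h2, -⟩ := exists_homeomorph_image_interior_closure_frontier_eq_unitBall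
    hconv hne hbdd
  rw [hclosed.closure_eq] at h2
  have hmem : ∀ x : Metric.closedBall (0 : EuclideanSpace ℝ (Fin d)) 1,
      h.symm x ∈ cornerSimplex d := fun x => by
    obtain ⟨y, hy, hyx⟩ := h2.ge x.2
    rw [← hyx, h.symm_apply_apply]
    exact hy
  refine ⟨⟨fun x => Fin.cons (1 - ∑ i, h.symm x i) (fun i => h.symm x i), ?_⟩, ?_, ?_, ?_, ?_⟩
  · refine continuous_pi fun i => ?_
    refine Fin.cases ?_ (fun j => ?_) i
    · simp only [Fin.cons_zero]
      fun_prop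
    · simp only [Fin.cons_succ]
      fun_prop
  · intro x
    refine ⟨fun i => ?_, ?_⟩
    · refine Fin.cases ?_ (fun j => ?_) i
      · exact sub_nonneg.2 (hmem x).2
      · exact (hmem x).1 j
    · simp [Fin.sum_univ_succ]
  · intro x x' hxx
    refine Subtype.ext (h.symm.injective (PiLp.ext fun i => ?_))
    exact congrFun hxx i.succ
  · intro y hy
    have hy' : (WithLp.toLp 2 fun i : Fin d => y i.succ) ∈ cornerSimplex d := by
      refine ⟨fun i => hy.1 _, ?_⟩
      have := hy.2
      rw [Fin.sum_univ_succ] at this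
      have h0 := hy.1 0
      simp only
      linarith
    refine ⟨⟨h (WithLp.toLp 2 fun i : Fin d => y i.succ), h2.le ⟨_, hy', rfl⟩⟩, ?_⟩
    ext i
    refine Fin.cases ?_ (fun j => ?_) i
    · have := hy.2
      rw [Fin.sum_univ_succ] at this
      simp
      linarith
    · simp
  · intro x
    have h3 : ‖(x : EuclideanSpace ℝ (Fin d))‖ = 1 ↔ h.symm x ∉ interior (cornerSimplex d) := by
      have h4 := mem_closedBall_zero_iff.1 x.2
      have h5 : h.symm x ∈ interior (cornerSimplex d) ↔
          (x : EuclideanSpace ℝ (Fin d)) ∈ Metric.ball 0 1 := by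
        rw [← h1]
        constructor
        · intro h6
          exact ⟨_, h6, h.apply_symm_apply _⟩
        · rintro ⟨y, hy, hyx⟩
          rw [← hyx, h.symm_apply_apply]
          exact hy
      rw [h5, mem_ball_zero_iff, not_lt]
      exact ⟨fun h => h.ge, fun h => le_antisymm h4 h⟩
    rw [h3, interior_cornerSimplex, Set.mem_ofPred_eq, not_and_or, not_forall]
    have hm := hmem x
    constructor
    · rintro (⟨i, hi⟩ | hi)
      · exact ⟨i.succ, le_antisymm (not_lt.1 hi) (hm.1 i)⟩
      · refine ⟨0, le_antisymm ?_ (sub_nonneg.2 hm.2)⟩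
        exact sub_nonpos.2 (not_lt.1 hi)
    · rintro ⟨i, hi⟩
      revert hi
      refine Fin.cases (fun hi => ?_) (fun j hi => ?_) i
      · right
        have : 1 - ∑ i, h.symm x i = 0 := hi
        linarith
      · left
        exact ⟨j, fun h7 => h7.ne' hi⟩

open Module in
theorem exists_ball_sphere {d : ℕ} (v : Metric.sphere (0 : EuclideanSpace ℝ (Fin (d + 1))) 1) :
    ∃ θ : C(Metric.closedBall (0 : EuclideanSpace ℝ (Fin d)) 1,
        Metric.sphere (0 : EuclideanSpace ℝ (Fin (d + 1))) 1),
      (∀ z, z ≠ v → ∃ x, θ x = z) ∧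
      (∀ x : Metric.closedBall (0 : EuclideanSpace ℝ (Fin d)) 1,
        θ x = v ↔ ‖(x : EuclideanSpace ℝ (Fin d))‖ = 1) ∧
      ∀ x x' : Metric.closedBall (0 : EuclideanSpace ℝ (Fin d)) 1,
        ‖(x : EuclideanSpace ℝ (Fin d))‖ ≠ 1 → θ x = θ x' → x = x' := by
  obtain ⟨v, hv⟩ := v
  have hv1 : ‖v‖ = 1 := mem_sphere_zero_iff_norm.1 hv
  have hv0 : v ≠ 0 := fun h => by simp [h] at hv1
  have : Fact (finrank ℝ (EuclideanSpace ℝ (Fin (d + 1))) = d + 1) := ⟨by simp⟩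
  let L := (OrthonormalBasis.fromOrthogonalSpanSingleton (𝕜 := ℝ) d hv0).repr.symm
  have hLv : ∀ x, inner ℝ v (L x : EuclideanSpace ℝ (Fin (d + 1))) = 0 := fun x =>
    Submodule.mem_orthogonal_singleton_iff_inner_right.1 (L x).2
  have hLn : ∀ x, ‖(L x : EuclideanSpace ℝ (Fin (d + 1)))‖ = ‖x‖ := fun x => L.norm_map x
  let f : EuclideanSpace ℝ (Fin d) → EuclideanSpace ℝ (Fin (d + 1)) := fun x =>
    (2 * ‖x‖ ^ 2 - 1) • v + (2 * √(1 - ‖x‖ ^ 2)) • (L x : EuclideanSpace ℝ (Fin (d + 1)))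
  have hfc : Continuous f := by
    have : Continuous fun x => (L x : EuclideanSpace ℝ (Fin (d + 1))) :=
      continuous_subtype_val.comp L.continuous
    fun_prop
  have hvv : inner ℝ v v = (1 : ℝ) := by rw [real_inner_self_eq_norm_sq, hv1, one_pow]
  have hfv : ∀ x, inner ℝ v (f x) = 2 * ‖x‖ ^ 2 - 1 := fun x => by
    simp only [f, inner_add_right, inner_smul_right, hLv, hvv]
    ring
  have hnorm : ∀ a b x, ‖a • v + b • (L x : EuclideanSpace ℝ (Fin (d + 1)))‖ ^ 2 =
      a ^ 2 + b ^ 2 * ‖x‖ ^ 2 := fun a b x => by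
    rw [norm_add_sq_real, inner_smul_left, inner_smul_right, hLv, norm_smul, norm_smul, hLn, hv1,
      mul_pow, mul_pow, Real.norm_eq_abs, Real.norm_eq_abs, sq_abs, sq_abs]
    simp
  have hfs : ∀ x, ‖x‖ ≤ 1 → f x ∈ Metric.sphere (0 : EuclideanSpace ℝ (Fin (d + 1))) 1 := by
    intro x hx
    have h1 : 0 ≤ 1 - ‖x‖ ^ 2 := by nlinarith [norm_nonneg x]
    rw [mem_sphere_zero_iff_norm, ← sq_eq_sq₀ (norm_nonneg _) zero_le_one, hnorm, mul_pow,
      Real.sq_sqrt h1]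
    ring
  have hx1 : ∀ x : Metric.closedBall (0 : EuclideanSpace ℝ (Fin d)) 1,
      ‖(x : EuclideanSpace ℝ (Fin d))‖ ≤ 1 := fun x => mem_closedBall_zero_iff.1 x.2
  refine ⟨⟨fun x => ⟨f x, hfs x (hx1 x)⟩, by fun_prop⟩, ?_, ?_, ?_⟩
  · rintro ⟨z, hz⟩ hzv
    have hz1 : ‖z‖ = 1 := mem_sphere_zero_iff_norm.1 hz
    set t : ℝ := inner ℝ v z with ht
    have ht1 : t < 1 := by
      refine lt_of_le_of_ne ?_ fun h => hzv (Subtype.ext ?_)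
      · have := real_inner_le_norm v z
        rwa [hv1, hz1, one_mul] at this
      · exact ((inner_eq_one_iff_of_norm_eq_one (𝕜 := ℝ) hv1 hz1).1 h).symm
    have ht2 : -1 ≤ t := by
      have := neg_le_of_abs_le (abs_real_inner_le_norm v z)
      rwa [hv1, hz1, one_mul] at this
    have hw : z - t • v ∈ (Submodule.span ℝ {v})ᗮ := by
      rw [Submodule.mem_orthogonal_singleton_iff_inner_right, inner_sub_right, inner_smul_right,
        hvv, mul_one, ← ht, sub_self]
    have hwn : ‖z - t • v‖ ^ 2 = 1 - t ^ 2 := by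
      rw [norm_sub_sq_real, inner_smul_right, real_inner_comm, ← ht, norm_smul, hz1, hv1, mul_one,
        Real.norm_eq_abs, sq_abs]
      ring
    let s : ℝ := 2 * √((1 - t) / 2)
    have hs0 : 0 < s := by
      have : 0 < (1 - t) / 2 := by linarith
      have := Real.sqrt_pos.2 this
      positivity
    have hs2 : s ^ 2 = 2 * (1 - t) := by
      rw [mul_pow, Real.sq_sqrt (by linarith)]
      ring
    let x : EuclideanSpace ℝ (Fin d) := s⁻¹ • L.symm ⟨z - t • v, hw⟩
    have hxn : ‖x‖ ^ 2 = (1 + t) / 2 := by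
      rw [norm_smul, mul_pow, LinearIsometryEquiv.norm_map, Submodule.coe_norm, hwn, norm_inv,
        inv_pow, Real.norm_eq_abs, sq_abs, hs2]
      have : 1 - t ≠ 0 := by linarith
      field_simp
      ring
    have hxle : ‖x‖ ≤ 1 := by
      rw [← sq_le_one_iff₀ (norm_nonneg _), hxn]
      linarith
    refine ⟨⟨x, mem_closedBall_zero_iff.2 hxle⟩, Subtype.ext ?_⟩
    change f x = z
    have h3 : 1 - ‖x‖ ^ 2 = (1 - t) / 2 := by rw [hxn]; ring
    have h4 : (L x : EuclideanSpace ℝ (Fin (d + 1))) = s⁻¹ • (z - t • v) := by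
      simp [x]
    simp only [f]
    rw [h3, h4, hxn]
    change _ + s • _ = _
    rw [smul_smul, mul_inv_cancel₀ hs0.ne', one_smul]
    have : 2 * ((1 + t) / 2) - 1 = t := by ring
    rw [this]
    abel
  · intro x
    constructor
    · intro h
      have h1 : f x = v := congrArg Subtype.val h
      have h2 := hfv x
      rw [h1, hvv] at h2
      have h3 : ‖(x : EuclideanSpace ℝ (Fin d))‖ ^ 2 = 1 := by linarith
      exact (pow_eq_one_iff_of_nonneg (norm_nonneg _) two_ne_zero).1 h3
    · intro h
      refine Subtype.ext ?_
      change f x = v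
      simp only [f, h]
      norm_num
  · intro x x' hx h
    have h1 : f x = f x' := congrArg Subtype.val h
    have h2 := congrArg (fun z => inner ℝ v z) h1
    simp only [hfv] at h2
    have h3 : ‖(x : EuclideanSpace ℝ (Fin d))‖ ^ 2 = ‖(x' : EuclideanSpace ℝ (Fin d))‖ ^ 2 := by
      linarith
    simp only [f] at h1
    rw [← h3] at h1
    have h4 := add_left_cancel h1
    have h5 : 0 < 1 - ‖(x : EuclideanSpace ℝ (Fin d))‖ ^ 2 := by
      have := lt_of_le_of_ne (hx1 x) hx
      nlinarith [norm_nonneg (x : EuclideanSpace ℝ (Fin d))]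
    have h6 : 2 * √(1 - ‖(x : EuclideanSpace ℝ (Fin d))‖ ^ 2) ≠ 0 := by
      have := Real.sqrt_pos.2 h5
      positivity
    exact Subtype.ext (L.injective (Subtype.ext (smul_right_injective _ h6 h4)))

end discs

namespace AbsSC

section disc

variable {M : Type*} [Fintype M] {d : ℕ} {K : AbsSC M} {τ : Finset M}

/-- The weights on the vertices of a simplex, extended by zero. -/
def simplexFun (e : Fin (d + 1) ≃ τ) (y : Fin (d + 1) → ℝ) (v : M) : ℝ :=
  ∑ i, if (e i : M) = v then y i else 0

omit [Fintype M] in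
theorem simplexFun_apply (e : Fin (d + 1) ≃ τ) (y : Fin (d + 1) → ℝ) (i : Fin (d + 1)) :
    simplexFun e y (e i) = y i := by
  rw [simplexFun, Finset.sum_eq_single i]
  · simp
  · intro j _ hj
    exact if_neg fun h => hj (e.injective (Subtype.ext h))
  · simp

theorem supp_simplexFun (e : Fin (d + 1) ≃ τ) (y : Fin (d + 1) → ℝ) :
    supp (simplexFun e y) ⊆ τ := by
  intro v hv
  rw [mem_supp] at hv
  obtain ⟨i, -, hi⟩ := Finset.exists_ne_zero_of_sum_ne_zero hv
  rw [ite_ne_right_iff] at hi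
  rw [← hi.1]
  exact (e i).2

theorem supp_simplexFun_eq (e : Fin (d + 1) ≃ τ) {y : Fin (d + 1) → ℝ} :
    supp (simplexFun e y) = τ ↔ ∀ i, y i ≠ 0 := by
  constructor
  · intro h i
    rw [← simplexFun_apply e y i, ← mem_supp, h]
    exact (e i).2
  · intro h
    refine (supp_simplexFun e y).antisymm fun v hv => ?_
    obtain ⟨i, hi⟩ := e.surjective ⟨v, hv⟩
    have hi' : (e i : M) = v := congrArg Subtype.val hi
    rw [mem_supp, ← hi', simplexFun_apply]
    exact h i

/-- The characteristic map of a simplex, with parameters in a space mapping to the standard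
simplex. -/
def simplexMap {B : Type*} [TopologicalSpace B] (hτ : τ ∈ K.faces) (e : Fin (d + 1) ≃ τ)
    (β : C(B, Fin (d + 1) → ℝ)) (hβ : ∀ x, β x ∈ stdSimplex ℝ (Fin (d + 1))) :
    C(B, K.realization) where
  toFun x := K.pt (simplexFun e (β x))
    (fun v => Finset.sum_nonneg fun i _ => by split_ifs; exacts [(hβ x).1 i, le_rfl])
    (by
      unfold simplexFun
      rw [Finset.sum_comm]
      simpa using (hβ x).2)
    (K.down_closed _ hτ _ (supp_simplexFun e _))
  continuous_toFun := continuous_of_val <| continuous_pi fun v => by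
    change Continuous fun x => ∑ i, if (e i : M) = v then β x i else 0
    refine continuous_finsetSum _ fun i _ => ?_
    split_ifs
    · exact (continuous_apply i).comp β.continuous
    · exact continuous_const

end disc

theorem homotopyEquiv_of_chainsAvoid {M : Type} [Fintype M] [PartialOrder M] {S : Set M}
    {T : Finset (Finset M)} {d : ℕ} (hne : T.Nonempty)
    (hT : ∀ τ ∈ T, τ ∈ (chainsIn S).faces ∧ τ.card = d + 1)
    (hmax : ∀ τ ∈ (chainsIn S).faces, τ.card ≤ d + 1)
    [ContractibleSpace (chainsAvoid S T).realization] :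
    Nonempty (ContinuousMap.HomotopyEquiv (chainsIn S).realization (SphereWedge T d)) := by
  obtain ⟨β, hβ, hβi, hβs, hβ1⟩ := exists_ball_simplex d
  obtain ⟨θ, hθs, hθ1, hθ⟩ := exists_ball_sphere (spherePt d)
  have : Nonempty T := hne.to_subtype
  let e : ∀ τ : T, Fin (d + 1) ≃ τ.1 := fun τ => (τ.1.equivFinOfCardEq (hT τ.1 τ.2).2).symm
  have hsupp : ∀ (τ : T) x, supp (simplexMap (hT τ.1 τ.2).1 (e τ) β hβ x).1 = τ.1 ↔
      ‖(x : EuclideanSpace ℝ (Fin d))‖ ≠ 1 := fun τ x => by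
    rw [Ne, hβ1, not_exists]
    exact supp_simplexFun_eq (e τ)
  have hsub : ∀ (τ : T) x, supp (simplexMap (hT τ.1 τ.2).1 (e τ) β hβ x).1 ⊆ τ.1 := fun τ x =>
    supp_simplexFun (e τ) _
  have key : ∀ (τ : T) x (τ' : T) x', simplexMap (hT τ.1 τ.2).1 (e τ) β hβ x =
      simplexMap (hT τ'.1 τ'.2).1 (e τ') β hβ x' → ‖(x : EuclideanSpace ℝ (Fin d))‖ ≠ 1 →
      τ = τ' ∧ x = x' := by
    intro τ x τ' x' h hx
    have h1 := (hsupp τ x).2 hx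
    rw [h] at h1
    have h2 := hsub τ' x'
    rw [h1] at h2
    have h3 : τ = τ' := Subtype.ext (Finset.eq_of_subset_of_card_le h2
      (by rw [(hT τ.1 τ.2).2, (hT τ'.1 τ'.2).2]))
    subst h3
    refine ⟨rfl, hβi (funext fun i => ?_)⟩
    have h4 := congrFun (congrArg (fun p => p.1) h) (e τ i)
    exact (simplexFun_apply (e τ) _ i).symm.trans (h4.trans (simplexFun_apply (e τ) _ i))
  refine homotopyEquiv_sphereWedge (A := (chainsAvoid S T).realization)
    (E := EuclideanSpace ℝ (Fin d)) (incl (chainsAvoid_subset S T)) (incl_injective _)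
    (fun τ => simplexMap (hT τ.1 τ.2).1 (e τ) β hβ) ?_ ?_ ?_ ?_ θ hθs hθ1 hθ
  · intro p
    by_cases hp : ∃ τ ∈ T, τ ⊆ supp p.1
    · right
      obtain ⟨τ, hτ, hle⟩ := hp
      have hpτ : τ = supp p.1 := Finset.eq_of_subset_of_card_le hle
        ((hmax _ (supp_mem p)).trans_eq (hT τ hτ).2.symm)
      have hval : ∀ y : Fin (d + 1) → ℝ, (∀ i, y i = p.1 (e ⟨τ, hτ⟩ i)) →
          simplexFun (e ⟨τ, hτ⟩) y = p.1 := by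
        intro y hy
        funext v
        by_cases hv : v ∈ τ
        · obtain ⟨i, hi⟩ := (e ⟨τ, hτ⟩).surjective ⟨v, hv⟩
          have hi' : (e ⟨τ, hτ⟩ i : M) = v := congrArg Subtype.val hi
          rw [← hi', simplexFun_apply, hy]
        · have h1 : v ∉ supp (simplexFun (e ⟨τ, hτ⟩) y) := fun h =>
            hv (supp_simplexFun (e ⟨τ, hτ⟩) y h)
          have h2 : v ∉ supp p.1 := hpτ ▸ hv
          rw [mem_supp, not_not] at h1 h2
          rw [h1, h2]
      have hy : (fun i => p.1 (e ⟨τ, hτ⟩ i)) ∈ stdSimplex ℝ (Fin (d + 1)) := by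
        refine ⟨fun i => nonneg p _, ?_⟩
        rw [Equiv.sum_comp (e ⟨τ, hτ⟩) (fun v => p.1 v), Finset.sum_coe_sort τ (fun v => p.1 v)]
        refine (Finset.sum_subset (Finset.subset_univ _) fun v _ hv => ?_).trans (sum_eq_one p)
        rw [hpτ, mem_supp, not_not] at hv
        exact hv
      obtain ⟨x, hx⟩ := hβs _ hy
      exact ⟨⟨τ, hτ⟩, x, Subtype.ext (hval (β x) fun i => congrFun hx i)⟩
    · left
      refine ⟨(chainsAvoid S T).pt p.1 (nonneg p) (sum_eq_one p)
        ⟨(supp_mem p).1, (supp_mem p).2, fun τ hτ hle => hp ⟨τ, hτ, hle⟩⟩, rfl⟩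
  · intro τ x hx
    have h1 := hsub τ x
    have h2 : supp (simplexMap (hT τ.1 τ.2).1 (e τ) β hβ x).1 ≠ τ.1 := fun h =>
      (hsupp τ x).1 h hx
    have h3 := Finset.card_lt_card (h1.ssubset_of_ne h2)
    have h4 := supp_mem (simplexMap (hT τ.1 τ.2).1 (e τ) β hβ x)
    refine ⟨(chainsAvoid S T).pt (simplexMap (hT τ.1 τ.2).1 (e τ) β hβ x).1 (nonneg _)
      (sum_eq_one _) ⟨h4.1, h4.2, fun τ' hτ' hle => ?_⟩, rfl⟩
    have h5 := Finset.card_le_card hle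
    rw [(hT τ' hτ').2] at h5
    have h6 := (hT τ.1 τ.2).2
    omega
  · intro τ x a h
    by_contra hx
    have h1 := (hsupp τ x).2 hx
    rw [h] at h1
    exact (supp_mem a).2.2 τ.1 τ.2 h1.ge
  · intro τ x τ' x' h
    by_cases hx : ‖(x : EuclideanSpace ℝ (Fin d))‖ = 1
    · by_cases hx' : ‖(x' : EuclideanSpace ℝ (Fin d))‖ = 1
      · exact Or.inl ⟨hx, hx'⟩
      · obtain ⟨h1, h2⟩ := key τ' x' τ x h.symm hx'
        exact Or.inr ⟨h1.symm, h2.symm⟩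
    · exact Or.inr (key τ x τ' x' h hx)

/-- The proper part of a lattice in which every corank one element decreases corank by at most
one, and elements are separated by such elements, is a wedge of spheres. -/
theorem exists_homotopyEquiv_sphereWedge {M : Type} {Ix : Type*} [Fintype M] [SemilatticeInf M]
    [OrderTop M] {cr : M → ℕ} {c : Ix → M} (hcr : ∀ x y, x < y → cr y < cr x)
    (hc : ∀ x i, ¬ x ≤ c i → cr (x ⊓ c i) = cr x + 1)
    (hsep : ∀ x y, x < y → ∃ i, x ≤ c i ∧ ¬ y ≤ c i) (h0 : cr ⊤ = 0) {w : M} {d : ℕ}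
    (hw : cr w = d + 2) :
    ∃ ι : Type, Nonempty ι ∧ Nonempty (ContinuousMap.HomotopyEquiv
      (chainsIn (Set.Ioo w ⊤)).realization (SphereWedge ι d)) := by
  obtain ⟨T, h1, h2, h3⟩ := exists_faces hcr hc hsep h0 (d + 1) w hw
  have := h3 (by omega)
  have hwt : w ≠ ⊤ := fun h => by rw [h, h0] at hw; omega
  refine ⟨T, h1.to_subtype, homotopyEquiv_of_chainsAvoid h1 h2 fun τ hτ => ?_⟩
  have := card_add_one_le hcr h0 hτ hwt
  omega

end AbsSC

namespace MGraph

open Module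

variable {G : MGraph}

/-- Incidence coefficient modulo two. -/
def inc (G : MGraph) (e : G.E) (w : G.V) : ZMod 2 :=
  if G.ends e = Sym2.diag w then 0 else if w ∈ G.ends e then 1 else 0

theorem exists_ends (e : G.E) : ∃ a b, G.ends e = s(a, b) :=
  Sym2.ind (f := fun z => ∃ a b, z = s(a, b)) (fun a b => ⟨a, b, rfl⟩) (G.ends e)

theorem inc_eq {e : G.E} {a b : G.V} (h : G.ends e = s(a, b)) (w : G.V) :
    G.inc e w =
      Pi.single (M := fun _ => ZMod 2) a 1 w + Pi.single (M := fun _ => ZMod 2) b 1 w := by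
  rw [inc, h, Pi.single_apply, Pi.single_apply]
  have h2 : s(a, b) = Sym2.diag w ↔ w = a ∧ w = b := by
    rw [Sym2.diag, Sym2.eq_iff]
    tauto
  simp only [h2, Sym2.mem_iff]
  by_cases ha : w = a <;> by_cases hb : w = b <;> simp [ha, hb]
  all_goals simp_all
  decide

theorem valence_cast (S : Finset G.E) (w : G.V) :
    ((G.valence S w : ℕ) : ZMod 2) = ∑ e ∈ S, G.inc e w := by
  rw [valence, Nat.cast_sum]
  refine Finset.sum_congr rfl fun e _ => ?_
  rw [inc]
  split_ifs
  · decide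
  · simp
  · simp

/-- The boundary map on chains modulo two. -/
def bd (G : MGraph) : (G.E → ZMod 2) →ₗ[ZMod 2] (G.V → ZMod 2) where
  toFun z w := ∑ e, z e * G.inc e w
  map_add' x y := by
    ext w
    simp [add_mul, Finset.sum_add_distrib]
  map_smul' c x := by
    ext w
    simp [Finset.mul_sum, mul_assoc]

theorem bd_apply (z : G.E → ZMod 2) (w : G.V) : G.bd z w = ∑ e, z e * G.inc e w := rfl

theorem bd_single {e : G.E} {a b : G.V} (h : G.ends e = s(a, b)) :
    G.bd (Pi.single e 1) = Pi.single a 1 + Pi.single b 1 := by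
  ext w
  rw [bd_apply, Finset.sum_eq_single e]
  · rw [Pi.single_eq_same, one_mul, inc_eq h, Pi.add_apply]
  · intro e' _ h'
    simp [h']
  · simp

theorem fun_add_self {α : Type*} (f : α → ZMod 2) : f + f = 0 :=
  funext fun _ => CharTwo.add_self_eq_zero _

theorem exists_bd_of_vconn {H : Finset G.E} {u v : G.V} (h : G.vconn H u v) :
    ∃ z : G.E → ZMod 2, (∀ e ∉ H, z e = 0) ∧ G.bd z = Pi.single u 1 + Pi.single v 1 := by
  induction h with
  | refl =>
    refine ⟨0, fun _ _ => rfl, ?_⟩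
    rw [map_zero, fun_add_self]
  | @tail b c _ h ih =>
    obtain ⟨z, hz, hb⟩ := ih
    obtain ⟨e, he, hab⟩ := h
    refine ⟨z + Pi.single e 1, fun e' he' => ?_, ?_⟩
    · have : e' ≠ e := fun h => he' (h ▸ he)
      simp [hz e' he', this]
    · rw [map_add, hb, bd_single hab, add_assoc, ← add_assoc (Pi.single b 1 : G.V → ZMod 2),
        fun_add_self, zero_add]

theorem sum_bd (C : Finset G.V) (z : G.E → ZMod 2) :
    ∑ w ∈ C, G.bd z w = ∑ e, z e * ∑ w ∈ C, G.inc e w := by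
  simp only [bd_apply, Finset.mul_sum]
  exact Finset.sum_comm

theorem sum_inc (C : Finset G.V) {e : G.E} {a b : G.V} (h : G.ends e = s(a, b)) :
    ∑ w ∈ C, G.inc e w = (if a ∈ C then 1 else 0) + (if b ∈ C then 1 else 0) := by
  simp only [inc_eq h, Finset.sum_add_distrib, Pi.single_apply]
  simp

theorem sum_inc_eq_zero (C : Finset G.V) {e : G.E}
    (h : ∀ a b, G.ends e = s(a, b) → (a ∈ C ↔ b ∈ C)) : ∑ w ∈ C, G.inc e w = 0 := by
  obtain ⟨a, b, hab⟩ := exists_ends e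
  rw [sum_inc C hab, if_congr (h a b hab) rfl rfl, CharTwo.add_self_eq_zero]

theorem sum_bd_eq_zero (C : Finset G.V) (z : G.E → ZMod 2)
    (h : ∀ e, z e ≠ 0 → ∀ a b, G.ends e = s(a, b) → (a ∈ C ↔ b ∈ C)) :
    ∑ w ∈ C, G.bd z w = 0 := by
  rw [sum_bd]
  refine Finset.sum_eq_zero fun e _ => ?_
  by_cases he : z e = 0
  · rw [he, zero_mul]
  · rw [sum_inc_eq_zero C (h e he), mul_zero]

theorem vconn_symm {H : Finset G.E} {u v : G.V} (h : G.vconn H u v) : G.vconn H v u := by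
  induction h with
  | refl => exact Relation.ReflTransGen.refl
  | tail _ h ih =>
    obtain ⟨e, he, hab⟩ := h
    exact Relation.ReflTransGen.head ⟨e, he, hab.trans Sym2.eq_swap⟩ ih

theorem vconn_mono {H H' : Finset G.E} (hH : H ⊆ H') {u v : G.V} (h : G.vconn H u v) :
    G.vconn H' u v := by
  induction h with
  | refl => exact Relation.ReflTransGen.refl
  | tail _ h ih =>
    obtain ⟨e, he, hab⟩ := h
    exact ih.tail ⟨e, hH he, hab⟩

theorem vconn_iff {H : Finset G.E} {u a b : G.V} {e : G.E} (he : e ∈ H)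
    (hab : G.ends e = s(a, b)) : G.vconn H u a ↔ G.vconn H u b :=
  ⟨fun h => h.tail ⟨e, he, hab⟩, fun h => h.tail ⟨e, he, hab.trans Sym2.eq_swap⟩⟩

/-- Relative cycles supported on a subgraph. -/
def relCycles (l : Finset G.V) (H : Finset G.E) : Submodule (ZMod 2) (G.E → ZMod 2) where
  carrier := {z | (∀ w ∉ l, G.bd z w = 0) ∧ ∀ e ∉ H, z e = 0}
  add_mem' := fun {x y} hx hy => ⟨fun w hw => by simp [hx.1 w hw, hy.1 w hw],
    fun e he => by simp [hx.2 e he, hy.2 e he]⟩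
  zero_mem' := ⟨fun w _ => by simp, fun _ _ => rfl⟩
  smul_mem' := fun c x hx => ⟨fun w hw => by simp [hx.1 w hw],
    fun e he => by simp [hx.2 e he]⟩

theorem mem_relCycles {l : Finset G.V} {H : Finset G.E} {z : G.E → ZMod 2} :
    z ∈ relCycles l H ↔ (∀ w ∉ l, G.bd z w = 0) ∧ ∀ e ∉ H, z e = 0 := Iff.rfl

theorem relCycles_inf (l : Finset G.V) (H H' : Finset G.E) :
    relCycles l H ⊓ relCycles l H' = relCycles l (H ∩ H') := by
  ext z
  rw [Submodule.mem_inf, mem_relCycles, mem_relCycles, mem_relCycles]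
  constructor
  · rintro ⟨h1, h2⟩
    refine ⟨h1.1, fun e he => ?_⟩
    by_cases h : e ∈ H
    · exact h2.2 e fun h' => he (Finset.mem_inter.2 ⟨h, h'⟩)
    · exact h1.2 e h
  · rintro ⟨h1, h2⟩
    exact ⟨⟨h1, fun e he => h2 e fun h => he (Finset.mem_inter.1 h).1⟩,
      ⟨h1, fun e he => h2 e fun h => he (Finset.mem_inter.1 h).2⟩⟩

theorem relCycles_mono (l : Finset G.V) {H H' : Finset G.E} (h : H ⊆ H') :
    relCycles l H ≤ relCycles l H' := fun _ hz => ⟨hz.1, fun e he => hz.2 e fun h' => he (h h')⟩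

theorem sum_valence (S : Finset G.E) : ∑ v, G.valence S v = 2 * S.card := by
  simp only [valence]
  rw [Finset.sum_comm, mul_comm, ← smul_eq_mul, ← Finset.sum_const]
  refine Finset.sum_congr rfl fun e _ => ?_
  obtain ⟨a, b, hab⟩ := exists_ends e
  have h2 : ∀ w, s(a, b) = Sym2.diag w ↔ w = a ∧ w = b := fun w => by
    rw [Sym2.diag, Sym2.eq_iff]
    tauto
  have : ∀ w, (if G.ends e = Sym2.diag w then 2 else if w ∈ G.ends e then 1 else 0) =
      (if w = a then 1 else 0) + (if w = b then 1 else 0) := fun w => by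
    simp only [hab, h2, Sym2.mem_iff]
    by_cases ha : w = a <;> by_cases hb : w = b <;> simp [ha, hb]
    all_goals simp_all
  simp [this, Finset.sum_add_distrib]

theorem exists_cycle_of_hasCycle {H : Finset G.E} (h : G.hasCycle H) :
    ∃ z : G.E → ZMod 2, z ≠ 0 ∧ (∀ e ∉ H, z e = 0) ∧ G.bd z = 0 := by
  obtain ⟨S, hSH, ⟨e0, he0⟩, hS⟩ := h
  let VS : Finset G.V := Finset.univ.filter fun v => G.valence S v ≠ 0
  have hVS : ∀ e ∈ S, ∀ v, v ∈ G.ends e → v ∈ VS := fun e he v hv => by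
    refine Finset.mem_filter.2 ⟨Finset.mem_univ _, fun h0 => ?_⟩
    rw [valence, Finset.sum_eq_zero_iff] at h0
    have := h0 e he
    rw [if_pos hv] at this
    split_ifs at this
  have hcard : VS.card ≤ S.card := by
    have h1 : ∑ v ∈ VS, G.valence S v = 2 * S.card := by
      rw [← sum_valence]
      refine Finset.sum_subset (Finset.subset_univ _) fun v _ hv => ?_
      by_contra h
      exact hv (Finset.mem_filter.2 ⟨Finset.mem_univ _, h⟩)
    have h2 : VS.card * 2 ≤ ∑ v ∈ VS, G.valence S v := by
      rw [← smul_eq_mul]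
      refine Finset.card_nsmul_le_sum _ _ _ fun v hv => ?_
      have := (Finset.mem_filter.1 hv).2
      have := hS v
      omega
    omega
  let ι : (S → ZMod 2) →ₗ[ZMod 2] (G.E → ZMod 2) :=
    LinearMap.pi fun e => if h : e ∈ S then LinearMap.proj ⟨e, h⟩ else 0
  have hι1 : ∀ x (e : G.E) (he : e ∈ S), ι x e = x ⟨e, he⟩ := fun x e he => by
    simp [ι, he]
  have hι0 : ∀ x (e : G.E), e ∉ S → ι x e = 0 := fun x e he => by
    simp [ι, he]
  let φ : (S → ZMod 2) →ₗ[ZMod 2] (VS → ZMod 2) :=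
    (LinearMap.funLeft (ZMod 2) (ZMod 2) (fun v : VS => (v : G.V))) ∘ₗ G.bd ∘ₗ ι
  have hφ : ∀ x (v : VS), φ x v = G.bd (ι x) v := fun x v => rfl
  have hsum : ∀ x, ∑ v, φ x v = 0 := fun x => by
    simp only [hφ]
    rw [Finset.sum_coe_sort VS (fun v => G.bd (ι x) v)]
    refine sum_bd_eq_zero _ _ fun e he a b hab => ?_
    have heS : e ∈ S := by
      by_contra h
      exact he (hι0 x e h)
    exact iff_of_true (hVS e heS a (by simp [hab])) (hVS e heS b (by simp [hab]))
  have hnot : ¬ Function.Injective φ := fun hinj => by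
    have h1 := LinearMap.finrank_range_of_inj hinj
    have h2 : LinearMap.range φ = ⊤ := by
      refine Submodule.eq_top_of_finrank_eq (le_antisymm (Submodule.finrank_le _) ?_)
      rw [h1, finrank_pi, finrank_pi, Fintype.card_coe, Fintype.card_coe]
      exact hcard
    obtain ⟨a, b, hab⟩ := exists_ends e0
    obtain ⟨x, hx⟩ := LinearMap.range_eq_top.1 h2
      (Pi.single (⟨a, hVS e0 he0 a (by simp [hab])⟩ : VS) 1)
    have h3 := hsum x
    rw [hx] at h3
    simp at h3
  rw [← LinearMap.ker_eq_bot, Submodule.eq_bot_iff] at hnot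
  push Not at hnot
  obtain ⟨x, hx, hx0⟩ := hnot
  refine ⟨ι x, fun h => hx0 ?_, fun e he => hι0 x e fun h => he (hSH h), ?_⟩
  · ext ⟨e, he⟩
    rw [← hι1 x e he, h]
    rfl
  · ext v
    by_cases hv : v ∈ VS
    · exact congrFun (LinearMap.mem_ker.1 hx) ⟨v, hv⟩
    · rw [bd_apply]
      refine Finset.sum_eq_zero fun e _ => ?_
      by_cases he : e ∈ S
      · have : v ∉ G.ends e := fun h => hv (hVS e he v h)
        simp [inc, this]
      · rw [hι0 x e he, zero_mul]

theorem inX_iff {l : Finset G.V} {H : Finset G.E} :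
    G.inX l H ↔ ∃ z ∈ relCycles l H, z ≠ 0 := by
  constructor
  · rintro (h | ⟨u, v, hu, hv, huv, h⟩)
    · obtain ⟨z, h0, hz, hb⟩ := exists_cycle_of_hasCycle h
      exact ⟨z, ⟨fun w _ => by rw [hb]; rfl, hz⟩, h0⟩
    · obtain ⟨z, hz, hb⟩ := exists_bd_of_vconn h
      refine ⟨z, ⟨fun w hw => ?_, hz⟩, fun h0 => ?_⟩
      · have h1 : w ≠ u := fun h => hw (h ▸ hu)
        have h2 : w ≠ v := fun h => hw (h ▸ hv)
        simp [hb, h1, h2]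
      · have := congrFun hb u
        rw [h0, map_zero] at this
        simp [huv] at this
  · rintro ⟨z, hz, h0⟩
    let S : Finset G.E := Finset.univ.filter fun e => z e ≠ 0
    have hSH : S ⊆ H := fun e he => by
      by_contra h
      exact (Finset.mem_filter.1 he).2 (hz.2 e h)
    have hval : ∀ v, ((G.valence S v : ℕ) : ZMod 2) = G.bd z v := fun v => by
      rw [valence_cast, bd_apply, Finset.sum_filter]
      refine Finset.sum_congr rfl fun e _ => ?_
      have : ∀ x : ZMod 2, x ≠ 0 → x = 1 := by decide
      split_ifs with h
      · rw [this _ h, one_mul]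
      · rw [not_not] at h
        rw [h, zero_mul]
    by_cases hS : ∀ v, G.valence S v ≠ 1
    · left
      refine ⟨S, hSH, ?_, hS⟩
      obtain ⟨e, he⟩ := Function.ne_iff.1 h0
      exact ⟨e, Finset.mem_filter.2 ⟨Finset.mem_univ _, he⟩⟩
    · right
      push Not at hS
      obtain ⟨u, hu⟩ := hS
      have hbu : G.bd z u = 1 := by rw [← hval, hu, Nat.cast_one]
      have hul : u ∈ l := by
        by_contra h
        rw [hz.1 u h] at hbu
        exact zero_ne_one hbu
      by_contra hno
      push Not at hno
      let C : Finset G.V := Finset.univ.filter fun w => G.vconn S u w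
      have huC : u ∈ C := Finset.mem_filter.2 ⟨Finset.mem_univ _, Relation.ReflTransGen.refl⟩
      have h1 : ∑ w ∈ C, G.bd z w = 0 := by
        refine sum_bd_eq_zero _ _ fun e he a b hab => ?_
        simp only [C, Finset.mem_filter, Finset.mem_univ, true_and]
        exact vconn_iff (Finset.mem_filter.2 ⟨Finset.mem_univ _, he⟩) hab
      rw [Finset.sum_eq_single u, hbu] at h1
      · exact one_ne_zero h1
      · intro w hw hwu
        refine hz.1 w fun hwl => hno u w hul hwl (Ne.symm hwu) ?_
        exact vconn_mono hSH (Finset.mem_filter.1 hw).2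
      · exact fun h => absurd huC h

/-- All relative cycles. -/
abbrev allCycles (l : Finset G.V) : Submodule (ZMod 2) (G.E → ZMod 2) :=
  relCycles l Finset.univ

theorem mem_relCycles_iff {l : Finset G.V} {H : Finset G.E} {z : G.E → ZMod 2} :
    z ∈ relCycles l H ↔ z ∈ allCycles l ∧ ∀ e ∉ H, z e = 0 :=
  ⟨fun h => ⟨⟨h.1, fun e he => absurd (Finset.mem_univ e) he⟩, h.2⟩, fun h => ⟨h.1.1, h.2⟩⟩

theorem LSep.eq_zero {l : Finset G.V} {e : G.E} (h : G.LSep l e) {z : G.E → ZMod 2}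
    (hz : z ∈ allCycles l) : z e = 0 := by
  obtain ⟨hsep, ⟨a, ha, hl⟩, -⟩ := h
  obtain ⟨b, hab⟩ := Sym2.mem_iff_exists.1 ha
  have hnab := hsep a b hab
  let C : Finset G.V := Finset.univ.filter fun w => G.vconn (Finset.univ.erase e) b w
  have hC : ∀ w, w ∈ C ↔ G.vconn (Finset.univ.erase e) b w := fun w => by simp [C]
  have h1 : ∑ w ∈ C, G.bd z w = 0 := Finset.sum_eq_zero fun w hw => hz.1 w fun hwl =>
    hnab ((hl w hwl).trans (vconn_symm ((hC w).1 hw)))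
  rw [sum_bd, Finset.sum_eq_single e, sum_inc C hab,
    if_neg (fun h => hnab (vconn_symm ((hC a).1 h))),
    if_pos ((hC b).2 Relation.ReflTransGen.refl), zero_add, mul_one] at h1
  · exact h1
  · intro e' _ he'
    rw [sum_inc_eq_zero, mul_zero]
    intro a' b' hab'
    rw [hC, hC]
    exact vconn_iff (by simp [he']) hab'
  · simp

theorem vconn_erase_or (hconn : G.Conn) {e : G.E} {a b : G.V} (hab : G.ends e = s(a, b))
    (w : G.V) : G.vconn (Finset.univ.erase e) a w ∨ G.vconn (Finset.univ.erase e) b w := by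
  have h := hconn a w
  induction h with
  | refl => exact Or.inl Relation.ReflTransGen.refl
  | tail _ h ih =>
    obtain ⟨e', -, he'⟩ := h
    by_cases hee : e' = e
    · subst hee
      rw [hab, Sym2.eq_iff] at he'
      rcases he' with ⟨-, h⟩ | ⟨h, -⟩
      · exact Or.inr (h ▸ Relation.ReflTransGen.refl)
      · exact Or.inl (h ▸ Relation.ReflTransGen.refl)
    · have hmem : e' ∈ Finset.univ.erase e := by simp [hee]
      exact ih.imp (fun h => h.tail ⟨e', hmem, he'⟩) (fun h => h.tail ⟨e', hmem, he'⟩)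

theorem lSep_of_eq_zero (hconn : G.Conn) {l : Finset G.V} {e : G.E}
    (h : ∀ z ∈ allCycles l, z e = 0) (hne : allCycles l ≠ ⊥) : G.LSep l e := by
  have key : ∀ z : G.E → ZMod 2, z e = 0 → z + Pi.single e 1 ∉ allCycles l := by
    intro z hz hmem
    have := h _ hmem
    simp [hz] at this
  have hpath : ∀ {u v}, G.vconn (Finset.univ.erase e) u v →
      ∃ z : G.E → ZMod 2, z e = 0 ∧ G.bd z = Pi.single u 1 + Pi.single v 1 := fun huv => by
    obtain ⟨z, h1, h2⟩ := exists_bd_of_vconn huv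
    exact ⟨z, h1 e (by simp), h2⟩
  refine ⟨fun a b hab hc => ?_, ?_, ?_⟩
  · obtain ⟨z, h1, h2⟩ := hpath hc
    refine key z h1 ⟨fun w _ => ?_, fun e he => absurd (Finset.mem_univ e) he⟩
    rw [map_add, h2, bd_single hab, fun_add_self]
    rfl
  · obtain ⟨a, b, hab⟩ := exists_ends e
    by_contra hno
    push Not at hno
    obtain ⟨u, hu, hau⟩ := hno a (by simp [hab])
    obtain ⟨v, hv, hbv⟩ := hno b (by simp [hab])
    obtain ⟨z1, h1, h1'⟩ := hpath ((vconn_erase_or hconn hab u).resolve_left hau)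
    obtain ⟨z2, h2, h2'⟩ := hpath ((vconn_erase_or hconn hab v).resolve_right hbv)
    refine key (z1 + z2) (by simp [h1, h2])
      ⟨fun w hw => ?_, fun e he => absurd (Finset.mem_univ e) he⟩
    have hwu : w ≠ u := fun h => hw (h ▸ hu)
    have hwv : w ≠ v := fun h => hw (h ▸ hv)
    rw [map_add, map_add, h1', h2', bd_single hab]
    simp only [Pi.add_apply, Pi.single_eq_of_ne hwu, Pi.single_eq_of_ne hwv, add_zero]
    have := CharTwo.add_self_eq_zero ((Pi.single a 1 + Pi.single b 1 : G.V → ZMod 2) w)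
    rw [Pi.add_apply] at this
    rw [← this]
    ring
  · obtain ⟨z, hz, h0⟩ := (Submodule.ne_bot_iff _).1 hne
    refine inX_iff.2 ⟨z, ⟨hz.1, fun e' he' => ?_⟩, h0⟩
    have : e' = e := by simpa using he'
    rw [this]
    exact h z hz

theorem allCycles_empty (v : G.V) :
    allCycles (G := G) ∅ = allCycles {v} := by
  ext z
  refine ⟨fun h => ⟨fun w _ => h.1 w (by simp), h.2⟩, fun h => ⟨fun w _ => ?_, h.2⟩⟩
  by_cases hw : w = v
  · have h1 : ∑ w, G.bd z w = 0 := sum_bd_eq_zero _ _ fun e _ a b _ => by simp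
    rw [Finset.sum_eq_single v (fun w _ hw => h.1 w (by simpa using hw)) (by simp)] at h1
    rw [hw, h1]
  · exact h.1 w (by simpa using hw)

theorem finrank_allCycles (hconn : G.Conn) {l : Finset G.V} (hl : l.Nonempty) :
    finrank (ZMod 2) (allCycles l) + Fintype.card G.V = Fintype.card G.E + l.card := by
  obtain ⟨u, hu⟩ := hl
  let φ : (G.E → ZMod 2) →ₗ[ZMod 2] ((lᶜ : Finset G.V) → ZMod 2) :=
    (LinearMap.funLeft (ZMod 2) (ZMod 2) (fun v : (lᶜ : Finset G.V) => (v : G.V))) ∘ₗ G.bd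
  have hφ : ∀ x v, φ x v = G.bd x v := fun x v => rfl
  have hker : LinearMap.ker φ = allCycles l := by
    ext z
    rw [LinearMap.mem_ker]
    constructor
    · intro h
      refine ⟨fun w hw => ?_, fun e he => absurd (Finset.mem_univ e) he⟩
      exact congrFun h ⟨w, Finset.mem_compl.2 hw⟩
    · intro h
      ext w
      exact h.1 w (Finset.mem_compl.1 w.2)
  have hsurj : LinearMap.range φ = ⊤ := by
    rw [eq_top_iff, ← (Pi.basisFun (ZMod 2) (lᶜ : Finset G.V)).span_eq, Submodule.span_le]
    rintro _ ⟨w, rfl⟩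
    obtain ⟨z, -, hz⟩ := exists_bd_of_vconn (hconn w u)
    refine ⟨z, ?_⟩
    ext w'
    rw [hφ, hz, Pi.basisFun_apply]
    have : (w' : G.V) ≠ u := fun h => Finset.mem_compl.1 w'.2 (h ▸ hu)
    rw [Pi.add_apply, Pi.single_eq_of_ne this, add_zero, Pi.single_apply, Pi.single_apply]
    exact if_congr Subtype.ext_iff.symm rfl rfl
  have h1 := LinearMap.finrank_range_add_finrank_ker φ
  rw [hker, hsurj, finrank_top, finrank_pi, finrank_pi, Fintype.card_coe, Finset.card_compl] at h1
  have h2 := Finset.card_le_univ l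
  omega

end MGraph

section Retraction

open Module MeasureTheory Set

theorem exists_interpolation (N : ℕ) {ε : ℝ} (hε : 0 < ε) :
    ∃ t c : Fin N → ℝ, (∀ i, 0 < t i ∧ t i < ε) ∧
      ∀ q : Polynomial ℝ, q.degree < N → ∑ i, c i * q.eval (t i) = q.eval 1 := by
  let t : Fin N → ℝ := fun i => ε / ((i : ℝ) + 2)
  have ht : Function.Injective t := fun i j h => by
    have h1 : (0 : ℝ) < (i : ℝ) + 2 := by positivity
    have h2 : (0 : ℝ) < (j : ℝ) + 2 := by positivity
    have h3 : ε / ((i : ℝ) + 2) = ε / ((j : ℝ) + 2) := h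
    rw [div_eq_div_iff h1.ne' h2.ne'] at h3
    have h4 := mul_left_cancel₀ hε.ne' h3
    rw [add_left_inj, Nat.cast_inj] at h4
    exact Fin.ext h4.symm
  refine ⟨t, fun i => (Lagrange.basis Finset.univ t i).eval 1, fun i => ⟨?_, ?_⟩, fun q hq => ?_⟩
  · exact div_pos hε (by positivity)
  · refine div_lt_self hε ?_
    have : (0 : ℝ) ≤ (i : ℝ) := by positivity
    linarith
  · have h := Lagrange.eq_interpolate (s := Finset.univ) (v := t) (f := q) ht.injOn
      (by simpa using hq)
    conv_rhs => rw [h, Lagrange.interpolate_apply, Polynomial.eval_finsetSum]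
    exact Finset.sum_congr rfl fun i _ => by simp [mul_comm]

variable {V : Type*} [NormedAddCommGroup V] [InnerProductSpace ℝ V] [FiniteDimensional ℝ V]

theorem exists_polynomial_det (A : V →L[ℝ] V) :
    ∃ q : Polynomial ℝ, q.degree < (finrank ℝ V + 1 : ℕ) ∧
      ∀ t : ℝ, q.eval t = (1 + t • A).det := by
  let b := finBasis ℝ V
  let M := LinearMap.toMatrix b b (A : V →ₗ[ℝ] V)
  refine ⟨Matrix.det ((Polynomial.X : Polynomial ℝ) • M.map Polynomial.C +
    (1 : Matrix _ _ ℝ).map Polynomial.C), ?_, fun t => ?_⟩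
  · refine Polynomial.degree_le_natDegree.trans_lt (Nat.cast_lt.2 (Nat.lt_succ_of_le ?_))
    simpa using Polynomial.natDegree_det_X_add_C_le M 1
  · rw [← Polynomial.coe_evalRingHom, RingHom.map_det, ContinuousLinearMap.det,
      ← LinearMap.det_toMatrix b]
    congr 1
    have : LinearMap.toMatrix b b ((1 + t • A : V →L[ℝ] V) : V →ₗ[ℝ] V) = 1 + t • M := by
      have h : ((1 + t • A : V →L[ℝ] V) : V →ₗ[ℝ] V) = LinearMap.id + t • (A : V →ₗ[ℝ] V) := rfl
      rw [h, map_add, map_smul, LinearMap.toMatrix_id]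
    rw [this]
    ext i j
    simp [Matrix.one_apply, apply_ite, add_comm]
    exact mul_comm _ _

theorem det_eq_zero_of_norm_eq_one {r : V → V} {x : V} (hr : DifferentiableAt ℝ r x)
    (h1 : ∀ x, ‖r x‖ = 1) : (fderiv ℝ r x).det = 0 := by
  have h2 := hr.hasFDerivAt.norm_sq
  have h3 : (‖r ·‖ ^ 2) = fun _ : V => (1 : ℝ) := by
    ext y
    simp [h1]
  rw [h3] at h2
  have h4 := h2.unique (hasFDerivAt_const 1 x)
  by_contra hdet
  obtain ⟨v, hv⟩ := (LinearMap.equivOfDetNeZero _ hdet).surjective (r x)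
  have h5 := congrArg (fun T : V →L[ℝ] ℝ => T v) h4
  have h6 : fderiv ℝ r x v = r x := hv
  simp [h6, h1] at h5

theorem image_id_add_smul {φ : V → V} {K : NNReal}
    (hK : LipschitzOnWith K φ (Metric.closedBall 0 1))
    (hφ : ∀ x, ‖x‖ = 1 → φ x = 0) (hball : ∀ x, ‖x‖ ≤ 1 → ‖x + φ x‖ ≤ 1) :
    ∃ ε : ℝ, 0 < ε ∧ ε ≤ 1 ∧ ∀ t, 0 < t → t < ε →
      InjOn (fun x => x + t • φ x) (Metric.closedBall 0 1) ∧
      (fun x => x + t • φ x) '' Metric.closedBall 0 1 = Metric.closedBall 0 1 := by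
  obtain ⟨ψ, hψ, heq⟩ := hK.extend_finite_dimension
  set L := lipschitzExtensionConstant V * K
  have hL : (0 : ℝ) ≤ L := L.2
  refine ⟨1 / (2 * (L + 1)), by positivity, ?_, fun t ht0 ht => ?_⟩
  · rw [div_le_one (by positivity)]
    linarith
  have htL : t * (L + 1) < 1 / 2 := by
    rw [lt_div_iff₀ (by positivity)] at ht
    linarith
  have ht1 : t ≤ 1 := by nlinarith
  have hdist : ∀ x y, ‖t • ψ x - t • ψ y‖ ≤ 1 / 2 * ‖x - y‖ := fun x y => by
    rw [← smul_sub, norm_smul, Real.norm_of_nonneg ht0.le]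
    have h1 := hψ.norm_sub_le x y
    have h2 := norm_nonneg (x - y)
    nlinarith [mul_le_mul_of_nonneg_left h1 ht0.le]
  have hc : ∀ x ∈ Metric.closedBall (0 : V) 1, x + t • φ x = x + t • ψ x := fun x hx => by
    rw [heq hx]
  refine ⟨fun x hx y hy hxy => ?_, Subset.antisymm ?_ fun y hy => ?_⟩
  · replace hxy : x + t • ψ x = y + t • ψ y := by
      rw [← hc x hx, ← hc y hy]
      exact hxy
    have h1 := hdist y x
    have h2 : t • ψ y - t • ψ x = x - y := by
      rw [sub_eq_sub_iff_add_eq_add, hxy, add_comm]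
    rw [h2, norm_sub_rev y x] at h1
    have h3 := norm_nonneg (x - y)
    exact sub_eq_zero.1 (norm_eq_zero.1 (by linarith))
  · rintro _ ⟨x, hx, rfl⟩
    rw [mem_closedBall_zero_iff] at hx ⊢
    have : x + t • φ x = (1 - t) • x + t • (x + φ x) := by module
    calc ‖x + t • φ x‖ ≤ ‖(1 - t) • x‖ + ‖t • (x + φ x)‖ := this ▸ norm_add_le _ _
      _ ≤ (1 - t) * 1 + t * 1 := by
        rw [norm_smul, norm_smul, Real.norm_of_nonneg ht0.le, Real.norm_of_nonneg (by linarith)]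
        exact add_le_add (mul_le_mul_of_nonneg_left hx (by linarith))
          (mul_le_mul_of_nonneg_left (hball x hx) ht0.le)
      _ = 1 := by ring
  · have hcon : ContractingWith (1 / 2) fun x => y - t • ψ x := by
      refine ⟨by rw [← NNReal.coe_lt_coe]; norm_num, LipschitzWith.of_dist_le_mul fun a b => ?_⟩
      rw [dist_eq_norm, dist_eq_norm]
      have := hdist b a
      rw [norm_sub_rev b a] at this
      simpa using this
    have hfix := hcon.fixedPoint_isFixedPt
    set x := hcon.fixedPoint
    have hx : x + t • ψ x = y := by
      have : y - t • ψ x = x := hfix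
      exact (sub_eq_iff_eq_add.1 this).symm
    have hxB : x ∈ Metric.closedBall (0 : V) 1 := by
      rw [mem_closedBall_zero_iff] at hy ⊢
      by_contra! hx1
      have hx0 : 0 < ‖x‖ := by linarith
      have hun : ‖(‖x‖⁻¹ • x)‖ = 1 := by
        rw [norm_smul, norm_inv, norm_norm, inv_mul_cancel₀ hx0.ne']
      have hu0 : ψ (‖x‖⁻¹ • x) = 0 := by
        rw [← heq (mem_closedBall_zero_iff.2 hun.le), hφ _ hun]
      have h1 := hdist x (‖x‖⁻¹ • x)
      rw [hu0, smul_zero, sub_zero] at h1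
      have h2 : ‖x - ‖x‖⁻¹ • x‖ = ‖x‖ - 1 := by
        have : x - ‖x‖⁻¹ • x = (1 - ‖x‖⁻¹) • x := by module
        rw [this, norm_smul, Real.norm_of_nonneg (by
          have := inv_le_one_of_one_le₀ hx1.le
          linarith), sub_mul, inv_mul_cancel₀ hx0.ne', one_mul]
      have h3 : ‖x‖ - ‖t • ψ x‖ ≤ ‖y‖ := by
        rw [← hx]
        have := norm_sub_norm_le x (-(t • ψ x))
        rwa [norm_neg, sub_neg_eq_add] at this
      linarith
    exact ⟨x, hxB, by simp only [hc x hxB, hx]⟩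

/-- There is no continuously differentiable map to the unit sphere restricting to the identity on
the sphere. -/
theorem no_smooth_retraction {r : V → V} (hr : ContDiff ℝ 1 r) (h1 : ∀ x, ‖r x‖ = 1)
    (hid : ∀ x, ‖x‖ = 1 → r x = x) : False := by
  borelize V
  let μ : Measure V := Measure.addHaar
  let B : Set V := Metric.closedBall 0 1
  have hB : IsCompact B := isCompact_closedBall 0 1
  let A : V → V →L[ℝ] V := fun x => fderiv ℝ r x - 1
  have hA : Continuous A := (hr.continuous_fderiv one_ne_zero).sub continuous_const
  have hdc : Continuous fun T : V →L[ℝ] V => T.det := ContinuousLinearMap.continuous_det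
  obtain ⟨K, hK⟩ := (hr.sub contDiff_id).contDiffOn.exists_lipschitzOnWith one_ne_zero
    (convex_closedBall 0 1) hB
  obtain ⟨ε, hε, -, himg⟩ := image_id_add_smul hK (fun x hx => sub_eq_zero.2 (hid x hx))
    (fun x _ => by simp [h1])
  have hcont : Continuous fun p : ℝ × V => (1 + p.1 • A p.2).det :=
    hdc.comp (continuous_const.add (continuous_fst.smul (hA.comp continuous_snd)))
  have hpos : ∀ᶠ t in nhds (0 : ℝ), ∀ x ∈ B, 0 < (1 + t • A x).det := by
    refine hB.eventually_forall_of_forall_eventually fun x _ => ?_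
    refine hcont.continuousAt.eventually (lt_mem_nhds ?_)
    simp [ContinuousLinearMap.det]
  obtain ⟨δ, hδ, hpos⟩ := Metric.eventually_nhds_iff.1 hpos
  have hint : ∀ t : ℝ, IntegrableOn (fun x => (1 + t • A x).det) B μ := fun t =>
    (hcont.comp (Continuous.prodMk_right t)).continuousOn.integrableOn_compact hB
  have hvol : ∀ t, 0 < t → t < min ε δ → ∫ x in B, (1 + t • A x).det ∂μ = μ.real B := by
    intro t ht0 ht
    have hp : ∀ x ∈ B, 0 < (1 + t • A x).det := by
      refine hpos ?_
      rw [Real.dist_eq, sub_zero, abs_of_pos ht0]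
      exact ht.trans_le (min_le_right _ _)
    obtain ⟨hinj, him⟩ := himg t ht0 (ht.trans_le (min_le_left _ _))
    have hder : ∀ x ∈ B, HasFDerivWithinAt (fun x => x + t • (r x - id x)) (1 + t • A x) B x :=
      fun x _ => by
        have h := (hr.differentiable one_ne_zero x).hasFDerivAt
        exact ((hasFDerivAt_id x).add
          ((h.sub (hasFDerivAt_id x)).const_smul t)).hasFDerivWithinAt
    have := lintegral_abs_det_fderiv_eq_addHaar_image μ hB.measurableSet hder hinj
    rw [him] at this
    rw [integral_eq_lintegral_of_nonneg_ae, Measure.real, ← this]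
    · congr 1
      refine setLIntegral_congr_fun hB.measurableSet fun x hx => ?_
      simp only [abs_of_pos (hp x hx)]
    · exact (ae_restrict_iff' hB.measurableSet).2
        (Filter.Eventually.of_forall fun x hx => (hp x hx).le)
    · exact (hint t).aestronglyMeasurable
  obtain ⟨t, c, ht, hq⟩ := exists_interpolation (finrank ℝ V + 1) (lt_min hε hδ)
  have hc : ∑ i, c i = 1 := by
    have := hq 1 (by
      rw [Polynomial.degree_one]
      exact_mod_cast Nat.succ_pos _)
    simpa using this
  have hzero : ∀ x, ∑ i, c i * (1 + t i • A x).det = 0 := fun x => by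
    obtain ⟨q, hdeg, hev⟩ := exists_polynomial_det (A x)
    simp only [← hev]
    rw [hq q hdeg, hev, one_smul, add_sub_cancel]
    exact det_eq_zero_of_norm_eq_one (hr.differentiable one_ne_zero x) h1
  have hI : ∫ x in B, ∑ i, c i * (1 + t i • A x).det ∂μ = μ.real B := by
    rw [integral_finsetSum _ fun i _ => (hint (t i)).const_mul (c i)]
    simp only [integral_const_mul]
    rw [Finset.sum_congr rfl fun i _ => by rw [hvol (t i) (ht i).1 (ht i).2],
      ← Finset.sum_mul, hc, one_mul]
  simp only [hzero, integral_zero] at hI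
  have hB0 : 0 < μ B := Metric.measure_closedBall_pos μ 0 one_pos
  exact (ENNReal.toReal_pos hB0.ne' hB.measure_lt_top.ne).ne hI

variable (V) in
theorem not_contractible_sphere :
    ¬ ContractibleSpace (Metric.sphere (0 : V) 1) := by
  intro hcontr
  obtain ⟨q, ⟨h⟩⟩ := id_nullhomotopic (Metric.sphere (0 : V) 1)
  let u : V → Metric.sphere (0 : V) 1 := fun x =>
    if hx : x = 0 then q else ⟨‖x‖⁻¹ • x, by
      rw [mem_sphere_zero_iff_norm, norm_smul, norm_inv, norm_norm,
        inv_mul_cancel₀ (norm_ne_zero_iff.2 hx)]⟩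
  have hu : ∀ x, x ≠ 0 → (u x : V) = ‖x‖⁻¹ • x := fun x hx => by
    simp only [u, dif_neg hx]
  have huc : ∀ x, x ≠ 0 → ContinuousAt u x := fun x hx => by
    rw [Topology.IsInducing.subtypeVal.continuousAt_iff]
    have h1 : ContinuousAt (fun x : V => ‖x‖⁻¹ • x) x :=
      (continuous_norm.continuousAt.inv₀ (norm_ne_zero_iff.2 hx)).smul continuousAt_id
    refine h1.congr ?_
    filter_upwards [isOpen_ne.mem_nhds hx] with y hy
    exact (hu y hy).symm
  let τ : V → unitInterval := fun x => projIcc 0 1 zero_le_one (2 * (3 / 4 - ‖x‖))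
  have hτ : Continuous τ := continuous_projIcc.comp (by fun_prop)
  let F : V → V := fun x => h (τ x, u x)
  have hF1 : ∀ x, ‖F x‖ = 1 := fun x => mem_sphere_zero_iff_norm.1 (h (τ x, u x)).2
  have hFc : Continuous F := by
    rw [continuous_iff_continuousAt]
    intro x
    by_cases hx : x = 0
    · refine (continuousAt_const (y := (q : V))).congr ?_
      have h1 : ∀ᶠ y : V in nhds x, ‖y‖ < 1 / 4 :=
        continuous_norm.continuousAt.eventually (gt_mem_nhds (by simp [hx]))
      filter_upwards [h1] with y hy
      have h2 : τ y = 1 := projIcc_of_right_le _ (by linarith)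
      simp only [F, h2, ContinuousMap.Homotopy.apply_one, ContinuousMap.const_apply]
    · exact (continuous_subtype_val.comp h.continuous).continuousAt.comp
        (hτ.continuousAt.prodMk (huc x hx))
  have hF : ∀ x, 3 / 4 ≤ ‖x‖ → F x = ‖x‖⁻¹ • x := fun x hx => by
    have h2 : τ x = 0 := projIcc_of_le_left _ (by linarith)
    have h0 : x ≠ 0 := norm_ne_zero_iff.1 (by linarith)
    simp only [F, h2, ContinuousMap.Homotopy.apply_zero, ContinuousMap.id_apply, hu x h0]
  obtain ⟨g, hg, hgd, hgS, -⟩ := hFc.exists_contDiff_approx_and_eqOn 1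
    (ε := fun _ => 1 / 2) continuous_const (fun _ => by norm_num)
    (S := {x | 7 / 8 ≤ ‖x‖}) (U := {x | 3 / 4 < ‖x‖})
    (isClosed_le continuous_const continuous_norm)
    ((isOpen_lt continuous_const continuous_norm).mem_nhdsSet.2 fun x hx => by
      have : 7 / 8 ≤ ‖x‖ := hx
      change 3 / 4 < ‖x‖
      linarith) (by
      have h1 : ContDiffOn ℝ 1 (fun x : V => ‖x‖⁻¹ • x) {x | 3 / 4 < ‖x‖} := fun x hx => by
        have hx' : 3 / 4 < ‖x‖ := hx
        have h0 : x ≠ 0 := norm_ne_zero_iff.1 (by linarith)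
        exact (((contDiffAt_norm ℝ h0).inv (norm_ne_zero_iff.2 h0)).smul
          contDiffAt_id).contDiffWithinAt
      exact h1.congr fun x hx => hF x (le_of_lt hx))
  have hg0 : ∀ x, g x ≠ 0 := fun x h0 => by
    have h1 := hgd x
    rw [h0, dist_zero_left, hF1] at h1
    norm_num at h1
  refine no_smooth_retraction (r := fun x => ‖g x‖⁻¹ • g x) ?_ (fun x => ?_) fun x hx => ?_
  · exact ((hg.norm ℝ hg0).inv fun x => norm_ne_zero_iff.2 (hg0 x)).smul hg
  · rw [norm_smul, norm_inv, norm_norm, inv_mul_cancel₀ (norm_ne_zero_iff.2 (hg0 x))]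
  · have h1 : g x = x := by
      rw [hgS (by change 7 / 8 ≤ ‖x‖; rw [hx]; norm_num), hF x (by rw [hx]; norm_num), hx]
      simp
    simp only [h1, hx, inv_one, one_smul]

end Retraction

theorem not_contractible_sphereWedge (ι : Type) (d : ℕ) [hι : Nonempty ι] :
    ¬ ContractibleSpace (SphereWedge ι d) := by
  intro hcontr
  obtain ⟨j⟩ := hι
  apply not_contractible_sphere (EuclideanSpace ℝ (Fin (d + 1)))
  let f : C(Metric.sphere (0 : EuclideanSpace ℝ (Fin (d + 1))) 1, SphereWedge ι d) :=
    ⟨fun x => Quot.mk _ (j, x), SphereWedge.continuous_mk j⟩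
  let g : C(SphereWedge ι d, Metric.sphere (0 : EuclideanSpace ℝ (Fin (d + 1))) 1) :=
    ⟨fun w => SphereWedge.toPi ι d w j,
      (continuous_apply j).comp (SphereWedge.continuous_toPi ι d)⟩
  have hgf : g.comp f = ContinuousMap.id _ := by
    ext1 x
    exact if_pos rfl
  rw [contractible_iff_id_nullhomotopic, ← hgf]
  have := ((id_nullhomotopic (SphereWedge ι d)).comp_left f).comp_right g
  simpa using this

namespace AbsSC

theorem chainsIn_homotopyEquiv {M N : Type*} [Fintype M] [Fintype N] [PartialOrder M]
    [PartialOrder N] {S : Set M} {S' : Set N} {f : M → N} {g : N → M} (hfS : Set.MapsTo f S S')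
    (hf : MonotoneOn f S) (hgS : Set.MapsTo g S' S) (hg : MonotoneOn g S')
    (hgf : ∀ x ∈ S, g (f x) ≤ x) (hfg : ∀ y ∈ S', f (g y) ≤ y) :
    Nonempty (ContinuousMap.HomotopyEquiv (chainsIn S).realization
      (chainsIn S').realization) := by
  refine ⟨⟨map (simplicial_chainsIn hfS hf), map (simplicial_chainsIn hgS hg), ?_, ?_⟩⟩
  · have h := chainsIn_homotopic (hgS.comp hfS) (hg.comp hf hfS) (Set.mapsTo_id S)
      monotoneOn_id hgf
    rwa [map_id, ← map_comp (simplicial_chainsIn hfS hf) (simplicial_chainsIn hgS hg)] at h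
  · have h := chainsIn_homotopic (hfS.comp hgS) (hf.comp hg hgS) (Set.mapsTo_id S')
      monotoneOn_id hfg
    rwa [map_id, ← map_comp (simplicial_chainsIn hgS hg) (simplicial_chainsIn hfS hf)] at h

theorem orderComplex_eq_chainsIn (M : Type*) [Preorder M] :
    orderComplex M = chainsIn (Set.univ : Set M) := by
  unfold orderComplex chainsIn
  congr 1
  ext σ
  simp

end AbsSC

namespace MGraph

open Module

variable {G : MGraph} {l : Finset G.V}

instance inst_s6 (l : Finset G.V) : Fintype (G.XP l) :=
  inferInstanceAs (Fintype {_H : Finset G.E // _})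

/-- The lattice of subspaces of relative cycles supported on subgraphs. -/
def CycleLattice (G : MGraph) (l : Finset G.V) : Type :=
  {W : Submodule (ZMod 2) (G.E → ZMod 2) // ∃ H, W = relCycles l H}

namespace CycleLattice

instance : SemilatticeInf (CycleLattice G l) :=
  Subtype.semilatticeInf fun {_ _} ⟨H, h⟩ ⟨H', h'⟩ => ⟨H ∩ H', by rw [h, h', relCycles_inf]⟩

instance : Fintype (CycleLattice G l) := by
  have : Finite (Submodule (ZMod 2) (G.E → ZMod 2)) :=
    Finite.of_injective (fun W => (W : Set (G.E → ZMod 2))) SetLike.coe_injective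
  have : Finite (CycleLattice G l) := Subtype.finite
  exact Fintype.ofFinite _

/-- The subspace of relative cycles of a subgraph. -/
def mk (l : Finset G.V) (H : Finset G.E) : CycleLattice G l := ⟨relCycles l H, H, rfl⟩

instance : OrderTop (CycleLattice G l) where
  top := mk l Finset.univ
  le_top := by
    rintro ⟨_, H, rfl⟩
    exact relCycles_mono l (Finset.subset_univ H)

theorem le_iff {x y : CycleLattice G l} : x ≤ y ↔ x.1 ≤ y.1 := Iff.rfl

theorem lt_iff {x y : CycleLattice G l} : x < y ↔ x.1 < y.1 := Iff.rfl

theorem top_val : (⊤ : CycleLattice G l).1 = allCycles l := rfl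

theorem inf_val (x y : CycleLattice G l) : (x ⊓ y).1 = x.1 ⊓ y.1 := rfl

theorem le_allCycles (x : CycleLattice G l) : x.1 ≤ allCycles l := le_iff.1 le_top

theorem le_mk_iff {x : CycleLattice G l} {H : Finset G.E} :
    x ≤ mk l H ↔ ∀ z ∈ x.1, ∀ e ∉ H, z e = 0 :=
  ⟨fun h _ hz => (h hz).2, fun h z hz => mem_relCycles_iff.2 ⟨le_allCycles x hz, h z hz⟩⟩

theorem le_mk_erase_iff {x : CycleLattice G l} {e : G.E} :
    x ≤ mk l (Finset.univ.erase e) ↔ ∀ z ∈ x.1, z e = 0 := by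
  simp [le_mk_iff]

/-- The codimension of an element. -/
def corank (x : CycleLattice G l) : ℕ := finrank (ZMod 2) (allCycles l) - finrank (ZMod 2) x.1

theorem finrank_le (x : CycleLattice G l) :
    finrank (ZMod 2) x.1 ≤ finrank (ZMod 2) (allCycles l) :=
  Submodule.finrank_mono (le_allCycles x)

theorem corank_lt (x y : CycleLattice G l) (h : x < y) : corank y < corank x := by
  have h1 := Submodule.finrank_lt_finrank_of_lt (lt_iff.1 h)
  have h2 := finrank_le y
  unfold corank
  omega

theorem finrank_inf_add_one {x : CycleLattice G l} {e : G.E}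
    (h : ¬ x ≤ mk l (Finset.univ.erase e)) :
    finrank (ZMod 2) (x ⊓ mk l (Finset.univ.erase e)).1 + 1 = finrank (ZMod 2) x.1 := by
  let p : Dual (ZMod 2) x.1 := (LinearMap.proj e : (G.E → ZMod 2) →ₗ[ZMod 2] ZMod 2) ∘ₗ
    x.1.subtype
  have hp : p ≠ 0 := fun h0 => h <| le_mk_erase_iff.2 fun z hz =>
    LinearMap.congr_fun h0 (⟨z, hz⟩ : x.1)
  have : (x ⊓ mk l (Finset.univ.erase e)).1 = Submodule.map x.1.subtype (LinearMap.ker p) := by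
    ext z
    rw [inf_val, Submodule.mem_inf, Submodule.mem_map]
    constructor
    · rintro ⟨h1, h2⟩
      exact ⟨⟨z, h1⟩, h2.2 e (by simp), rfl⟩
    · rintro ⟨⟨z, h1⟩, h2, rfl⟩
      refine ⟨h1, mem_relCycles_iff.2 ⟨le_allCycles x h1, fun e' he' => ?_⟩⟩
      have : e' = e := by simpa using he'
      rw [this]
      exact h2
  rw [← Module.Dual.finrank_ker_add_one_of_ne_zero hp, this, Submodule.finrank_map_subtype_eq]

theorem corank_inf (x : CycleLattice G l) (e : G.E) (h : ¬ x ≤ mk l (Finset.univ.erase e)) :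
    corank (x ⊓ mk l (Finset.univ.erase e)) = corank x + 1 := by
  have h1 := finrank_inf_add_one h
  have h2 := finrank_le x
  unfold corank
  omega

theorem exists_le_mk_erase (x y : CycleLattice G l) (h : x < y) :
    ∃ e, x ≤ mk l (Finset.univ.erase e) ∧ ¬ y ≤ mk l (Finset.univ.erase e) := by
  obtain ⟨z, hz, hzx⟩ := SetLike.exists_of_lt (lt_iff.1 h)
  obtain ⟨_, H, rfl⟩ := x
  have : ¬ ∀ e ∉ H, z e = 0 := fun h' => hzx (mem_relCycles_iff.2 ⟨le_allCycles y hz, h'⟩)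
  push Not at this
  obtain ⟨e, he, hze⟩ := this
  exact ⟨e, le_mk_erase_iff.2 fun z' hz' => hz'.2 e he, fun h' => hze (le_mk_erase_iff.1 h' z hz)⟩

/-- The set of edges supporting a subspace of relative cycles. -/
def support (x : CycleLattice G l) : Finset G.E := Finset.univ.filter fun e => ∃ z ∈ x.1, z e ≠ 0

theorem support_mono {x y : CycleLattice G l} (h : x ≤ y) : support x ⊆ support y := by
  intro e he
  obtain ⟨z, hz, h0⟩ := (Finset.mem_filter.1 he).2
  exact Finset.mem_filter.2 ⟨Finset.mem_univ _, z, h hz, h0⟩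

theorem support_mk_subset (l : Finset G.V) (H : Finset G.E) : support (mk l H) ⊆ H := by
  intro e he
  obtain ⟨z, hz, h0⟩ := (Finset.mem_filter.1 he).2
  by_contra h
  exact h0 (hz.2 e h)

theorem mk_support (x : CycleLattice G l) : mk l (support x) = x := by
  apply le_antisymm
  · obtain ⟨_, H, rfl⟩ := x
    exact relCycles_mono l (support_mk_subset l H)
  · refine le_mk_iff.2 fun z hz e he => ?_
    by_contra h
    exact he (Finset.mem_filter.2 ⟨Finset.mem_univ _, z, hz, h⟩)

theorem mk_empty_val : (mk l ∅ : CycleLattice G l).1 = ⊥ :=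
  (Submodule.eq_bot_iff _).2 fun _ hz => funext fun e => hz.2 e (Finset.notMem_empty e)

theorem mk_empty_lt_iff {x : CycleLattice G l} : mk l ∅ < x ↔ x.1 ≠ ⊥ := by
  rw [lt_iff, mk_empty_val, bot_lt_iff_ne_bot]

theorem inX_iff_ne_bot {H : Finset G.E} : G.inX l H ↔ (mk l H).1 ≠ ⊥ := by
  rw [inX_iff, Submodule.ne_bot_iff]
  rfl

theorem mk_mem_Ioo (hcol : ∀ e, ∃ z ∈ allCycles l, z e ≠ 0) (H : G.XP l) :
    mk l H.1 ∈ Set.Ioo (mk l ∅) ⊤ := by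
  refine ⟨mk_empty_lt_iff.2 (inX_iff_ne_bot.1 H.2.2), lt_of_le_of_ne le_top fun h => ?_⟩
  obtain ⟨e, -, he⟩ := Finset.exists_of_ssubset H.2.1
  obtain ⟨z, hz, h0⟩ := hcol e
  exact h0 (le_mk_iff.1 h.ge z hz e he)

theorem support_prop {x : CycleLattice G l} (hx : x ∈ Set.Ioo (mk l ∅) ⊤) :
    support x ⊂ Finset.univ ∧ G.inX l (support x) := by
  constructor
  · rw [Finset.ssubset_univ_iff]
    intro h
    have := mk_support x
    rw [h] at this
    exact hx.2.ne this.symm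
  · rw [inX_iff_ne_bot, mk_support]
    exact mk_empty_lt_iff.1 hx.1

theorem homotopyEquiv_XP (hcol : ∀ e, ∃ z ∈ allCycles l, z e ≠ 0) [Nonempty (G.XP l)] :
    Nonempty (ContinuousMap.HomotopyEquiv (AbsSC.realization (orderComplex (G.XP l)))
      (AbsSC.chainsIn (Set.Ioo (mk l ∅) (⊤ : CycleLattice G l))).realization) := by
  rw [AbsSC.orderComplex_eq_chainsIn]
  let g : CycleLattice G l → G.XP l := fun x =>
    if h : x ∈ Set.Ioo (mk l ∅) ⊤ then ⟨support x, support_prop h⟩ else Classical.arbitrary _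
  have hg : ∀ x ∈ Set.Ioo (mk l ∅) (⊤ : CycleLattice G l), (g x).1 = support x := fun x hx =>
    congrArg Subtype.val (dif_pos hx)
  refine AbsSC.chainsIn_homotopyEquiv (f := fun H : G.XP l => mk l H.1) (g := g)
    (fun H _ => mk_mem_Ioo hcol H) (fun H _ H' _ h => relCycles_mono l h) (fun _ _ => trivial)
    (fun x hx y hy h => ?_) (fun H _ => ?_) (fun x hx => ?_)
  · change (g x).1 ⊆ (g y).1
    rw [hg x hx, hg y hy]
    exact support_mono h
  · change (g _).1 ⊆ H.1
    rw [hg _ (mk_mem_Ioo hcol H)]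
    exact support_mk_subset l H.1
  · simp only [hg x hx, mk_support, le_refl]

theorem nonempty_XP (h2 : 2 ≤ finrank (ZMod 2) (allCycles l)) : Nonempty (G.XP l) := by
  have hbot : mk l ∅ < (⊤ : CycleLattice G l) := mk_empty_lt_iff.2 fun h => by
    rw [top_val] at h
    rw [h, finrank_bot] at h2
    omega
  obtain ⟨e, -, he⟩ := exists_le_mk_erase _ _ hbot
  have h3 := finrank_inf_add_one he
  rw [top_inf_eq, top_val] at h3
  refine ⟨⟨Finset.univ.erase e, Finset.erase_ssubset (Finset.mem_univ e),
    inX_iff_ne_bot.2 fun h => ?_⟩⟩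
  rw [h, finrank_bot] at h3
  omega

theorem isEmpty_XP (hcol : ∀ e, ∃ z ∈ allCycles l, z e ≠ 0)
    (h1 : finrank (ZMod 2) (allCycles l) ≤ 1) : IsEmpty (G.XP l) := by
  refine ⟨fun H => ?_⟩
  have h := mk_mem_Ioo hcol H
  have h2 := Submodule.finrank_lt_finrank_of_lt (lt_iff.1 h.1)
  have h3 := Submodule.finrank_lt_finrank_of_lt (lt_iff.1 h.2)
  rw [top_val] at h3
  omega

theorem exists_homotopyEquiv {d : ℕ} (hcol : ∀ e, ∃ z ∈ allCycles l, z e ≠ 0)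
    (hd : finrank (ZMod 2) (allCycles l) = d + 2) :
    ∃ ι : Type, Nonempty ι ∧ Nonempty (ContinuousMap.HomotopyEquiv
      (AbsSC.realization (orderComplex (G.XP l))) (SphereWedge ι d)) := by
  have := nonempty_XP (l := l) (by omega)
  obtain ⟨h1⟩ := homotopyEquiv_XP hcol
  obtain ⟨ι, hι, ⟨h2⟩⟩ := AbsSC.exists_homotopyEquiv_sphereWedge (M := CycleLattice G l)
    (cr := corank) (c := fun e => mk l (Finset.univ.erase e)) (w := mk l ∅) (d := d)
    corank_lt corank_inf exists_le_mk_erase (Nat.sub_self _) (by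
      rw [corank, mk_empty_val, finrank_bot, hd, Nat.sub_zero])
  exact ⟨ι, hι, ⟨h1.trans h2⟩⟩

end CycleLattice

theorem contractible_of_lSep {e : G.E} (h : G.LSep l e) :
    ContractibleSpace (AbsSC.realization (orderComplex (G.XP l))) := by
  rw [AbsSC.orderComplex_eq_chainsIn]
  have herase : ∀ H : G.XP l, G.inX l (H.1.erase e) := fun H => by
    obtain ⟨z, hz, h0⟩ := inX_iff.1 H.2.2
    refine inX_iff.2 ⟨z, ⟨hz.1, fun e' he' => ?_⟩, h0⟩
    by_cases hee : e' = e
    · rw [hee]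
      exact h.eq_zero (mem_relCycles_iff.1 hz).1
    · exact hz.2 e' fun hm => he' (Finset.mem_erase.2 ⟨hee, hm⟩)
  refine AbsSC.contractible_chainsIn (f := fun H : G.XP l => ⟨H.1.erase e,
      (Finset.erase_subset e _).trans_ssubset H.2.1, herase H⟩)
    (a := ⟨Finset.univ.erase e, Finset.erase_ssubset (Finset.mem_univ e), h.2.2⟩)
    (fun _ _ => trivial) (fun H _ H' _ hle => ?_) (fun H _ => ?_) trivial (fun H _ => ?_)
  · exact Finset.erase_subset_erase e hle
  · exact Finset.erase_subset e H.1
  · exact Finset.erase_subset_erase e (Finset.subset_univ _)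

theorem isEmpty_realization {V : Type*} [IsEmpty V] (K : AbsSC V) : IsEmpty K.realization := by
  refine ⟨fun p => ?_⟩
  obtain ⟨s, -, -, -, h⟩ := p.2
  rw [Finset.eq_empty_of_isEmpty s] at h
  simp at h

end MGraph

/-- Let `(G,l)` be a connected finite labelled graph (no
isolated vertices) with `k` labelled vertices and fundamental group of rank
`n`, and let `d = n + k - 3` if `k ≥ 1` and `d = n - 2` if `k = 0`. Then the
order complex of `X(G,l)` is homotopy equivalent to a wedge of `d`-spheres, and
it is contractible if and only if `G` contains an `l`-separating edge. -/
theorem XP_wedge_of_spheres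
    (G : MGraph) (l : Finset G.V) (hconn : G.Conn) (hiso : G.NoIsolated)
    (hne : Nonempty G.V)
    (n : ℕ) (hrank : Fintype.card G.E + 1 = Fintype.card G.V + n) :
    IsWedgeOfSpheres
        (if 1 ≤ l.card then (n : ℤ) + l.card - 3 else (n : ℤ) - 2)
        (AbsSC.realization (orderComplex (G.XP l))) ∧
      (ContractibleSpace (AbsSC.realization (orderComplex (G.XP l))) ↔
        ∃ e : G.E, G.LSep l e) := by
  set d : ℤ := if 1 ≤ l.card then (n : ℤ) + l.card - 3 else (n : ℤ) - 2 with hd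
  have hs : (Module.finrank (ZMod 2) (MGraph.allCycles l) : ℤ) = d + 2 := by
    rcases l.eq_empty_or_nonempty with rfl | hl
    · obtain ⟨v⟩ := hne
      have := MGraph.finrank_allCycles hconn (Finset.singleton_nonempty v)
      rw [MGraph.allCycles_empty v]
      rw [Finset.card_singleton] at this
      simp only [Finset.card_empty] at hd
      norm_num at hd
      omega
    · have := MGraph.finrank_allCycles hconn hl
      rw [if_pos (Nat.one_le_iff_ne_zero.2 (Finset.card_pos.2 hl).ne')] at hd
      omega
  by_cases hsep : ∃ e : G.E, G.LSep l e
  · obtain ⟨e, he⟩ := hsep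
    have := MGraph.contractible_of_lSep he
    exact ⟨Or.inl this, fun _ => ⟨e, he⟩, fun _ => this⟩
  have hcol : MGraph.allCycles l ≠ ⊥ → ∀ e, ∃ z ∈ MGraph.allCycles l, z e ≠ 0 := by
    intro hbot e
    by_contra hno
    push Not at hno
    exact hsep ⟨e, MGraph.lSep_of_eq_zero hconn hno hbot⟩
  rcases lt_or_ge d 0 with hd0 | hd0
  · have : IsEmpty (G.XP l) := by
      by_cases hbot : MGraph.allCycles l = ⊥
      · refine ⟨fun H => ?_⟩
        obtain ⟨z, hz, h0⟩ := MGraph.inX_iff.1 H.2.2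
        have h1 := (MGraph.mem_relCycles_iff.1 hz).1
        rw [hbot] at h1
        exact h0 h1
      · exact MGraph.CycleLattice.isEmpty_XP (hcol hbot) (by omega)
    have hemp := MGraph.isEmpty_realization (orderComplex (G.XP l))
    refine ⟨Or.inr (Or.inl ⟨hd0, hemp⟩), fun h => ?_, fun h => absurd h hsep⟩
    obtain ⟨q, -⟩ := id_nullhomotopic (AbsSC.realization (orderComplex (G.XP l)))
    exact (hemp.false q).elim
  · have hbot : MGraph.allCycles l ≠ ⊥ := fun h => by
      rw [h, finrank_bot] at hs
      omega
    obtain ⟨ι, hι, ⟨he⟩⟩ := MGraph.CycleLattice.exists_homotopyEquiv (d := d.toNat)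
      (hcol hbot) (by omega)
    refine ⟨Or.inr (Or.inr ⟨hd0, ι, hι, ⟨he⟩⟩), fun h => ?_, fun h => absurd h hsep⟩
    exact absurd he.symm.contractibleSpace (not_contractible_sphereWedge ι d.toNat)
end
end
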